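/- Let d ≥ k ≥ 1 and let S₁, S₂ ⊂ I^d be closed cubes. Suppose that for all ν₁ ∈ S₁ and ν₂ ∈ S₂ the vectors ∇φ_j(ν₂) − ∇φ_j(ν₁), j = 1,…,k, are linearly independent, and that condition (N) holds: for every ν₁ ∈ S₁, ν₂ ∈ S₂, every t ∈ ℝ^k with |t| = 1 and ν ∈ {ν₁, ν₂}, det[N(ν₂,ν₁)(Σ_{i=1}^k t_i Hφ_i(ν)) N(ν₂,ν₁)^t] ≠ 0, where N(ν₂,ν₁) is a (d−k)×d matrix whose rows form an orthonormal basis of the orthogonal complement of the span of the rows of D(ν₁,ν₂). Then for every α > 0 there is a constant C_α such that for every R ≥ 2 and every cube Q_R ⊂ ℝ^{d+k} of sidelength R, ‖E₁f · E₂g‖_{L^{(d+3k)/(d+k)}(Q_R)} ≤ C_α R^α ‖f‖_{L²} ‖g‖_{L²}. -/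

import Mathlib

open MeasureTheory ENNReal Matrix

noncomputable section

/-- The extension (adjoint restriction) operator associated to the surface
`ξ ↦ (ξ, Φ ξ)`, acting on functions supported in `S ⊆ I^d`, evaluated at
`w = (x, t) ∈ ℝ^d × ℝ^k`. -/
def extOp (d k : ℕ) (S : Set (Fin d → ℝ)) (Φ : (Fin d → ℝ) → Fin k → ℝ)
    (f : (Fin d → ℝ) → ℂ) (w : (Fin d → ℝ) × (Fin k → ℝ)) : ℂ :=
  ∫ ξ in S, Complex.exp (2 * Real.pi * Complex.I *
    (((∑ i, w.1 i * ξ i) + ∑ j, w.2 j * Φ ξ j : ℝ) : ℂ)) * f ξ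

/-- `S` is a closed cube in `ℝ^d` (an axis-parallel cube `∏ [aᵢ - r, aᵢ + r]`). -/
def IsClosedCube (d : ℕ) (S : Set (Fin d → ℝ)) : Prop :=
  ∃ (a : Fin d → ℝ) (r : ℝ), 0 ≤ r ∧ S = {x | ∀ i, |x i - a i| ≤ r}

/-- The gradient `∇φ(ν)` of a scalar function on `ℝ^d`, as a vector. -/
def gradPhi (d : ℕ) (φ : (Fin d → ℝ) → ℝ) (ν : Fin d → ℝ) : Fin d → ℝ :=
  fun i => fderiv ℝ φ ν (Pi.single i 1)

/-- The Hessian matrix `Hφ(ν)` of a scalar function on `ℝ^d`. -/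
def hessPhi (d : ℕ) (φ : (Fin d → ℝ) → ℝ) (ν : Fin d → ℝ) : Matrix (Fin d) (Fin d) ℝ :=
  Matrix.of fun i j => fderiv ℝ (fun x => fderiv ℝ φ x (Pi.single j 1)) ν (Pi.single i 1)

/-- The `k × d` matrix `D(ν₁, ν₂)` whose `j`-th row is `∇φⱼ(ν₂) - ∇φⱼ(ν₁)`. -/
def Dmat (d k : ℕ) (Φ : (Fin d → ℝ) → Fin k → ℝ) (ν₁ ν₂ : Fin d → ℝ) :
    Matrix (Fin k) (Fin d) ℝ :=
  Matrix.of fun j i => gradPhi d (fun x => Φ x j) ν₂ i - gradPhi d (fun x => Φ x j) ν₁ i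

/-- The matrix `∑ᵢ tᵢ Hφᵢ(ν)`. -/
def tHess (d k : ℕ) (Φ : (Fin d → ℝ) → Fin k → ℝ) (t : Fin k → ℝ) (ν : Fin d → ℝ) :
    Matrix (Fin d) (Fin d) ℝ :=
  ∑ i, t i • hessPhi d (fun x => Φ x i) ν

/-- The `(k+d) × (k+d)` block matrix `M(t, ν₁, ν₂, ν)` with blocks
`0, D(ν₁,ν₂); D(ν₁,ν₂)ᵗ, ∑ᵢ tᵢ Hφᵢ(ν)`. -/
def Mmat (d k : ℕ) (Φ : (Fin d → ℝ) → Fin k → ℝ) (t : Fin k → ℝ) (ν₁ ν₂ ν : Fin d → ℝ) :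
    Matrix (Fin k ⊕ Fin d) (Fin k ⊕ Fin d) ℝ :=
  Matrix.fromBlocks 0 (Dmat d k Φ ν₁ ν₂) (Dmat d k Φ ν₁ ν₂)ᵀ (tHess d k Φ t ν)

/-- The axis-parallel cube of sidelength `R` in `ℝ^d × ℝ^k` centered at `c`. -/
def cubeQ (d k : ℕ) (R : ℝ) (c : (Fin d → ℝ) × (Fin k → ℝ)) :
    Set ((Fin d → ℝ) × (Fin k → ℝ)) :=
  {w | (∀ i, |w.1 i - c.1 i| ≤ R / 2) ∧ ∀ j, |w.2 j - c.2 j| ≤ R / 2}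

/-- The unimodular character `x ↦ e^{2πix}`. -/
def ec (x : ℝ) : ℂ := Complex.exp (2 * Real.pi * Complex.I * (x : ℂ))

lemma norm_ec (x : ℝ) : ‖ec x‖ = 1 := by
  have : 2 * Real.pi * Complex.I * (x : ℂ) = ((2 * Real.pi * x : ℝ) : ℂ) * Complex.I := by
    push_cast; ring
  rw [ec, this, Complex.norm_exp_ofReal_mul_I]

lemma enorm_ec (x : ℝ) : ‖ec x‖ₑ = 1 := by
  rw [← ofReal_norm, norm_ec, ENNReal.ofReal_one]

lemma ec_add (x y : ℝ) : ec (x + y) = ec x * ec y := by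
  simp only [ec]; rw [← Complex.exp_add]; push_cast; ring_nf

lemma ec_zero : ec 0 = 1 := by simp [ec]

lemma ec_neg (x : ℝ) : ec (-x) = star (ec x) := by
  simp only [ec, Complex.star_def, ← Complex.exp_conj]
  simp [Complex.conj_ofNat]

lemma ec_sum {ι : Type*} (s : Finset ι) (f : ι → ℝ) : ec (∑ i ∈ s, f i) = ∏ i ∈ s, ec (f i) := by
  simp only [ec, ← Complex.exp_sum]
  push_cast
  rw [Finset.mul_sum]

@[fun_prop]
lemma continuous_ec : Continuous ec := by unfold ec; fun_prop

@[fun_prop]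
lemma measurable_ec : Measurable ec := continuous_ec.measurable

/-- The tent function on `[-1, 1]`. -/
def tent (s : ℝ) : ℝ := max 0 (1 - |s|)

/-- The Fejér kernel, the Fourier transform of the tent function. -/
def fejer (x : ℝ) : ℝ := if x = 0 then 1 else 2 * (1 - Real.cos (2 * Real.pi * x)) / (2 * Real.pi * x) ^ 2

@[fun_prop]
lemma continuous_tent : Continuous tent := by unfold tent; fun_prop

lemma tent_nonneg (s : ℝ) : 0 ≤ tent s := le_max_left _ _

lemma tent_le_one (s : ℝ) : tent s ≤ 1 := max_le zero_le_one (by linarith [abs_nonneg s])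

lemma tent_eq_zero {s : ℝ} (h : 1 ≤ |s|) : tent s = 0 := max_eq_left (by linarith)

lemma hasCompactSupport_tent : HasCompactSupport tent := by
  refine HasCompactSupport.intro (K := Set.Icc (-1) 1) isCompact_Icc fun x hx => tent_eq_zero ?_
  by_contra! h
  exact hx ⟨by linarith [(abs_lt.1 h).1], by linarith [(abs_lt.1 h).2]⟩

lemma integrable_tent : Integrable (fun s => (tent s : ℂ)) := by
  have := (continuous_tent.integrable_of_hasCompactSupport hasCompactSupport_tent (μ := volume))
  exact this.ofReal

lemma fejer_nonneg (x : ℝ) : 0 ≤ fejer x := by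
  unfold fejer; split_ifs
  · exact zero_le_one
  · have := Real.cos_le_one (2 * Real.pi * x)
    have : 0 ≤ 1 - Real.cos (2 * Real.pi * x) := by linarith
    positivity

lemma le_fejer {x : ℝ} (hx : |x| ≤ 1 / 2) : 4 / Real.pi ^ 2 ≤ fejer x := by
  have hpi := Real.pi_pos
  unfold fejer; split_ifs with h
  · rw [div_le_one (by positivity)]
    nlinarith [Real.pi_gt_three]
  · have h1 : |2 * Real.pi * x| ≤ Real.pi := by
      rw [abs_mul, abs_of_pos (by positivity : 0 < 2 * Real.pi)]
      nlinarith
    have := Real.cos_le_one_sub_mul_cos_sq h1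
    rw [le_div_iff₀ (by positivity)]
    have e : 4 / Real.pi ^ 2 * (2 * Real.pi * x) ^ 2 = 2 * (2 / Real.pi ^ 2 * (2 * Real.pi * x) ^ 2) := by ring
    rw [e]
    linarith

lemma fejer_le (x : ℝ) : fejer x ≤ 2 * (1 + x ^ 2)⁻¹ := by
  have hpi := Real.pi_gt_three
  unfold fejer; split_ifs with h
  · subst h; norm_num
  · have h1 := Real.one_sub_sq_div_two_le_cos (x := 2 * Real.pi * x)
    have h2 := Real.neg_one_le_cos (2 * Real.pi * x)
    have hx : 0 < x ^ 2 := by positivity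
    rw [← div_eq_mul_inv, div_le_div_iff₀ (by positivity) (by positivity)]
    have h3 : (36 : ℝ) * x ^ 2 ≤ (2 * Real.pi * x) ^ 2 := by nlinarith [mul_pos hx (by linarith : 0 < Real.pi)]
    set a := 2 * Real.pi * x
    set c := Real.cos a
    nlinarith

lemma fourier_tent (w : ℝ) : ∫ v : ℝ, ec (-(v * w)) * (tent v : ℂ) = (fejer w : ℂ) := by
  have hsupp : ∫ v : ℝ, ec (-(v * w)) * (tent v : ℂ) = ∫ v in (-1)..(1:ℝ), ec (-(v * w)) * (tent v : ℂ) := by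
    rw [intervalIntegral.integral_of_le (by norm_num), ← integral_Icc_eq_integral_Ioc,
      setIntegral_eq_integral_of_forall_compl_eq_zero]
    intro x hx
    rw [tent_eq_zero]; · simp
    by_contra! h
    exact hx ⟨by linarith [(abs_lt.1 h).1], by linarith [(abs_lt.1 h).2]⟩
  rw [hsupp, ← intervalIntegral.integral_add_adjacent_intervals (b := 0)
    ((by fun_prop : Continuous fun v : ℝ => ec (-(v * w)) * (tent v : ℂ)).intervalIntegrable _ _)
    ((by fun_prop : Continuous fun v : ℝ => ec (-(v * w)) * (tent v : ℂ)).intervalIntegrable _ _)]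
  have e1 : ∫ v in (-1)..(0:ℝ), ec (-(v * w)) * (tent v : ℂ)
      = ∫ v in (-1)..(0:ℝ), (1 + (v:ℂ)) * ec (-(v * w)) := by
    refine intervalIntegral.integral_congr fun v hv => ?_
    rw [Set.uIcc_of_le (by norm_num)] at hv
    have : tent v = 1 + v := by
      rw [tent, abs_of_nonpos hv.2, max_eq_right]; ring
      linarith [hv.1]
    simp only [this]; push_cast; ring
  have e2 : ∫ v in (0)..(1:ℝ), ec (-(v * w)) * (tent v : ℂ)
      = ∫ v in (0)..(1:ℝ), (1 - (v:ℂ)) * ec (-(v * w)) := by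
    refine intervalIntegral.integral_congr fun v hv => ?_
    rw [Set.uIcc_of_le (by norm_num)] at hv
    have : tent v = 1 - v := by
      rw [tent, abs_of_nonneg hv.1, max_eq_right]
      linarith [hv.2]
    simp only [this]; push_cast; ring
  rw [e1, e2]
  by_cases hw : w = 0
  · subst hw
    simp only [mul_zero, neg_zero, ec_zero, mul_one, fejer, if_true]
    have i1 : ∫ v in (-1)..(0:ℝ), (1 + (v:ℂ)) = ((∫ v in (-1)..(0:ℝ), (1 + v) : ℝ) : ℂ) := by
      rw [← intervalIntegral.integral_ofReal]; push_cast; rfl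
    have i2 : ∫ v in (0)..(1:ℝ), (1 - (v:ℂ)) = ((∫ v in (0)..(1:ℝ), (1 - v) : ℝ) : ℂ) := by
      rw [← intervalIntegral.integral_ofReal]; push_cast; rfl
    have j1 : ∫ v in (-1)..(0:ℝ), (1 + v) = 1 / 2 := by
      rw [intervalIntegral.integral_add (by simp) (by simp)]; norm_num
    have j2 : ∫ v in (0)..(1:ℝ), (1 - v) = 1 / 2 := by
      rw [intervalIntegral.integral_sub (by simp) (by simp)]; norm_num
    rw [i1, i2, j1, j2]
    norm_num
  · set l : ℂ := -(2 * Real.pi * Complex.I * w) with hl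
    have hpi : (Real.pi : ℂ) ≠ 0 := by exact_mod_cast Real.pi_ne_zero
    have hwc : (w : ℂ) ≠ 0 := by exact_mod_cast hw
    have hl0 : l ≠ 0 := by
      rw [hl]; simp [hpi, hwc, Complex.I_ne_zero]
    have hec : ∀ v : ℝ, ec (-(v * w)) = Complex.exp (l * v) := by
      intro v; rw [ec, hl]; push_cast; ring_nf
    simp only [hec]
    have hexp : ∀ v : ℝ, HasDerivAt (fun v : ℝ => Complex.exp (l * v)) (Complex.exp (l * v) * (l * 1)) v := by
      intro v
      exact (((hasDerivAt_id (v:ℂ)).const_mul l).cexp).comp_ofReal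
    have hid : ∀ v : ℝ, HasDerivAt (fun v : ℝ => (v:ℂ)) 1 v := fun v =>
      (hasDerivAt_id (v:ℂ)).comp_ofReal
    have d1 : ∀ v ∈ Set.uIcc (-1 : ℝ) 0, HasDerivAt (fun v : ℝ => ((1 + (v:ℂ)) / l - 1 / l ^ 2) * Complex.exp (l * v))
        ((1 + (v:ℂ)) * Complex.exp (l * v)) v := by
      intro v _
      have := ((((hid v).const_add 1).div_const l).sub_const (1 / l ^ 2)).mul (hexp v)
      exact this.congr_deriv (by field_simp; ring)
    have d2 : ∀ v ∈ Set.uIcc (0 : ℝ) 1, HasDerivAt (fun v : ℝ => ((1 - (v:ℂ)) / l + 1 / l ^ 2) * Complex.exp (l * v))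
        ((1 - (v:ℂ)) * Complex.exp (l * v)) v := by
      intro v _
      have := ((((hid v).const_sub 1).div_const l).add_const (1 / l ^ 2)).mul (hexp v)
      exact this.congr_deriv (by field_simp; ring)
    rw [intervalIntegral.integral_eq_sub_of_hasDerivAt d1 (Continuous.intervalIntegrable (by fun_prop) _ _),
      intervalIntegral.integral_eq_sub_of_hasDerivAt d2 (Continuous.intervalIntegrable (by fun_prop) _ _)]
    have hcos : Complex.exp l + Complex.exp (-l) = 2 * Complex.cos (2 * Real.pi * w) := by
      rw [Complex.cos, hl]; ring_nf
    rw [fejer, if_neg hw]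
    push_cast
    have hl2 : l ^ 2 = -(2 * Real.pi * w) ^ 2 := by
      rw [hl]; ring_nf; rw [Complex.I_sq]; ring
    have : (2 * (1 - Complex.cos (2 * Real.pi * w)) / (2 * Real.pi * w) ^ 2 : ℂ)
       = (2 * Complex.cos (2 * Real.pi * w) - 2) / l ^ 2 := by
      rw [hl2, div_neg, ← neg_div]; ring
    rw [this, ← hcos]
    simp only [mul_zero, mul_one, Complex.exp_zero, mul_neg]
    field_simp
    ring

lemma integrable_fejer : Integrable fejer := by
  refine Integrable.mono' (integrable_inv_one_add_sq.const_mul 2) ?_ ?_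
  · apply Measurable.aestronglyMeasurable
    unfold fejer
    exact Measurable.ite (measurableSet_singleton 0) measurable_const (by fun_prop)
  · refine Filter.Eventually.of_forall fun x => ?_
    rw [Real.norm_of_nonneg (fejer_nonneg x)]
    exact fejer_le x

lemma fourier_fejer (z : ℝ) : ∫ x : ℝ, ec (x * z) * (fejer x : ℂ) = (tent z : ℂ) := by
  have hF : FourierTransform.fourier (fun s => (tent s : ℂ)) = fun w => (fejer w : ℂ) := by
    ext w
    rw [← fourier_tent, Real.fourier_eq']
    refine integral_congr_ae (Filter.Eventually.of_forall fun v => ?_)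
    simp only [ec, smul_eq_mul, RCLike.inner_apply, conj_trivial]
    push_cast; ring_nf
  have h := Continuous.fourierInv_fourier_eq (f := fun s => (tent s : ℂ)) (by fun_prop) integrable_tent
    (by rw [hF]; exact integrable_fejer.ofReal)
  have h2 := congrFun h z
  rw [hF, Real.fourierInv_eq'] at h2
  rw [← h2]
  refine integral_congr_ae (Filter.Eventually.of_forall fun v => ?_)
  simp only [ec, smul_eq_mul, RCLike.inner_apply, conj_trivial]
  push_cast; ring_nf

section Majorant
variable {ι : Type*} [Fintype ι]

/-- Product kernel adapted to the cube of radius `ρ` centred at `w₀`. -/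
def fejerBox (ρ : ℝ) (w₀ w : ι → ℝ) : ℝ := ∏ i, fejer ((w i - w₀ i) / (2 * ρ))

lemma fejerBox_nonneg (ρ : ℝ) (w₀ w : ι → ℝ) : 0 ≤ fejerBox ρ w₀ w :=
  Finset.prod_nonneg fun _ _ => fejer_nonneg _

lemma le_fejerBox {ρ : ℝ} (hρ : 0 < ρ) {w₀ w : ι → ℝ} (hw : w ∈ Metric.closedBall w₀ ρ) :
    (4 / Real.pi ^ 2) ^ Fintype.card ι ≤ fejerBox ρ w₀ w := by
  unfold fejerBox
  rw [← Finset.card_univ, ← Finset.prod_const]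
  refine Finset.prod_le_prod (fun _ _ => by positivity) fun i _ => le_fejer ?_
  rw [mem_closedBall_iff_norm] at hw
  have := (norm_le_pi_norm (w - w₀) i).trans hw
  rw [abs_div, abs_of_pos (by positivity : 0 < 2 * ρ), div_le_div_iff₀ (by positivity) (by norm_num)]
  rw [Pi.sub_apply, Real.norm_eq_abs] at this
  linarith

lemma integrable_fejer_scaled {ρ : ℝ} (hρ : 0 < ρ) (a : ℝ) :
    Integrable fun x : ℝ => fejer ((x - a) / (2 * ρ)) :=
  (integrable_fejer.comp_div (by positivity : (2 * ρ) ≠ 0)).comp_sub_right a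

lemma integrable_fejerBox {ρ : ℝ} (hρ : 0 < ρ) (w₀ : ι → ℝ) :
    Integrable (fejerBox ρ w₀) := by
  have := Integrable.fintype_prod (𝕜 := ℝ) (f := fun i x => fejer ((x - w₀ i) / (2 * ρ)))
    (μ := fun _ => (volume : Measure ℝ)) (fun i => integrable_fejer_scaled hρ (w₀ i))
  exact this

lemma integral_fejer_scaled {ρ : ℝ} (hρ : 0 < ρ) (a z : ℝ) :
    ∫ x : ℝ, ec (x * z) * (fejer ((x - a) / (2 * ρ)) : ℂ) = ec (a * z) * (2 * ρ * tent (2 * ρ * z) : ℝ) := by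
  have h1 := integral_sub_right_eq_self (μ := volume)
    (fun x : ℝ => ec ((x + a) * z) * (fejer (x / (2 * ρ)) : ℂ)) a
  simp only [sub_add_cancel] at h1
  rw [h1]
  have h2 := Measure.integral_comp_div
    (fun x : ℝ => ec ((2 * ρ * x + a) * z) * (fejer x : ℂ)) (2 * ρ)
  have h3 : ∀ x : ℝ, 2 * ρ * (x / (2 * ρ)) = x := fun x => by field_simp
  simp only [h3] at h2
  rw [h2, abs_of_pos (by positivity : 0 < 2 * ρ)]
  have h4 : ∀ x : ℝ, ec ((2 * ρ * x + a) * z) * (fejer x : ℂ)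
      = ec (a * z) * (ec (x * (2 * ρ * z)) * (fejer x : ℂ)) := fun x => by
    rw [← mul_assoc, ← ec_add]; ring_nf
  simp only [h4]
  rw [integral_const_mul, fourier_fejer, Complex.real_smul]
  push_cast; ring

lemma norm_integral_fejerBox_le {ρ : ℝ} (hρ : 0 < ρ) (w₀ z : ι → ℝ) :
    ‖∫ w : ι → ℝ, ec (w ⬝ᵥ z) * (fejerBox ρ w₀ w : ℂ)‖ ≤
      (2 * ρ) ^ Fintype.card ι * (if ∀ i, |z i| ≤ 1 / ρ then 1 else 0) := by
  have h : ∫ w : ι → ℝ, ec (w ⬝ᵥ z) * (fejerBox ρ w₀ w : ℂ)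
      = ∏ i, (ec (w₀ i * z i) * (2 * ρ * tent (2 * ρ * z i) : ℝ)) := by
    rw [← Finset.prod_congr rfl (fun i _ => integral_fejer_scaled hρ (w₀ i) (z i)),
      ← integral_fintype_prod_eq_prod (𝕜 := ℂ)
        (fun i x => ec (x * z i) * (fejer ((x - w₀ i) / (2 * ρ)) : ℂ))]
    refine integral_congr_ae (Filter.Eventually.of_forall fun w => ?_)
    simp only [dotProduct, ec_sum, fejerBox, Complex.ofReal_prod, Finset.prod_mul_distrib]
  rw [h, norm_prod]
  split_ifs with hz
  · rw [mul_one, ← Finset.card_univ, ← Finset.prod_const]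
    refine Finset.prod_le_prod (fun _ _ => norm_nonneg _) fun i _ => ?_
    rw [norm_mul, norm_ec, one_mul, Complex.norm_real, Real.norm_of_nonneg
      (mul_nonneg (by positivity) (tent_nonneg _))]
    exact mul_le_of_le_one_right (by positivity) (tent_le_one _)
  · push Not at hz
    obtain ⟨i, hi⟩ := hz
    rw [mul_zero, Finset.prod_eq_zero (Finset.mem_univ i)]
    rw [tent_eq_zero]; · simp
    rw [abs_mul, abs_of_pos (by positivity : 0 < 2 * ρ)]
    rw [div_lt_iff₀ hρ] at hi
    linarith

/-- Local `L²` bound for oscillatory integrals by a double integral over close frequencies. -/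
lemma lintegral_closedBall_oscillatory_le {Y : Type*} [MeasurableSpace Y] (ν : Measure Y) [SFinite ν]
    {Θ : Y → ι → ℝ} (hΘ : Measurable Θ) {u : Y → ℂ} (hu : Integrable u ν) {ρ : ℝ} (hρ : 0 < ρ)
    (w₀ : ι → ℝ) :
    ∫⁻ w in Metric.closedBall w₀ ρ, ‖∫ y, ec (w ⬝ᵥ Θ y) * u y ∂ν‖ₑ ^ 2 ≤
      ENNReal.ofReal (((Real.pi ^ 2 / 4) * (2 * ρ)) ^ Fintype.card ι) *
        ∫⁻ p : Y × Y, ‖u p.1‖ₑ * ‖u p.2‖ₑ * (if ∀ i, |Θ p.1 i - Θ p.2 i| ≤ 1 / ρ then 1 else 0)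
          ∂(ν.prod ν) := by
  set n := Fintype.card ι
  set V : (ι → ℝ) → ℂ := fun w => ∫ y, ec (w ⬝ᵥ Θ y) * u y ∂ν
  have hpi := Real.pi_pos
  have hdot : Measurable fun q : (ι → ℝ) × Y => q.1 ⬝ᵥ Θ q.2 := by
    unfold dotProduct
    refine Finset.measurable_sum _ fun i _ => ?_
    exact ((measurable_pi_apply i).comp measurable_fst).mul
      ((measurable_pi_apply i).comp (hΘ.comp measurable_snd))
  -- the double-integral representation of `‖V‖²`
  have hVV : ∀ w, ((‖V w‖ ^ 2 : ℝ) : ℂ) =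
      ∫ p : Y × Y, ec (w ⬝ᵥ (Θ p.1 - Θ p.2)) * (u p.1 * star (u p.2)) ∂(ν.prod ν) := by
    intro w
    have e1 : ((‖V w‖ ^ 2 : ℝ) : ℂ) = V w * star (V w) := by
      rw [Complex.star_def, Complex.mul_conj, Complex.normSq_eq_norm_sq]
    have e2 : star (V w) = ∫ y, star (ec (w ⬝ᵥ Θ y) * u y) ∂ν := by
      simp only [Complex.star_def]
      exact integral_conj.symm
    rw [e1, e2, ← integral_prod_mul]
    refine integral_congr_ae (Filter.Eventually.of_forall fun p => ?_)
    simp only [star_mul']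
    rw [dotProduct_sub, sub_eq_add_neg, ec_add, ec_neg]
    ring
  have hint2 : Integrable (fun p : Y × Y => u p.1 * star (u p.2)) (ν.prod ν) := by
    refine hu.mul_prod (f := u) (g := fun y => star (u y)) ?_
    exact (LinearIsometryEquiv.integrable_comp_iff Complex.conjLIE).2 hu
  have hswap : ∫ w, (fejerBox ρ w₀ w : ℂ) * ((‖V w‖ ^ 2 : ℝ) : ℂ)
      = ∫ p : Y × Y, (∫ w : ι → ℝ, ec (w ⬝ᵥ (Θ p.1 - Θ p.2)) * (fejerBox ρ w₀ w : ℂ))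
          * (u p.1 * star (u p.2)) ∂(ν.prod ν) := by
    simp_rw [hVV, ← integral_const_mul, ← integral_mul_const]
    rw [integral_integral_swap]
    · refine integral_congr_ae (Filter.Eventually.of_forall fun p => ?_)
      refine integral_congr_ae (Filter.Eventually.of_forall fun w => ?_)
      simp only; ring
    · have hb : Integrable (fun q : (ι → ℝ) × Y × Y =>
          (fejerBox ρ w₀ q.1 : ℂ) * (u q.2.1 * star (u q.2.2))) (volume.prod (ν.prod ν)) := ((integrable_fejerBox hρ w₀).ofReal (𝕜 := ℂ)).mul_prod hint2
      have := hb.bdd_mul (c := 1) (f := fun q : (ι → ℝ) × Y × Y => ec (q.1 ⬝ᵥ (Θ q.2.1 - Θ q.2.2))) ?_ ?_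
      · refine this.congr (Filter.Eventually.of_forall fun q => ?_)
        simp only [Function.uncurry]
        ring
      · refine (measurable_ec.comp ?_).aestronglyMeasurable
        simp only [dotProduct_sub]
        exact (hdot.comp (measurable_fst.prodMk (measurable_fst.comp measurable_snd))).sub
          (hdot.comp (measurable_fst.prodMk (measurable_snd.comp measurable_snd)))
      · exact Filter.Eventually.of_forall fun q => (norm_ec _).le
  have hVm : AEStronglyMeasurable V volume := by
    have : AEStronglyMeasurable (fun q : (ι → ℝ) × Y => ec (q.1 ⬝ᵥ Θ q.2) * u q.2)
        (volume.prod ν) :=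
      (measurable_ec.comp hdot).aestronglyMeasurable.mul hu.aestronglyMeasurable.comp_snd
    exact this.integral_prod_right'
  have hVb : ∀ w, ‖V w‖ ≤ ∫ y, ‖u y‖ ∂ν := fun w => by
    refine (norm_integral_le_integral_norm _).trans (le_of_eq ?_)
    simp [norm_ec]
  have hintV : Integrable (fun w => fejerBox ρ w₀ w * ‖V w‖ ^ 2) := by
    refine (integrable_fejerBox hρ w₀).mul_bdd (c := (∫ y, ‖u y‖ ∂ν) ^ 2) (hVm.norm.pow 2) ?_
    refine Filter.Eventually.of_forall fun w => ?_
    rw [Real.norm_of_nonneg (by positivity)]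
    exact pow_le_pow_left₀ (norm_nonneg _) (hVb w) 2
  have key : ENNReal.ofReal (∫ w, fejerBox ρ w₀ w * ‖V w‖ ^ 2) ≤
      ENNReal.ofReal ((2 * ρ) ^ n) *
        ∫⁻ p : Y × Y, ‖u p.1‖ₑ * ‖u p.2‖ₑ * (if ∀ i, |Θ p.1 i - Θ p.2 i| ≤ 1 / ρ then 1 else 0)
          ∂(ν.prod ν) := by
    have h0 : 0 ≤ ∫ w, fejerBox ρ w₀ w * ‖V w‖ ^ 2 :=
      integral_nonneg fun w => mul_nonneg (fejerBox_nonneg _ _ _) (by positivity)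
    have e : ENNReal.ofReal (∫ w, fejerBox ρ w₀ w * ‖V w‖ ^ 2)
        = ‖∫ w, (fejerBox ρ w₀ w : ℂ) * ((‖V w‖ ^ 2 : ℝ) : ℂ)‖ₑ := by
      have : ∫ w, (fejerBox ρ w₀ w : ℂ) * ((‖V w‖ ^ 2 : ℝ) : ℂ)
          = ((∫ w, fejerBox ρ w₀ w * ‖V w‖ ^ 2 : ℝ) : ℂ) := by
        rw [← integral_complex_ofReal]; push_cast; rfl
      rw [this, ← ofReal_norm, Complex.norm_real, Real.norm_of_nonneg h0]
    rw [e, hswap, ← lintegral_const_mul' _ _ ENNReal.ofReal_ne_top]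
    refine (enorm_integral_le_lintegral_enorm _).trans (lintegral_mono fun p => ?_)
    have := norm_integral_fejerBox_le hρ w₀ (Θ p.1 - Θ p.2)
    rw [enorm_mul, enorm_mul]
    have hs : ‖star (u p.2)‖ₑ = ‖u p.2‖ₑ := by rw [← ofReal_norm, norm_star, ofReal_norm]
    rw [hs]
    have h2 := ENNReal.ofReal_le_ofReal this
    rw [ofReal_norm, ENNReal.ofReal_mul (by positivity)] at h2
    refine (mul_le_mul_left h2 _).trans (le_of_eq ?_)
    simp only [Pi.sub_apply]
    split_ifs <;> simp [n]
  calc ∫⁻ w in Metric.closedBall w₀ ρ, ‖V w‖ₑ ^ 2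
      ≤ ∫⁻ w in Metric.closedBall w₀ ρ, ENNReal.ofReal ((Real.pi ^ 2 / 4) ^ n) *
          ENNReal.ofReal (fejerBox ρ w₀ w * ‖V w‖ ^ 2) := by
        refine setLIntegral_mono' Metric.isClosed_closedBall.measurableSet fun w hw => ?_
        rw [← ENNReal.ofReal_mul (by positivity), ← ofReal_norm, ← ENNReal.ofReal_pow (norm_nonneg _)]
        refine ENNReal.ofReal_le_ofReal ?_
        have h1 := le_fejerBox hρ hw
        have h2 : (Real.pi ^ 2 / 4) ^ n * (4 / Real.pi ^ 2) ^ n = 1 := by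
          rw [← mul_pow]; field_simp; simp
        calc ‖V w‖ ^ 2 = ((Real.pi ^ 2 / 4) ^ n * (4 / Real.pi ^ 2) ^ n) * ‖V w‖ ^ 2 := by rw [h2, one_mul]
          _ ≤ ((Real.pi ^ 2 / 4) ^ n * fejerBox ρ w₀ w) * ‖V w‖ ^ 2 := by gcongr
          _ = _ := by ring
    _ ≤ ∫⁻ w, ENNReal.ofReal ((Real.pi ^ 2 / 4) ^ n) *
          ENNReal.ofReal (fejerBox ρ w₀ w * ‖V w‖ ^ 2) := setLIntegral_le_lintegral _ _
    _ = ENNReal.ofReal ((Real.pi ^ 2 / 4) ^ n) * ENNReal.ofReal (∫ w, fejerBox ρ w₀ w * ‖V w‖ ^ 2) := by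
        rw [lintegral_const_mul' _ _ ENNReal.ofReal_ne_top, ofReal_integral_eq_lintegral_ofReal hintV]
        exact Filter.Eventually.of_forall fun w => mul_nonneg (fejerBox_nonneg _ _ _) (by positivity)
    _ ≤ _ := by
        rw [mul_pow, ENNReal.ofReal_mul (by positivity), mul_assoc]
        gcongr

end Majorant

section Ext
variable {d k : ℕ}

/-- The extension operator on all of `ℝ^d`. -/
def extE (Φ : (Fin d → ℝ) → Fin k → ℝ) (f : (Fin d → ℝ) → ℂ)
    (w : (Fin d → ℝ) × (Fin k → ℝ)) : ℂ :=
  ∫ ξ, ec (w.1 ⬝ᵥ ξ + w.2 ⬝ᵥ Φ ξ) * f ξ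

/-- The constant of the local `L²` bounds. -/
def majC (d k : ℕ) : ℝ := (Real.pi ^ 2 / 4 * 2) ^ (d + k)

lemma majC_nonneg (d k : ℕ) : 0 ≤ majC d k := by unfold majC; positivity

lemma lintegral_closedBall_prod_oscillatory_le {Y : Type*} [MeasurableSpace Y] (ν : Measure Y)
    [SFinite ν] {Θ₁ : Y → Fin d → ℝ} {Θ₂ : Y → Fin k → ℝ} (h₁ : Measurable Θ₁) (h₂ : Measurable Θ₂)
    {u : Y → ℂ} (hu : Integrable u ν) {ρ : ℝ} (hρ : 0 < ρ) (w₀ : (Fin d → ℝ) × (Fin k → ℝ)) :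
    ∫⁻ w in Metric.closedBall w₀ ρ, ‖∫ y, ec (w.1 ⬝ᵥ Θ₁ y + w.2 ⬝ᵥ Θ₂ y) * u y ∂ν‖ₑ ^ 2 ≤
      ENNReal.ofReal (majC d k * ρ ^ (d + k)) *
        ∫⁻ p : Y × Y, ‖u p.1‖ₑ * ‖u p.2‖ₑ *
          (if ‖Θ₁ p.1 - Θ₁ p.2‖ ≤ 1 / ρ ∧ ‖Θ₂ p.1 - Θ₂ p.2‖ ≤ 1 / ρ then 1 else 0)
          ∂(ν.prod ν) := by
  let e := MeasurableEquiv.sumPiEquivProdPi (fun _ : Fin d ⊕ Fin k => ℝ)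
  have he : MeasurePreserving e volume volume := volume_measurePreserving_sumPiEquivProdPi _
  have hpre : e ⁻¹' (Metric.closedBall w₀ ρ) = Metric.closedBall (Sum.elim w₀.1 w₀.2) ρ := by
    ext x
    simp only [Set.mem_preimage, mem_closedBall_iff_norm, Prod.norm_def, sup_le_iff,
      pi_norm_le_iff_of_nonneg hρ.le, Sum.forall]
    rfl
  have := lintegral_closedBall_oscillatory_le ν (Θ := fun y => Sum.elim (Θ₁ y) (Θ₂ y))
    (by
      refine measurable_pi_iff.2 fun i => ?_
      cases i with
      | inl i => exact (measurable_pi_apply i).comp h₁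
      | inr i => exact (measurable_pi_apply i).comp h₂) hu hρ (Sum.elim w₀.1 w₀.2)
  rw [← he.setLIntegral_comp_preimage_emb e.measurableEmbedding, hpre]
  have hdot : ∀ (x : Fin d ⊕ Fin k → ℝ) y, x ⬝ᵥ Sum.elim (Θ₁ y) (Θ₂ y)
      = (e x).1 ⬝ᵥ Θ₁ y + (e x).2 ⬝ᵥ Θ₂ y := by
    intro x y
    simp only [dotProduct, Fintype.sum_sum_type, Sum.elim_inl, Sum.elim_inr]
    rfl
  simp only [hdot] at this
  refine this.trans (le_of_eq ?_)
  congr 1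
  · rw [majC, ← mul_pow]; simp [mul_assoc]
  · refine lintegral_congr fun p => ?_
    simp only [Sum.forall, Sum.elim_inl, Sum.elim_inr,
      pi_norm_le_iff_of_nonneg (by positivity : 0 ≤ 1 / ρ), Pi.sub_apply, Real.norm_eq_abs]

/-- Local energy estimate: the extension operator is `L² → L²(Q_R)` with norm `R^{k/2}`. -/
lemma lintegral_extE_sq_le {Φ : (Fin d → ℝ) → Fin k → ℝ} (hΦ : Measurable Φ)
    {f : (Fin d → ℝ) → ℂ} (hf : Integrable f) {R : ℝ} (hR : 0 < R)
    (w₀ : (Fin d → ℝ) × (Fin k → ℝ)) :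
    ∫⁻ w in Metric.closedBall w₀ R, ‖extE Φ f w‖ₑ ^ 2 ≤
      ENNReal.ofReal (2 ^ (d + 1) * majC d k * R ^ k) * ∫⁻ ξ, ‖f ξ‖ₑ ^ 2 := by
  refine (lintegral_closedBall_prod_oscillatory_le volume measurable_id hΦ hf hR w₀).trans ?_
  have hball : ∀ ξ : Fin d → ℝ, volume (Metric.closedBall ξ (1 / R)) = ENNReal.ofReal ((2 / R) ^ d) := by
    intro ξ
    rw [Real.volume_pi_closedBall _ (by positivity)]
    simp only [Fintype.card_fin]
    congr 2; ring
  have hmeas : AEMeasurable (fun ξ => ‖f ξ‖ₑ ^ 2) := hf.aestronglyMeasurable.enorm.pow_const 2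
  have hset : MeasurableSet {p : (Fin d → ℝ) × (Fin d → ℝ) | ‖p.1 - p.2‖ ≤ 1 / R} :=
    measurableSet_le (by fun_prop) (by fun_prop)
  have hI : AEMeasurable (fun p : (Fin d → ℝ) × (Fin d → ℝ) =>
      ({p : (Fin d → ℝ) × (Fin d → ℝ) | ‖p.1 - p.2‖ ≤ 1 / R}.indicator (fun _ => (1:ℝ≥0∞)) p))
      (volume.prod volume) := (measurable_const.indicator hset).aemeasurable
  have hm1 : AEMeasurable (fun p : (Fin d → ℝ) × (Fin d → ℝ) => ‖f p.1‖ₑ ^ 2 *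
      ({p : (Fin d → ℝ) × (Fin d → ℝ) | ‖p.1 - p.2‖ ≤ 1 / R}.indicator (fun _ => (1:ℝ≥0∞)) p))
      (volume.prod volume) := hmeas.comp_fst.mul hI
  have hm2 : AEMeasurable (fun p : (Fin d → ℝ) × (Fin d → ℝ) => ‖f p.2‖ₑ ^ 2 *
      ({p : (Fin d → ℝ) × (Fin d → ℝ) | ‖p.1 - p.2‖ ≤ 1 / R}.indicator (fun _ => (1:ℝ≥0∞)) p))
      (volume.prod volume) := hmeas.comp_snd.mul hI
  have hA : ∫⁻ p : (Fin d → ℝ) × (Fin d → ℝ), ‖f p.1‖ₑ ^ 2 *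
      ({p : (Fin d → ℝ) × (Fin d → ℝ) | ‖p.1 - p.2‖ ≤ 1 / R}.indicator (fun _ => (1:ℝ≥0∞)) p)
      ∂(volume.prod volume) = ENNReal.ofReal ((2 / R) ^ d) * ∫⁻ ξ, ‖f ξ‖ₑ ^ 2 := by
    rw [lintegral_prod _ hm1, ← lintegral_const_mul'' _ hmeas]
    refine lintegral_congr fun ξ => ?_
    have := lintegral_const_mul' (μ := volume) (‖f ξ‖ₑ ^ 2) (fun y =>
      {p : (Fin d → ℝ) × (Fin d → ℝ) | ‖p.1 - p.2‖ ≤ 1 / R}.indicator (fun _ => (1:ℝ≥0∞)) (ξ, y)) (by simp)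
    refine this.trans ?_
    rw [mul_comm, ← hball ξ]
    congr 1
    rw [← lintegral_indicator_one Metric.isClosed_closedBall.measurableSet]
    refine lintegral_congr fun ξ' => ?_
    simp only [Set.indicator, Set.mem_ofPred_eq, mem_closedBall_iff_norm', Pi.one_apply]
  have hB : ∫⁻ p : (Fin d → ℝ) × (Fin d → ℝ), ‖f p.2‖ₑ ^ 2 *
      ({p : (Fin d → ℝ) × (Fin d → ℝ) | ‖p.1 - p.2‖ ≤ 1 / R}.indicator (fun _ => (1:ℝ≥0∞)) p)
      ∂(volume.prod volume) = ENNReal.ofReal ((2 / R) ^ d) * ∫⁻ ξ, ‖f ξ‖ₑ ^ 2 := by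
    rw [lintegral_prod_symm _ hm2, ← lintegral_const_mul'' _ hmeas]
    refine lintegral_congr fun ξ => ?_
    have := lintegral_const_mul' (μ := volume) (‖f ξ‖ₑ ^ 2) (fun y =>
      {p : (Fin d → ℝ) × (Fin d → ℝ) | ‖p.1 - p.2‖ ≤ 1 / R}.indicator (fun _ => (1:ℝ≥0∞)) (y, ξ)) (by simp)
    refine this.trans ?_
    rw [mul_comm, ← hball ξ]
    congr 1
    rw [← lintegral_indicator_one Metric.isClosed_closedBall.measurableSet]
    refine lintegral_congr fun ξ' => ?_
    simp only [Set.indicator, Set.mem_ofPred_eq, mem_closedBall_iff_norm, Pi.one_apply]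
  calc _ ≤ ENNReal.ofReal (majC d k * R ^ (d + k)) *
        ∫⁻ p : (Fin d → ℝ) × (Fin d → ℝ), (‖f p.1‖ₑ ^ 2 *
          ({p : (Fin d → ℝ) × (Fin d → ℝ) | ‖p.1 - p.2‖ ≤ 1 / R}.indicator (fun _ => (1:ℝ≥0∞)) p)
          + ‖f p.2‖ₑ ^ 2 *
          ({p : (Fin d → ℝ) × (Fin d → ℝ) | ‖p.1 - p.2‖ ≤ 1 / R}.indicator (fun _ => (1:ℝ≥0∞)) p))
          ∂(volume.prod volume) := by
        gcongr with p
        have hab : ‖f p.1‖ₑ * ‖f p.2‖ₑ ≤ ‖f p.1‖ₑ ^ 2 + ‖f p.2‖ₑ ^ 2 := by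
          rcases le_total ‖f p.1‖ₑ ‖f p.2‖ₑ with h | h
          · exact (mul_le_mul_left h _).trans (by rw [← sq]; exact le_add_self)
          · exact (mul_le_mul_right h _).trans (by rw [← sq]; exact le_self_add)
        rw [← add_mul]
        refine mul_le_mul' hab ?_
        simp only [Set.indicator, Set.mem_ofPred_eq]
        split_ifs with h1 h2 h2
        · exact le_rfl
        · exact absurd h1.1 h2
        · exact bot_le
        · exact le_rfl
    _ = ENNReal.ofReal (majC d k * R ^ (d + k)) *
          (ENNReal.ofReal ((2 / R) ^ d) * (∫⁻ ξ, ‖f ξ‖ₑ ^ 2)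
            + ENNReal.ofReal ((2 / R) ^ d) * ∫⁻ ξ, ‖f ξ‖ₑ ^ 2) := by
        rw [lintegral_add_left' hm1, hA, hB]
    _ = _ := by
        rw [← two_mul, ← mul_assoc, ← mul_assoc]
        congr 1
        rw [show (2:ℝ≥0∞) = ENNReal.ofReal 2 by simp, ← ENNReal.ofReal_mul (mul_nonneg (majC_nonneg _ _) (by positivity)),
          ← ENNReal.ofReal_mul (mul_nonneg (mul_nonneg (majC_nonneg _ _) (by positivity)) (by norm_num))]
        congr 1
        rw [div_pow, pow_add R]
        field_simp
        ring

lemma lintegral_extE_mul_sq_le {Φ : (Fin d → ℝ) → Fin k → ℝ} (hΦ : Measurable Φ)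
    {f g : (Fin d → ℝ) → ℂ} (hf : Integrable f) (hg : Integrable g) {ρ : ℝ} (hρ : 0 < ρ)
    (w₀ : (Fin d → ℝ) × (Fin k → ℝ)) :
    ∫⁻ w in Metric.closedBall w₀ ρ, ‖extE Φ f w * extE Φ g w‖ₑ ^ 2 ≤
      ENNReal.ofReal (majC d k * ρ ^ (d + k)) *
      ∫⁻ p : ((Fin d → ℝ) × (Fin d → ℝ)) × ((Fin d → ℝ) × (Fin d → ℝ)),
        ‖f p.1.1‖ₑ * ‖g p.1.2‖ₑ * (‖f p.2.1‖ₑ * ‖g p.2.2‖ₑ) *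
        (if ‖(p.1.1 + p.1.2) - (p.2.1 + p.2.2)‖ ≤ 1 / ρ ∧
          ‖(Φ p.1.1 + Φ p.1.2) - (Φ p.2.1 + Φ p.2.2)‖ ≤ 1 / ρ then 1 else 0) := by
  have := lintegral_closedBall_prod_oscillatory_le
    ((volume : Measure (Fin d → ℝ)).prod (volume : Measure (Fin d → ℝ)))
    (Θ₁ := fun p => p.1 + p.2) (Θ₂ := fun p => Φ p.1 + Φ p.2) (by fun_prop) (by fun_prop)
    (hf.mul_prod hg) hρ w₀
  simp only [enorm_mul] at this
  refine le_trans (le_of_eq ?_) this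
  refine lintegral_congr fun w => ?_
  congr 2
  rw [extE, extE, ← integral_prod_mul]
  refine integral_congr_ae (Filter.Eventually.of_forall fun p => ?_)
  simp only [dotProduct_add]
  rw [show w.1 ⬝ᵥ p.1 + w.1 ⬝ᵥ p.2 + (w.2 ⬝ᵥ Φ p.1 + w.2 ⬝ᵥ Φ p.2)
    = (w.1 ⬝ᵥ p.1 + w.2 ⬝ᵥ Φ p.1) + (w.1 ⬝ᵥ p.2 + w.2 ⬝ᵥ Φ p.2) by ring,
    ec_add (w.1 ⬝ᵥ p.1 + w.2 ⬝ᵥ Φ p.1)]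
  ring

end Ext

section Torus
variable {d : ℕ}

local instance : MeasureSpace UnitAddCircle := ⟨AddCircle.haarAddCircle⟩

local instance : Measure.IsAddHaarMeasure (volume : Measure UnitAddCircle) :=
  inferInstanceAs (Measure.IsAddHaarMeasure AddCircle.haarAddCircle)

local instance : IsProbabilityMeasure (volume : Measure UnitAddCircle) :=
  inferInstanceAs (IsProbabilityMeasure AddCircle.haarAddCircle)

/-- The half-open unit cube centred at the origin. -/
def unitCube (d : ℕ) : Set (Fin d → ℝ) := {x | ∀ i, x i ∈ Set.Ioc (-1 / 2 : ℝ) (-1 / 2 + 1)}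

lemma measurableSet_unitCube : MeasurableSet (unitCube d) :=
  MeasurableSet.univ_pi' fun _ => measurableSet_Ioc

/-- The integer point `v` as a real vector. -/
def toR (v : Fin d → ℤ) : Fin d → ℝ := fun i => (v i : ℝ)

/-- Trigonometric polynomials on `ℝ^d`. -/
def trigPoly (V : Finset (Fin d → ℤ)) (c : (Fin d → ℤ) → ℂ) (x : Fin d → ℝ) : ℂ :=
  ∑ v ∈ V, c v * ec (toR v ⬝ᵥ x)

lemma mFourier_coe (v : Fin d → ℤ) (x : Fin d → ℝ) :
    UnitAddTorus.mFourier v (fun i => (x i : UnitAddCircle)) = ec (toR v ⬝ᵥ x) := by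
  rw [dotProduct, ec_sum]
  simp only [UnitAddTorus.mFourier, ContinuousMap.coe_mk]
  refine Finset.prod_congr rfl fun i _ => ?_
  rw [fourier_coe_apply, ec, toR]
  congr 1
  push_cast
  ring

lemma lintegral_torus (F : UnitAddTorus (Fin d) → ℝ≥0∞) :
    ∫⁻ x, F x = ∫⁻ x in unitCube d, F (fun i => (x i : UnitAddCircle)) :=
  UnitAddTorus.lintegral_preimage F (fun _ => -1 / 2)

lemma sum_mFourierLp_ae (V : Finset (Fin d → ℤ)) (c : (Fin d → ℤ) → ℂ) :
    (∑ v ∈ V, c v • UnitAddTorus.mFourierLp (d := Fin d) 2 v : Lp ℂ 2 (volume : Measure (UnitAddTorus (Fin d))))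
      =ᵐ[volume] fun x => ∑ v ∈ V, c v * UnitAddTorus.mFourier v x := by
  have h1 := Lp.coeFn_finsetSum V (fun v => c v • UnitAddTorus.mFourierLp (d := Fin d) 2 v)
  have h2 : ∀ᵐ x, ∀ v ∈ V, (c v • UnitAddTorus.mFourierLp (d := Fin d) 2 v :
      Lp ℂ 2 (volume : Measure (UnitAddTorus (Fin d)))) x = c v * UnitAddTorus.mFourier v x := by
    rw [Filter.eventually_all_finset]
    intro v _
    filter_upwards [Lp.coeFn_smul (c v) (UnitAddTorus.mFourierLp (d := Fin d) 2 v),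
      UnitAddTorus.coeFn_mFourierLp 2 v] with x hx hx'
    rw [hx, Pi.smul_apply, hx', smul_eq_mul]
  filter_upwards [h1, h2] with x hx hx'
  rw [hx, Finset.sum_apply]
  exact Finset.sum_congr rfl hx'

lemma lintegral_trigPoly (V : Finset (Fin d → ℤ)) (c : (Fin d → ℤ) → ℂ) :
    ∫⁻ x in unitCube d, ‖trigPoly V c x‖ₑ ^ 2 = ENNReal.ofReal (∑ v ∈ V, ‖c v‖ ^ 2) := by
  set g : Lp ℂ 2 (volume : Measure (UnitAddTorus (Fin d))) :=
    ∑ v ∈ V, c v • UnitAddTorus.mFourierLp (d := Fin d) 2 v with hg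
  have h1 : ‖g‖ ^ 2 = ∑ v ∈ V, ‖c v‖ ^ 2 := by
    have := UnitAddTorus.orthonormal_mFourier (d := Fin d)
    have h := this.inner_sum c c V
    rw [← hg, inner_self_eq_norm_sq_to_K] at h
    have h' : ((‖g‖ ^ 2 : ℝ) : ℂ) = ((∑ v ∈ V, ‖c v‖ ^ 2 : ℝ) : ℂ) := by
      push_cast
      refine h.trans (Finset.sum_congr rfl fun v _ => ?_)
      rw [RCLike.conj_mul]
      rfl
    exact_mod_cast h'
  have h2 : ‖g‖ₑ ^ 2 = ∫⁻ x, ‖g x‖ₑ ^ 2 := by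
    rw [Lp.enorm_def, eLpNorm_eq_lintegral_rpow_enorm_toReal (by simp) (by simp)]
    simp only [ENNReal.toReal_ofNat, ENNReal.rpow_ofNat]
    rw [← ENNReal.rpow_natCast, ← ENNReal.rpow_mul]
    norm_num
  calc _ = ∫⁻ x : UnitAddTorus (Fin d), ‖∑ v ∈ V, c v * UnitAddTorus.mFourier v x‖ₑ ^ 2 := by
        rw [lintegral_torus]
        simp only [mFourier_coe]
        rfl
    _ = ∫⁻ x, ‖g x‖ₑ ^ 2 := by
        refine lintegral_congr_ae ?_
        filter_upwards [sum_mFourierLp_ae V c] with x hx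
        rw [hx]
    _ = _ := by
        rw [← h2, ← h1, ← ofReal_norm, ENNReal.ofReal_pow (norm_nonneg _)]

lemma exists_trigPoly_approx {F : (Fin d → ℝ) → ℂ} (hF : AEStronglyMeasurable F (volume.restrict (unitCube d)))
    (hF2 : ∫⁻ x in unitCube d, ‖F x‖ₑ ^ 2 < ∞) {η : ℝ≥0∞} (hη : 0 < η) :
    ∃ (V : Finset (Fin d → ℤ)) (c : (Fin d → ℤ) → ℂ),
      ∫⁻ x in unitCube d, ‖F x - trigPoly V c x‖ₑ ^ 2 ≤ η ∧
      ENNReal.ofReal (∑ v ∈ V, ‖c v‖ ^ 2) ≤ ∫⁻ x in unitCube d, ‖F x‖ₑ ^ 2 := by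
  set E := UnitAddTorus.measurableEquivPiIoc (fun _ : Fin d => (-1 / 2 : ℝ)) with hE
  have hEmp := UnitAddTorus.measurePreserving_equivPiIoc (fun _ : Fin d => (-1 / 2 : ℝ))
  set G : UnitAddTorus (Fin d) → ℂ := fun x => F (E x).1 with hG
  have hEx : ∀ x ∈ unitCube d, (E (fun i => (x i : UnitAddCircle))).1 = x := by
    intro x hx
    have : (fun i => (x i : UnitAddCircle)) = E.symm ⟨x, hx⟩ := rfl
    rw [this, E.apply_symm_apply]
  have hGm : AEStronglyMeasurable G := by
    have h1 : AEStronglyMeasurable (fun x : unitCube d => F x.1) (Measure.comap Subtype.val volume) := by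
      have h2 : MeasurePreserving (Subtype.val : unitCube d → _) (Measure.comap Subtype.val volume)
        (volume.restrict (unitCube d)) := ⟨measurable_subtype_coe, map_comap_subtype_coe measurableSet_unitCube _⟩
      exact hF.comp_measurePreserving h2
    exact h1.comp_measurePreserving hEmp
  have hlift : ∀ P : (Fin d → ℝ) → ℂ, ∀ Q : UnitAddTorus (Fin d) → ℂ,
      (∀ x ∈ unitCube d, Q (fun i => (x i : UnitAddCircle)) = P x) →
      ∫⁻ x, ‖Q x‖ₑ ^ 2 = ∫⁻ x in unitCube d, ‖P x‖ₑ ^ 2 := by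
    intro P Q h
    rw [lintegral_torus]
    refine setLIntegral_congr_fun measurableSet_unitCube fun x hx => ?_
    simp only [h x hx]
  have hG2 : ∫⁻ x, ‖G x‖ₑ ^ 2 = ∫⁻ x in unitCube d, ‖F x‖ₑ ^ 2 :=
    hlift F G fun x hx => by simp only [hG, hEx x hx]
  have hnorm : ∀ Q : UnitAddTorus (Fin d) → ℂ, eLpNorm Q 2 volume ^ 2 = ∫⁻ x, ‖Q x‖ₑ ^ 2 := by
    intro Q
    rw [eLpNorm_eq_lintegral_rpow_enorm_toReal (by simp) (by simp)]
    simp only [ENNReal.toReal_ofNat, ENNReal.rpow_ofNat]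
    rw [← ENNReal.rpow_natCast, ← ENNReal.rpow_mul]
    norm_num
  have hGmem : MemLp G 2 := by
    refine ⟨hGm, ?_⟩
    have := hnorm G
    rw [hG2] at this
    rw [← this] at hF2
    by_contra hcon
    rw [not_lt_top_iff] at hcon
    simp [hcon] at hF2
  set g := hGmem.toLp G with hg
  have hsum := UnitAddTorus.hasSum_mFourier_series_L2 g
  have hpars := UnitAddTorus.hasSum_sq_mFourierCoeff g
  have hgG : g =ᵐ[volume] G := hGmem.coeFn_toLp
  obtain ⟨δ, hδ, hδη⟩ : ∃ δ : ℝ, 0 < δ ∧ ENNReal.ofReal δ ^ 2 ≤ η := by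
    obtain ⟨x, hx0, hx⟩ : ∃ x : ℝ, 0 < x ∧ ENNReal.ofReal x ≤ η := by
      rcases eq_or_ne η ∞ with h | h
      · exact ⟨1, one_pos, by simp [h]⟩
      · exact ⟨η.toReal, ENNReal.toReal_pos hη.ne' h, by rw [ENNReal.ofReal_toReal h]⟩
    refine ⟨Real.sqrt x, Real.sqrt_pos.2 hx0, ?_⟩
    rw [← ENNReal.ofReal_pow (Real.sqrt_nonneg _), Real.sq_sqrt hx0.le]
    exact hx
  obtain ⟨V, hV⟩ := ((Metric.tendsto_nhds.1 hsum) δ hδ).exists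
  refine ⟨V, UnitAddTorus.mFourierCoeff g, ?_, ?_⟩
  · refine le_trans ?_ hδη
    rw [← hlift (fun x => F x - trigPoly V (UnitAddTorus.mFourierCoeff g) x)
      (fun x => G x - ∑ v ∈ V, UnitAddTorus.mFourierCoeff g v * UnitAddTorus.mFourier v x)
      (fun x hx => by simp only [hG, hEx x hx, mFourier_coe, trigPoly]), ← hnorm]
    rw [dist_comm, dist_eq_norm] at hV
    gcongr
    have hgV := ENNReal.ofReal_le_ofReal hV.le
    rw [Lp.norm_def, ENNReal.ofReal_toReal (Lp.eLpNorm_ne_top _)] at hgV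
    refine le_trans (le_of_eq ?_) hgV
    refine eLpNorm_congr_ae ?_
    filter_upwards [hgG, sum_mFourierLp_ae V (UnitAddTorus.mFourierCoeff g),
      Lp.coeFn_sub g (∑ v ∈ V, UnitAddTorus.mFourierCoeff g v • UnitAddTorus.mFourierLp 2 v)] with x h1 h2 h3
    rw [h3, Pi.sub_apply, h1, h2]
  · rw [← hG2]
    have h1 : ∑ v ∈ V, ‖UnitAddTorus.mFourierCoeff g v‖ ^ 2 ≤ ∫ t, ‖g t‖ ^ 2 :=
      sum_le_hasSum V (fun _ _ => by positivity) hpars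
    refine (ENNReal.ofReal_le_ofReal h1).trans ?_
    rw [integral_eq_lintegral_of_nonneg_ae (Filter.Eventually.of_forall fun _ => by positivity)
      (by exact (Lp.aestronglyMeasurable g).norm.pow 2)]
    refine ENNReal.ofReal_toReal_le.trans (le_of_eq (lintegral_congr_ae ?_))
    filter_upwards [hgG] with x hx
    rw [hx, ENNReal.ofReal_pow (norm_nonneg _), ofReal_norm]

end Torus

section Packet
variable {d : ℕ}

/-- A smooth bump adapted to the unit cube. -/
def bumpX (d : ℕ) : ContDiffBump (0 : Fin d → ℝ) := ⟨1 / 4, 1 / 2, by norm_num, by norm_num⟩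

lemma bumpX_eq_one {x : Fin d → ℝ} (hx : ‖x‖ ≤ 1 / 4) : bumpX d x = 1 :=
  (bumpX d).one_of_mem_closedBall (by simpa [bumpX] using hx)

lemma bumpX_eq_zero {x : Fin d → ℝ} (hx : 1 / 2 ≤ ‖x‖) : bumpX d x = 0 :=
  (bumpX d).zero_of_le_dist (by simpa [bumpX] using hx)

lemma norm_bumpX_le (x : Fin d → ℝ) : ‖((bumpX d x : ℝ) : ℂ)‖ ≤ 1 := by
  rw [Complex.norm_real, Real.norm_of_nonneg (bumpX d).nonneg]
  exact (bumpX d).le_one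

/-- Wave packets are indexed by a frequency and a position. -/
abbrev Idx (d : ℕ) := (Fin d → ℤ) × (Fin d → ℤ)

/-- The centre of the frequency cell of index `q` at scale `1 / ρ`. -/
def freq (ρ : ℝ) (q : Fin d → ℤ) : Fin d → ℝ := (1 / (2 * ρ)) • toR q

/-- The `L²`-normalised wave packet of index `T` at scale `ρ`. -/
def packet (ρ : ℝ) (T : Idx d) (ξ : Fin d → ℝ) : ℂ :=
  (Real.sqrt (ρ ^ d) : ℂ) * (bumpX d (ρ • (ξ - freq ρ T.1)) : ℂ) *
    ec (toR T.2 ⬝ᵥ (ρ • (ξ - freq ρ T.1)))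

/-- A finite superposition of wave packets. -/
def synth (ρ : ℝ) (𝕋 : Finset (Idx d)) (c : Idx d → ℂ) (ξ : Fin d → ℝ) : ℂ :=
  ∑ T ∈ 𝕋, c T * packet ρ T ξ

lemma continuous_packet (ρ : ℝ) (T : Idx d) : Continuous (packet ρ T) := by
  unfold packet
  have h := (bumpX d).continuous
  have h2 := continuous_ec
  simp only [dotProduct]
  fun_prop

lemma continuous_synth (ρ : ℝ) (𝕋 : Finset (Idx d)) (c : Idx d → ℂ) : Continuous (synth ρ 𝕋 c) :=
  continuous_finsetSum _ fun T _ => continuous_const.mul (continuous_packet ρ T)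

lemma packet_eq_zero {ρ : ℝ} (hρ : 0 < ρ) {T : Idx d} {ξ : Fin d → ℝ}
    (h : 1 / (2 * ρ) ≤ ‖ξ - freq ρ T.1‖) : packet ρ T ξ = 0 := by
  rw [packet, bumpX_eq_zero]
  · simp
  · rw [norm_smul, Real.norm_of_nonneg hρ.le]
    calc (1 / 2 : ℝ) = ρ * (1 / (2 * ρ)) := by field_simp
      _ ≤ _ := by gcongr

lemma norm_packet_le (ρ : ℝ) (T : Idx d) (ξ : Fin d → ℝ) : ‖packet ρ T ξ‖ ≤ Real.sqrt (ρ ^ d) := by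
  rw [packet, norm_mul, norm_mul, norm_ec, mul_one, Complex.norm_real,
    Real.norm_of_nonneg (Real.sqrt_nonneg _)]
  exact mul_le_of_le_one_right (Real.sqrt_nonneg _) (norm_bumpX_le _)

lemma lintegral_packet_le {ρ : ℝ} (hρ : 0 < ρ) (T : Idx d) :
    ∫⁻ ξ, ‖packet ρ T ξ‖ₑ ≤ ENNReal.ofReal (1 / Real.sqrt (ρ ^ d)) := by
  calc _ ≤ ∫⁻ ξ, (Metric.closedBall (freq ρ T.1) (1 / (2 * ρ))).indicator
        (fun _ => ENNReal.ofReal (Real.sqrt (ρ ^ d))) ξ := by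
        refine lintegral_mono fun ξ => ?_
        by_cases h : ξ ∈ Metric.closedBall (freq ρ T.1) (1 / (2 * ρ))
        · rw [Set.indicator_of_mem h, ← ofReal_norm]
          exact ENNReal.ofReal_le_ofReal (norm_packet_le ρ T ξ)
        · rw [packet_eq_zero hρ (by rw [mem_closedBall_iff_norm, not_le] at h; exact h.le)]
          simp
    _ = _ := by
        rw [lintegral_indicator Metric.isClosed_closedBall.measurableSet, lintegral_const,
          Measure.restrict_apply_univ, Real.volume_pi_closedBall _ (by positivity),
          ← ENNReal.ofReal_mul (Real.sqrt_nonneg _)]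
        congr 1
        have h0 : 0 < Real.sqrt (ρ ^ d) := Real.sqrt_pos.2 (by positivity)
        rw [eq_div_iff h0.ne', mul_right_comm, Real.mul_self_sqrt (by positivity), Fintype.card_fin,
          ← mul_pow]
        rw [show ρ * (2 * (1 / (2 * ρ))) = 1 by field_simp, one_pow]

lemma integrable_packet {ρ : ℝ} (hρ : 0 < ρ) (T : Idx d) : Integrable (packet ρ T) :=
  ⟨(continuous_packet ρ T).aestronglyMeasurable, (lintegral_packet_le hρ T).trans_lt (by simp)⟩

lemma integrable_synth {ρ : ℝ} (hρ : 0 < ρ) (𝕋 : Finset (Idx d)) (c : Idx d → ℂ) :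
    Integrable (synth ρ 𝕋 c) :=
  integrable_finsetSum _ fun T _ => (integrable_packet hρ T).const_mul _

lemma lintegral_comp_scale {ρ : ℝ} (hρ : 0 < ρ) (a : Fin d → ℝ) (F : (Fin d → ℝ) → ℝ≥0∞) :
    ∫⁻ ξ, F (ρ • (ξ - a)) = ENNReal.ofReal ((1 / ρ) ^ d) * ∫⁻ η, F η := by
  have he : MeasurableEmbedding (fun ξ : Fin d → ℝ => ρ • (ξ - a)) :=
    ((Homeomorph.subRight a).trans (Homeomorph.smulOfNeZero ρ hρ.ne')).measurableEmbedding
  rw [← he.lintegral_map F]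
  have : Measure.map (fun ξ : Fin d → ℝ => ρ • (ξ - a)) volume =
      ENNReal.ofReal ((1 / ρ) ^ d) • (volume : Measure (Fin d → ℝ)) := by
    rw [show (fun ξ : Fin d → ℝ => ρ • (ξ - a)) = (ρ • ·) ∘ (fun ξ => ξ - a) from rfl,
      ← Measure.map_map (by fun_prop) (by fun_prop), map_sub_right_eq_self,
      Measure.map_addHaar_smul _ hρ.ne']
    congr 2
    rw [Module.finrank_fintype_fun_eq_card, Fintype.card_fin, abs_of_pos (by positivity), one_div, inv_pow]
  rw [this, lintegral_smul_measure, smul_eq_mul]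

lemma mem_unitCube_of_norm_lt {x : Fin d → ℝ} (hx : ‖x‖ < 1 / 2) : x ∈ unitCube d := by
  intro i
  have := abs_lt.1 ((norm_le_pi_norm x i).trans_lt hx)
  exact ⟨by linarith, by linarith⟩

/-- A localised trigonometric polynomial is controlled by its coefficients. -/
lemma lintegral_cell_le {ρ : ℝ} (hρ : 0 < ρ) (q : Fin d → ℤ) (F : (Fin d → ℝ) → ℂ) :
    ∫⁻ ξ, ‖(Real.sqrt (ρ ^ d) : ℂ) * (bumpX d (ρ • (ξ - freq ρ q)) : ℂ) *
      F (ρ • (ξ - freq ρ q))‖ₑ ^ 2 ≤ ∫⁻ x in unitCube d, ‖F x‖ₑ ^ 2 := by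
  have h1 := lintegral_comp_scale hρ (freq ρ q)
    (fun η => ‖(Real.sqrt (ρ ^ d) : ℂ) * (bumpX d η : ℂ) * F η‖ₑ ^ 2)
  rw [h1, ← lintegral_const_mul' _ _ (by simp), ← lintegral_indicator measurableSet_unitCube]
  refine lintegral_mono fun η => ?_
  by_cases h : ‖η‖ < 1 / 2
  · rw [Set.indicator_of_mem (mem_unitCube_of_norm_lt h), enorm_mul, enorm_mul, mul_pow, mul_pow,
      ← mul_assoc, ← mul_assoc]
    have h2 : ENNReal.ofReal ((1 / ρ) ^ d) * ‖(Real.sqrt (ρ ^ d) : ℂ)‖ₑ ^ 2 = 1 := by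
      rw [← ofReal_norm, Complex.norm_real, Real.norm_of_nonneg (Real.sqrt_nonneg _),
        ← ENNReal.ofReal_pow (Real.sqrt_nonneg _), ← ENNReal.ofReal_mul (by positivity),
        Real.sq_sqrt (by positivity), ← mul_pow, one_div_mul_cancel hρ.ne']
      simp
    rw [h2, one_mul]
    refine mul_le_of_le_one_left' (pow_le_one' ?_ 2)
    rw [← ofReal_norm]
    exact ENNReal.ofReal_le_one.2 (norm_bumpX_le η)
  · rw [bumpX_eq_zero (not_lt.1 h)]
    simp

lemma card_near_freq_le {ρ : ℝ} (hρ : 0 < ρ) (Q : Finset (Fin d → ℤ)) (ξ : Fin d → ℝ) :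
    (Q.filter fun q => ‖ξ - freq ρ q‖ < 1 / (2 * ρ)).card ≤ 3 ^ d := by
  classical
  have hsub : (Q.filter fun q => ‖ξ - freq ρ q‖ < 1 / (2 * ρ)) ⊆
      Fintype.piFinset fun i => Finset.Icc (⌊2 * ρ * ξ i⌋ - 1) (⌊2 * ρ * ξ i⌋ + 1) := by
    intro q hq
    rw [Finset.mem_filter] at hq
    rw [Fintype.mem_piFinset]
    intro i
    have h1 := (norm_le_pi_norm (ξ - freq ρ q) i).trans_lt hq.2
    have h2 : |2 * ρ * ξ i - q i| < 1 := by
      have : 2 * ρ * ξ i - q i = 2 * ρ * (ξ - freq ρ q) i := by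
        simp only [freq, toR, Pi.sub_apply, Pi.smul_apply, smul_eq_mul]
        field_simp
      rw [this, abs_mul, abs_of_pos (by positivity)]
      rw [Real.norm_eq_abs] at h1
      calc _ < 2 * ρ * (1 / (2 * ρ)) := by gcongr
        _ = 1 := by field_simp
    have h3 := Int.floor_le (2 * ρ * ξ i)
    have h4 := Int.lt_floor_add_one (2 * ρ * ξ i)
    rw [abs_lt] at h2
    rw [Finset.mem_Icc]
    constructor
    · have : ((⌊2 * ρ * ξ i⌋ : ℤ) : ℝ) - 1 < ((q i : ℤ) : ℝ) + 1 := by linarith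
      have : ⌊2 * ρ * ξ i⌋ - 1 < q i + 1 := by exact_mod_cast this
      omega
    · have : ((q i : ℤ) : ℝ) < ((⌊2 * ρ * ξ i⌋ : ℤ) : ℝ) + 2 := by linarith
      have : q i < ⌊2 * ρ * ξ i⌋ + 2 := by exact_mod_cast this
      omega
  refine (Finset.card_le_card hsub).trans ?_
  rw [Fintype.card_piFinset]
  refine (Finset.prod_le_prod' (g := fun _ => 3) fun i _ => ?_).trans (by simp)
  rw [Int.card_Icc]
  omega

lemma lintegral_synth_sq_le {ρ : ℝ} (hρ : 0 < ρ) (𝕋 : Finset (Idx d)) (c : Idx d → ℂ) :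
    ∫⁻ ξ, ‖synth ρ 𝕋 c ξ‖ₑ ^ 2 ≤ ENNReal.ofReal (3 ^ d * ∑ T ∈ 𝕋, ‖c T‖ ^ 2) := by
  classical
  set Q := 𝕋.image Prod.fst with hQ
  set V : (Fin d → ℤ) → Finset (Fin d → ℤ) := fun q => (𝕋.filter fun T => T.1 = q).image Prod.snd
  have hfib : ∀ {M : Type} [AddCommMonoid M] (F : Idx d → M),
      ∑ T ∈ 𝕋, F T = ∑ q ∈ Q, ∑ v ∈ V q, F (q, v) := by
    intro M _ F
    rw [← Finset.sum_fiberwise_of_maps_to (g := Prod.fst) (t := Q)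
      (fun T hT => Finset.mem_image_of_mem _ hT)]
    refine Finset.sum_congr rfl fun q _ => ?_
    rw [Finset.sum_image]
    · refine Finset.sum_congr rfl fun T hT => ?_
      rw [Finset.mem_filter] at hT
      rw [← hT.2]
    · intro T hT T' hT' h
      simp only [Finset.coe_filter, Set.mem_ofPred_eq] at hT hT'
      exact Prod.ext (hT.2.trans hT'.2.symm) h
  set B : (Fin d → ℤ) → (Fin d → ℝ) → ℂ := fun q ξ => ∑ v ∈ V q, c (q, v) * packet ρ (q, v) ξ
  have hB : ∀ q ξ, B q ξ = (Real.sqrt (ρ ^ d) : ℂ) * (bumpX d (ρ • (ξ - freq ρ q)) : ℂ) *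
      trigPoly (V q) (fun v => c (q, v)) (ρ • (ξ - freq ρ q)) := by
    intro q ξ
    simp only [B, trigPoly, Finset.mul_sum, packet]
    refine Finset.sum_congr rfl fun v _ => by ring
  have hpt : ∀ ξ, ‖synth ρ 𝕋 c ξ‖ₑ ^ 2 ≤ 3 ^ d * ∑ q ∈ Q, ‖B q ξ‖ₑ ^ 2 := by
    intro ξ
    set Q' := Q.filter fun q => ‖ξ - freq ρ q‖ < 1 / (2 * ρ)
    have h1 : synth ρ 𝕋 c ξ = ∑ q ∈ Q', B q ξ := by
      rw [synth, hfib (fun T => c T * packet ρ T ξ)]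
      refine (Finset.sum_subset (Finset.filter_subset _ _) fun q hq hq' => ?_).symm
      refine Finset.sum_eq_zero fun v _ => ?_
      rw [packet_eq_zero hρ, mul_zero]
      by_contra hcon
      exact hq' (Finset.mem_filter.2 ⟨hq, not_le.1 hcon⟩)
    have h2 : ‖synth ρ 𝕋 c ξ‖ ^ 2 ≤ 3 ^ d * ∑ q ∈ Q, ‖B q ξ‖ ^ 2 := by
      rw [h1]
      calc ‖∑ q ∈ Q', B q ξ‖ ^ 2 ≤ (∑ q ∈ Q', ‖B q ξ‖) ^ 2 := by
            gcongr; exact norm_sum_le _ _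
        _ ≤ Q'.card * ∑ q ∈ Q', ‖B q ξ‖ ^ 2 := sq_sum_le_card_mul_sum_sq
        _ ≤ 3 ^ d * ∑ q ∈ Q, ‖B q ξ‖ ^ 2 := by
            gcongr
            · exact_mod_cast card_near_freq_le hρ Q ξ
            · exact Finset.filter_subset _ _
    have h3 := ENNReal.ofReal_le_ofReal h2
    rw [ENNReal.ofReal_mul (by positivity), ENNReal.ofReal_sum_of_nonneg (fun _ _ => by positivity)] at h3
    simpa only [ENNReal.ofReal_pow (norm_nonneg _), ofReal_norm, ENNReal.ofReal_pow (by norm_num : (0:ℝ) ≤ 3),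
      ENNReal.ofReal_ofNat] using h3
  have hBc : ∀ q, Continuous (B q) := fun q =>
    continuous_finsetSum _ fun v _ => continuous_const.mul (continuous_packet ρ _)
  calc _ ≤ ∫⁻ ξ, 3 ^ d * ∑ q ∈ Q, ‖B q ξ‖ₑ ^ 2 := lintegral_mono hpt
    _ = 3 ^ d * ∑ q ∈ Q, ∫⁻ ξ, ‖B q ξ‖ₑ ^ 2 := by
        rw [lintegral_const_mul' _ _ (by simp), lintegral_finsetSum']
        exact fun q _ => ((hBc q).enorm.measurable.pow_const 2).aemeasurable
    _ ≤ 3 ^ d * ∑ q ∈ Q, ENNReal.ofReal (∑ v ∈ V q, ‖c (q, v)‖ ^ 2) := by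
        gcongr with q hq
        simp only [hB]
        exact (lintegral_cell_le hρ q _).trans (lintegral_trigPoly _ _).le
    _ = _ := by
        rw [← ENNReal.ofReal_sum_of_nonneg (fun _ _ => by positivity), ENNReal.ofReal_mul (by positivity),
          ENNReal.ofReal_pow (by norm_num), ENNReal.ofReal_ofNat, hfib (fun T => ‖c T‖ ^ 2)]

end Packet

section Analysis
variable {d : ℕ}

/-- The index of the frequency cell containing `ξ`. -/
def cellIdx (ρ : ℝ) (ξ : Fin d → ℝ) : Fin d → ℤ := fun i => ⌈2 * ρ * ξ i - 1 / 2⌉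

lemma measurable_cellIdx (ρ : ℝ) : Measurable (cellIdx (d := d) ρ) :=
  measurable_pi_iff.2 fun i => Int.measurable_ceil.comp (by fun_prop)

lemma norm_scale_cellIdx_le {ρ : ℝ} (hρ : 0 < ρ) (ξ : Fin d → ℝ) :
    ‖ρ • (ξ - freq ρ (cellIdx ρ ξ))‖ ≤ 1 / 4 := by
  refine (pi_norm_le_iff_of_nonneg (by norm_num)).2 fun i => ?_
  have h1 := Int.le_ceil (2 * ρ * ξ i - 1 / 2)
  have h2 := Int.ceil_lt_add_one (2 * ρ * ξ i - 1 / 2)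
  have h3 : (ρ • (ξ - freq ρ (cellIdx ρ ξ))) i = (2 * ρ * ξ i - ⌈2 * ρ * ξ i - 1 / 2⌉) / 2 := by
    simp only [freq, toR, cellIdx, Pi.sub_apply, Pi.smul_apply, smul_eq_mul]
    field_simp
  rw [h3, Real.norm_eq_abs, abs_le]
  constructor <;> linarith

lemma norm_sub_cellIdx_le {ρ : ℝ} (hρ : 0 < ρ) (ξ : Fin d → ℝ) :
    ‖ξ - freq ρ (cellIdx ρ ξ)‖ ≤ 1 / ρ := by
  have h := norm_scale_cellIdx_le hρ ξ
  rw [norm_smul, Real.norm_of_nonneg hρ.le] at h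
  rw [le_div_iff₀ hρ]
  linarith

/-- Frequency indices near a ball. -/
def freqSet (ρ : ℝ) (ν : Fin d → ℝ) (r : ℝ) : Finset (Fin d → ℤ) :=
  Fintype.piFinset fun i => Finset.Icc ⌈2 * ρ * (ν i - r)⌉ ⌊2 * ρ * (ν i + r)⌋

lemma mem_freqSet {ρ : ℝ} (hρ : 0 < ρ) {ν : Fin d → ℝ} {r : ℝ} (hr : 0 ≤ r) {q : Fin d → ℤ} :
    q ∈ freqSet ρ ν r ↔ ‖freq ρ q - ν‖ ≤ r := by
  rw [freqSet, Fintype.mem_piFinset, pi_norm_le_iff_of_nonneg hr]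
  refine forall_congr' fun i => ?_
  rw [Finset.mem_Icc, Int.ceil_le, Int.le_floor, Real.norm_eq_abs, abs_le]
  have h : (freq ρ q - ν) i = q i / (2 * ρ) - ν i := by
    simp only [freq, toR, Pi.sub_apply, Pi.smul_apply, smul_eq_mul]
    ring
  have h1 : (q i : ℝ) = 2 * ρ * (q i / (2 * ρ)) := by field_simp
  rw [h, h1]
  have h2 : 0 < 2 * ρ := by positivity
  rw [mul_le_mul_iff_right₀ h2, mul_le_mul_iff_right₀ h2, ← h1]
  constructor <;> rintro ⟨h3, h4⟩ <;> constructor <;> linarith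

lemma card_freqSet_le {ρ : ℝ} (hρ : 1 ≤ ρ) (ν : Fin d → ℝ) {r : ℝ} (hr : 0 ≤ r) :
    ((freqSet ρ ν r).card : ℝ) ≤ (4 * r + 1) ^ d * ρ ^ d := by
  rw [freqSet, Fintype.card_piFinset, ← mul_pow]
  push_cast
  refine (Finset.prod_le_prod (g := fun _ => (4 * r + 1) * ρ) (fun _ _ => by positivity) fun i _ => ?_).trans
    (by simp)
  rw [Int.card_Icc]
  have h1 := Int.le_ceil (2 * ρ * (ν i - r))
  have h2 := Int.floor_le (2 * ρ * (ν i + r))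
  have h3 : (((⌊2 * ρ * (ν i + r)⌋ + 1 - ⌈2 * ρ * (ν i - r)⌉).toNat : ℤ) : ℝ) ≤ (4 * r + 1) * ρ := by
    rw [Int.toNat_eq_max, Int.cast_max]
    refine max_le ?_ (by push_cast; positivity)
    push_cast
    nlinarith
  exact_mod_cast h3

lemma exists_cell_approx {f : (Fin d → ℝ) → ℂ} (hf : AEStronglyMeasurable f)
    (hf2 : ∫⁻ ξ, ‖f ξ‖ₑ ^ 2 < ∞) {ρ : ℝ} (hρ : 0 < ρ) (q : Fin d → ℤ)
    (hsupp : ∀ ξ, cellIdx ρ ξ ≠ q → f ξ = 0) {η : ℝ≥0∞} (hη : 0 < η) :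
    ∃ (V : Finset (Fin d → ℤ)) (c : (Fin d → ℤ) → ℂ),
      ∫⁻ ξ, ‖f ξ - ∑ v ∈ V, c v * packet ρ (q, v) ξ‖ₑ ^ 2 ≤ η ∧
      ENNReal.ofReal (∑ v ∈ V, ‖c v‖ ^ 2) ≤ ∫⁻ ξ, ‖f ξ‖ₑ ^ 2 := by
  set A : ℝ := Real.sqrt (ρ ^ d) with hA
  have hA0 : 0 < A := Real.sqrt_pos.2 (by positivity)
  set F : (Fin d → ℝ) → ℂ := fun η => (A : ℂ)⁻¹ * f (freq ρ q + (1 / ρ) • η) with hF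
  have hFf : ∀ ξ, (A : ℂ) * F (ρ • (ξ - freq ρ q)) = f ξ := by
    intro ξ
    simp only [hF, smul_smul, one_div_mul_cancel hρ.ne', one_smul, add_sub_cancel]
    rw [mul_inv_cancel_left₀ (by exact_mod_cast hA0.ne')]
  have hF2 : ∫⁻ x, ‖F x‖ₑ ^ 2 = ∫⁻ ξ, ‖f ξ‖ₑ ^ 2 := by
    have h1 := lintegral_comp_scale hρ (freq ρ q) (fun x => ‖(A : ℂ) * F x‖ₑ ^ 2)
    simp only [hFf] at h1
    rw [h1, ← lintegral_const_mul' _ _ (by simp)]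
    refine lintegral_congr fun x => ?_
    generalize F x = y
    have h2 : ENNReal.ofReal ((1 / ρ) ^ d) * ‖(A : ℂ)‖ₑ ^ 2 = 1 := by
      rw [← ofReal_norm, Complex.norm_real, Real.norm_of_nonneg hA0.le,
        ← ENNReal.ofReal_pow hA0.le, ← ENNReal.ofReal_mul (by positivity),
        Real.sq_sqrt (by positivity), ← mul_pow, one_div_mul_cancel hρ.ne']
      simp
    rw [enorm_mul, mul_pow, ← mul_assoc, h2, one_mul]
  have hFm : AEStronglyMeasurable F := by
    refine (hf.comp_quasiMeasurePreserving (g := f) (f := fun x => freq ρ q + (1 / ρ) • x) ?_).const_mul _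
    have h1 : Measure.QuasiMeasurePreserving (fun x : Fin d → ℝ => (1 / ρ) • x) volume volume := by
      refine ⟨by fun_prop, ?_⟩
      rw [Measure.map_addHaar_smul _ (by positivity : (1 / ρ) ≠ 0)]
      exact Measure.smul_absolutelyContinuous
    exact (measurePreserving_add_left volume (freq ρ q)).quasiMeasurePreserving.comp h1
  have hFU : ∫⁻ x in unitCube d, ‖F x‖ₑ ^ 2 ≤ ∫⁻ ξ, ‖f ξ‖ₑ ^ 2 :=
    hF2 ▸ setLIntegral_le_lintegral _ _
  obtain ⟨V, c, hV1, hV2⟩ := exists_trigPoly_approx hFm.restrict (hFU.trans_lt hf2) hη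
  refine ⟨V, c, ?_, hV2.trans hFU⟩
  refine le_trans ?_ hV1
  refine le_trans (le_of_eq ?_) (lintegral_cell_le hρ q (fun x => F x - trigPoly V c x))
  refine lintegral_congr fun ξ => ?_
  congr 2
  rw [mul_sub]
  congr 1
  · rw [mul_right_comm, ← hA, hFf]
    by_cases h : cellIdx ρ ξ = q
    · rw [bumpX_eq_one]
      · simp
      · rw [← h]; exact norm_scale_cellIdx_le hρ ξ
    · rw [hsupp ξ h, zero_mul]
  · simp only [trigPoly, Finset.mul_sum, packet]
    exact Finset.sum_congr rfl fun v _ => by ring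

/-- Approximate wave packet decomposition. -/
lemma exists_synth_approx {f : (Fin d → ℝ) → ℂ} (hf : AEStronglyMeasurable f)
    (hf2 : ∫⁻ ξ, ‖f ξ‖ₑ ^ 2 < ∞) {ρ : ℝ} (hρ : 0 < ρ) {ν : Fin d → ℝ} {r : ℝ} (hr : 0 ≤ r)
    (hsupp : ∀ ξ, r < ‖ξ - ν‖ → f ξ = 0) {η : ℝ≥0∞} (hη : 0 < η) :
    ∃ (𝕋 : Finset (Idx d)) (c : Idx d → ℂ), (∀ T ∈ 𝕋, ‖freq ρ T.1 - ν‖ ≤ r + 1 / ρ) ∧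
      ∫⁻ ξ, ‖f ξ - synth ρ 𝕋 c ξ‖ₑ ^ 2 ≤ η ∧
      ENNReal.ofReal (∑ T ∈ 𝕋, ‖c T‖ ^ 2) ≤ ∫⁻ ξ, ‖f ξ‖ₑ ^ 2 := by
  classical
  set Q := freqSet ρ ν (r + 1 / ρ) with hQ
  have hr' : 0 ≤ r + 1 / ρ := by positivity
  have hms : ∀ q : Fin d → ℤ, MeasurableSet {ξ | cellIdx ρ ξ = q} := fun q =>
    measurable_cellIdx ρ (measurableSet_singleton q)
  set fq : (Fin d → ℤ) → (Fin d → ℝ) → ℂ := fun q => {ξ | cellIdx ρ ξ = q}.indicator f with hfq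
  have hfqle : ∀ q ξ, ‖fq q ξ‖ₑ ≤ ‖f ξ‖ₑ := fun q ξ => by
    simp only [hfq, Set.indicator]; split_ifs <;> simp
  have hfq0 : ∀ q ξ, cellIdx ρ ξ ≠ q → fq q ξ = 0 := fun q ξ h => by
    simp only [hfq]; exact Set.indicator_of_notMem (s := {ξ' | cellIdx ρ ξ' = q}) h f
  have hfq1 : ∀ ξ, fq (cellIdx ρ ξ) ξ = f ξ := fun ξ => by
    simp only [hfq]; exact Set.indicator_of_mem (s := {ξ' | cellIdx ρ ξ' = cellIdx ρ ξ}) rfl f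
  have hfqm : ∀ q, AEStronglyMeasurable (fq q) := fun q => hf.indicator (hms q)
  clear_value fq
  have hcellQ : ∀ ξ, f ξ ≠ 0 → cellIdx ρ ξ ∈ Q := by
    intro ξ h
    rw [hQ, mem_freqSet hρ hr']
    have h1 : ‖ξ - ν‖ ≤ r := by
      by_contra hcon
      exact h (hsupp ξ (not_le.1 hcon))
    have h2 := norm_sub_cellIdx_le hρ ξ
    rw [norm_sub_rev] at h2
    calc ‖freq ρ (cellIdx ρ ξ) - ν‖ = ‖(freq ρ (cellIdx ρ ξ) - ξ) + (ξ - ν)‖ := by congr 1; abel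
      _ ≤ 1 / ρ + r := (norm_add_le _ _).trans (add_le_add h2 h1)
      _ = _ := add_comm _ _
  have hfsum : ∀ ξ, f ξ = ∑ q ∈ Q, fq q ξ := by
    intro ξ
    by_cases h : f ξ = 0
    · rw [h]
      refine (Finset.sum_eq_zero (fun q _ => ?_ : ∀ q ∈ Q, fq q ξ = 0)).symm
      have := hfqle q ξ
      rw [h] at this
      simpa using this
    · rw [Finset.sum_eq_single_of_mem _ (hcellQ ξ h) fun q _ hq => hfq0 q ξ (Ne.symm hq), hfq1]
  have hfqsum : ∑ q ∈ Q, ∫⁻ ξ, ‖fq q ξ‖ₑ ^ 2 ≤ ∫⁻ ξ, ‖f ξ‖ₑ ^ 2 := by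
    rw [← lintegral_finsetSum' _ fun q _ => ((hfqm q).enorm.pow_const 2)]
    refine lintegral_mono fun ξ => ?_
    by_cases h : cellIdx ρ ξ ∈ Q
    · rw [Finset.sum_eq_single_of_mem _ h fun q _ hq => by
        rw [hfq0 q ξ (Ne.symm hq)]; simp, hfq1]
    · rw [Finset.sum_eq_zero fun q hq => by
        rw [hfq0 q ξ (fun h' => h (h' ▸ hq))]; simp]
      exact bot_le
  set M : ℝ≥0∞ := (Q.card : ℝ≥0∞) ^ 2 + 1 with hM
  have hM0 : M ≠ 0 := by simp [hM]
  have hMt : M ≠ ∞ := by simp [hM]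
  have hδ : 0 < η / M := ENNReal.div_pos hη.ne' hMt
  choose V c hVc1 hVc2 using fun q => exists_cell_approx (f := fq q) (hfqm q)
    ((lintegral_mono fun ξ => pow_le_pow_left' (hfqle q ξ) 2).trans_lt hf2) hρ q (hfq0 q) hδ
  set W := Q.biUnion V with hW
  set c' : Idx d → ℂ := fun T => if T.2 ∈ V T.1 then c T.1 T.2 else 0 with hc'
  have hsumV : ∀ {M : Type} [AddCommMonoid M] (F : Idx d → ℂ → M), (∀ T, F T 0 = 0) →
      ∑ T ∈ Q ×ˢ W, F T (c' T) = ∑ q ∈ Q, ∑ v ∈ V q, F (q, v) (c q v) := by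
    intro M _ F hF
    rw [Finset.sum_product]
    refine Finset.sum_congr rfl fun q hq => ?_
    rw [← Finset.sum_subset (Finset.subset_biUnion_of_mem V hq) (fun v _ hv => by simp [hc', hv, hF])]
    exact Finset.sum_congr rfl fun v hv => by simp [hc', hv]
  refine ⟨Q ×ˢ W, c', ?_, ?_, ?_⟩
  · intro T hT
    exact (mem_freqSet hρ hr').1 (Finset.mem_product.1 hT).1
  · have hpt : ∀ ξ, ‖f ξ - synth ρ (Q ×ˢ W) c' ξ‖ₑ ^ 2 ≤
        Q.card * ∑ q ∈ Q, ‖fq q ξ - ∑ v ∈ V q, c q v * packet ρ (q, v) ξ‖ₑ ^ 2 := by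
      intro ξ
      rw [synth, hsumV (fun T z => z * packet ρ T ξ) (by simp), hfsum ξ, ← Finset.sum_sub_distrib]
      set B := fun q => fq q ξ - ∑ v ∈ V q, c q v * packet ρ (q, v) ξ
      have h2 : ‖∑ q ∈ Q, B q‖ ^ 2 ≤ Q.card * ∑ q ∈ Q, ‖B q‖ ^ 2 :=
        (pow_le_pow_left₀ (norm_nonneg _) (norm_sum_le _ _) 2).trans sq_sum_le_card_mul_sum_sq
      have h3 := ENNReal.ofReal_le_ofReal h2
      rw [ENNReal.ofReal_mul (by positivity), ENNReal.ofReal_sum_of_nonneg (fun _ _ => by positivity)] at h3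
      simpa only [ENNReal.ofReal_pow (norm_nonneg _), ofReal_norm, ENNReal.ofReal_natCast] using h3
    calc _ ≤ ∫⁻ ξ, Q.card * ∑ q ∈ Q, ‖fq q ξ - ∑ v ∈ V q, c q v * packet ρ (q, v) ξ‖ₑ ^ 2 := lintegral_mono hpt
      _ = Q.card * ∑ q ∈ Q, ∫⁻ ξ, ‖fq q ξ - ∑ v ∈ V q, c q v * packet ρ (q, v) ξ‖ₑ ^ 2 := by
          rw [lintegral_const_mul' _ _ (by simp), lintegral_finsetSum']
          intro q _
          refine (AEStronglyMeasurable.sub (hfqm q) ?_).enorm.pow_const 2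
          exact (continuous_finsetSum _ fun v _ => continuous_const.mul
            (continuous_packet ρ _)).aestronglyMeasurable
      _ ≤ Q.card * ∑ q ∈ Q, η / M := by gcongr with q; exact hVc1 q
      _ = (Q.card : ℝ≥0∞) ^ 2 * (η / M) := by
          rw [Finset.sum_const, nsmul_eq_mul, ← mul_assoc, sq]
      _ ≤ M * (η / M) := by gcongr; exact le_self_add
      _ = η := ENNReal.mul_div_cancel hM0 hMt
  · rw [hsumV (fun T z => ‖z‖ ^ 2) (by simp), ENNReal.ofReal_sum_of_nonneg
      (fun _ _ => Finset.sum_nonneg fun _ _ => by positivity)]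
    exact (Finset.sum_le_sum fun q _ => hVc2 q).trans hfqsum

end Analysis

section Analysis
variable {d k : ℕ}

lemma contDiff_intervalIntegral_param {P E : Type*} [NormedAddCommGroup P] [NormedSpace ℝ P]
    [NormedAddCommGroup E] [NormedSpace ℝ E] [CompleteSpace E] {F : P → ℝ → E}
    (hF : ContDiff ℝ (⊤ : ℕ∞) (Function.uncurry F)) :
    ContDiff ℝ (⊤ : ℕ∞) fun p => ∫ u in (0 : ℝ)..1, F p u := by
  set χ : ContDiffBump (0 : ℝ) := ⟨2, 3, by norm_num, by norm_num⟩
  set f : ℝ → ℝ := (Set.Ioc (0 : ℝ) 1).indicator 1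
  have hf : LocallyIntegrable f volume := by
    refine Integrable.locallyIntegrable ?_
    rw [integrable_indicator_iff measurableSet_Ioc]
    exact integrableOn_const (by simp) (by simp)
  have h := contDiffOn_convolution_right_with_param (μ := volume) (n := ⊤)
    (ContinuousLinearMap.lsmul ℝ ℝ : ℝ →L[ℝ] E →L[ℝ] E)
    (g := fun (p : P) (x : ℝ) => χ x • F p (-x)) (s := Set.univ) (k := Metric.closedBall 0 3)
    isOpen_univ (isCompact_closedBall _ _) (fun p x _ hx => by
      rw [χ.zero_of_le_dist, zero_smul]
      rw [Metric.mem_closedBall, not_le] at hx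
      exact hx.le) hf (by
      refine ContDiff.contDiffOn ?_
      refine (χ.contDiff.comp contDiff_snd).smul ?_
      exact hF.comp (contDiff_fst.prodMk contDiff_snd.neg))
  rw [Set.univ_prod_univ, contDiffOn_univ] at h
  have h' := h.comp (contDiff_id.prodMk contDiff_const : ContDiff ℝ _ fun p : P => (p, (0 : ℝ)))
  convert h' using 1
  funext p
  rw [intervalIntegral.integral_of_le zero_le_one, ← integral_indicator measurableSet_Ioc]
  simp only [convolution_def, Function.comp, id]
  refine integral_congr_ae (ae_of_all _ fun u => ?_)
  by_cases hu : u ∈ Set.Ioc (0 : ℝ) 1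
  · have : χ (-u) = 1 := by
      refine χ.one_of_mem_closedBall ?_
      simp only [χ, Metric.mem_closedBall, dist_zero_right, norm_neg, Real.norm_eq_abs]
      rw [abs_of_pos hu.1]; linarith [hu.2]
    simp [f, hu, this]
  · simp [f, hu]

/-- The second order Taylor remainder of `Φ`, rescaled. -/
def taylorRem (Φ : (Fin d → ℝ) → Fin k → ℝ) (s : ℝ) (ξ η : Fin d → ℝ) : Fin k → ℝ :=
  ∫ u in (0 : ℝ)..1, (1 - u) • fderiv ℝ (fderiv ℝ Φ) (ξ + (s * u) • η) η η

lemma contDiff_taylorRem {Φ : (Fin d → ℝ) → Fin k → ℝ} (hΦ : ContDiff ℝ (⊤ : ℕ∞) Φ) :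
    ContDiff ℝ (⊤ : ℕ∞) fun p : ℝ × (Fin d → ℝ) × (Fin d → ℝ) => taylorRem Φ p.1 p.2.1 p.2.2 := by
  refine contDiff_intervalIntegral_param
    (F := fun (p : ℝ × (Fin d → ℝ) × (Fin d → ℝ)) u =>
      (1 - u) • fderiv ℝ (fderiv ℝ Φ) (p.2.1 + (p.1 * u) • p.2.2) p.2.2 p.2.2) ?_
  have h1 : ContDiff ℝ (⊤ : ℕ∞) (fderiv ℝ Φ) := hΦ.fderiv_right (by simp)
  have h2 : ContDiff ℝ (⊤ : ℕ∞) (fderiv ℝ (fderiv ℝ Φ)) := h1.fderiv_right (by simp)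
  unfold Function.uncurry
  fun_prop

lemma taylorRem_eq {Φ : (Fin d → ℝ) → Fin k → ℝ} (hΦ : ContDiff ℝ (⊤ : ℕ∞) Φ) (s : ℝ)
    (ξ η : Fin d → ℝ) :
    Φ (ξ + s • η) = Φ ξ + s • fderiv ℝ Φ ξ η + (s ^ 2) • taylorRem Φ s ξ η := by
  have h1 : ContDiff ℝ (⊤ : ℕ∞) (fderiv ℝ Φ) := hΦ.fderiv_right (by simp)
  have h2 : ContDiff ℝ (⊤ : ℕ∞) (fderiv ℝ (fderiv ℝ Φ)) := h1.fderiv_right (by simp)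
  have key : ∀ u : ℝ, HasDerivAt (fun u : ℝ => (1 - u) • (s • fderiv ℝ Φ (ξ + (s * u) • η) η)
      + Φ (ξ + (s * u) • η)) ((s ^ 2) • ((1 - u) • fderiv ℝ (fderiv ℝ Φ) (ξ + (s * u) • η) η η)) u := by
    intro u
    have e0 : HasDerivAt (fun u : ℝ => ξ + (s * u) • η) (s • η) u := by
      have := (((hasDerivAt_id u).const_mul s).smul_const η).const_add ξ
      simpa using this
    have e1 : HasDerivAt (fun u : ℝ => fderiv ℝ Φ (ξ + (s * u) • η) η)
        (fderiv ℝ (fderiv ℝ Φ) (ξ + (s * u) • η) (s • η) η) u := by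
      have := ((h1.differentiable (by simp)).differentiableAt
        (x := ξ + (s * u) • η)).hasFDerivAt.comp_hasDerivAt u e0
      exact ((ContinuousLinearMap.apply ℝ (Fin k → ℝ) η).hasFDerivAt.comp_hasDerivAt u this)
    have e2 : HasDerivAt (fun u : ℝ => Φ (ξ + (s * u) • η)) (fderiv ℝ Φ (ξ + (s * u) • η) (s • η)) u :=
      ((hΦ.differentiable (by simp)).differentiableAt).hasFDerivAt.comp_hasDerivAt u e0
    have e3 := (((hasDerivAt_id u).const_sub 1).smul (e1.const_smul s)).add e2
    refine e3.congr_deriv ?_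
    simp only [id, map_smul, _root_.smul_apply, Pi.smul_apply]
    module
  have := intervalIntegral.integral_eq_sub_of_hasDerivAt (a := 0) (b := 1)
    (fun u _ => key u) (Continuous.intervalIntegrable (by
      have := h2.continuous
      fun_prop) _ _)
  rw [intervalIntegral.integral_smul] at this
  rw [taylorRem, this]
  simp
  abel

/-- A smooth family of amplitudes supported in a fixed ball. -/
structure IsAmp {P : Type*} [NormedAddCommGroup P] [NormedSpace ℝ P]
    (a : P → (Fin d → ℝ) → ℂ) : Prop where
  smooth : ContDiff ℝ (⊤ : ℕ∞) (Function.uncurry a)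
  supp : ∀ p η, 1 / 2 ≤ ‖η‖ → a p η = 0

namespace IsAmp
variable {P : Type*} [NormedAddCommGroup P] [NormedSpace ℝ P] {a : P → (Fin d → ℝ) → ℂ}

lemma contDiff (ha : IsAmp a) (p : P) : ContDiff ℝ (⊤ : ℕ∞) (a p) :=
  ha.smooth.comp (contDiff_const.prodMk contDiff_id)

lemma tsupport_subset (ha : IsAmp a) (p : P) : tsupport (a p) ⊆ Metric.closedBall 0 (1 / 2) := by
  refine closure_minimal (fun η hη => ?_) Metric.isClosed_closedBall
  rw [mem_closedBall_iff_norm, sub_zero]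
  by_contra h
  exact hη (ha.supp p η (not_le.1 h).le)

lemma hasCompactSupport (ha : IsAmp a) (p : P) : HasCompactSupport (a p) :=
  (isCompact_closedBall _ _).of_isClosed_subset (isClosed_tsupport _) (ha.tsupport_subset p)

lemma deriv (ha : IsAmp a) (v : Fin d → ℝ) : IsAmp fun p η => fderiv ℝ (a p) η v := by
  refine ⟨?_, fun p η hη => ?_⟩
  · exact ContDiff.fderiv_apply (f := fun (q : P × (Fin d → ℝ)) η => a q.1 η)
      (g := fun q => q.2) (k := fun _ => v) (m := (⊤ : ℕ∞))
      (ha.smooth.comp ((contDiff_fst.comp contDiff_fst).prodMk contDiff_snd)) contDiff_snd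
      contDiff_const (by simp)
  · have hη0 : 0 < ‖η‖ := by linarith
    by_cases h : η ∈ tsupport (a p)
    · have h1 := ha.tsupport_subset p h
      rw [mem_closedBall_iff_norm, sub_zero] at h1
      have h2 : IsClosed {η' | fderiv ℝ (a p) η' = 0} :=
        isClosed_eq ((ha.contDiff p).continuous_fderiv (by simp)) continuous_const
      have h3 : ∀ n : ℕ, fderiv ℝ (a p) ((1 + 1 / ((n : ℝ) + 1)) • η) = 0 := fun n => by
        refine image_eq_zero_of_notMem_tsupport fun h4 => ?_
        have h5 := ha.tsupport_subset p (tsupport_fderiv_subset ℝ h4)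
        rw [mem_closedBall_iff_norm, sub_zero, norm_smul, Real.norm_of_nonneg (by positivity)] at h5
        have h6 : 0 < 1 / ((n : ℝ) + 1) := by positivity
        nlinarith
      have h4 : Filter.Tendsto (fun n : ℕ => (1 + 1 / ((n : ℝ) + 1)) • η) Filter.atTop (nhds η) := by
        have := (tendsto_one_div_add_atTop_nhds_zero_nat (𝕜 := ℝ)).const_add 1
        simpa using this.smul_const η
      have h5 : fderiv ℝ (a p) η = 0 := h2.mem_of_tendsto h4 (Filter.Eventually.of_forall h3)
      rw [h5]; rfl
    · rw [image_eq_zero_of_notMem_tsupport (f := fderiv ℝ (a p))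
        (fun h4 => h (tsupport_fderiv_subset ℝ h4))]
      rfl

lemma integrable (ha : IsAmp a) (p : P) : Integrable (a p) :=
  (ha.contDiff p).continuous.integrable_of_hasCompactSupport (ha.hasCompactSupport p)

lemma norm_integral_le (ha : IsAmp a) {K : Set P} (hK : IsCompact K) :
    ∃ C : ℝ, 0 ≤ C ∧ ∀ p ∈ K, ∀ y : Fin d → ℝ, ‖∫ η, a p η * ec (y ⬝ᵥ η)‖ ≤ C := by
  obtain ⟨B, hB⟩ := (hK.prod (isCompact_closedBall (0 : Fin d → ℝ) (1 / 2))).exists_bound_of_continuousOn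
    ha.smooth.continuous.continuousOn
  have hvol : volume (Metric.closedBall (0 : Fin d → ℝ) (1 / 2)) ≠ ∞ :=
    measure_closedBall_lt_top.ne
  refine ⟨|B| * (volume (Metric.closedBall (0 : Fin d → ℝ) (1 / 2))).toReal, by positivity, fun p hp y => ?_⟩
  have h1 : ∫ η, a p η * ec (y ⬝ᵥ η) =
      ∫ η in Metric.closedBall (0 : Fin d → ℝ) (1 / 2), a p η * ec (y ⬝ᵥ η) := by
    refine (setIntegral_eq_integral_of_forall_compl_eq_zero fun η hη => ?_).symm
    rw [mem_closedBall_iff_norm, sub_zero, not_le] at hη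
    rw [ha.supp p η hη.le, zero_mul]
  rw [h1]
  refine norm_setIntegral_le_of_norm_le_const hvol.lt_top fun η hη => ?_
  rw [norm_mul, norm_ec, mul_one]
  exact (hB (p, η) ⟨hp, hη⟩).trans (le_abs_self B)

end IsAmp

lemma hasFDerivAt_ec_dot (y η : Fin d → ℝ) :
    DifferentiableAt ℝ (fun η => ec (y ⬝ᵥ η)) η ∧ ∀ i, fderiv ℝ (fun η => ec (y ⬝ᵥ η)) η (Pi.single i 1) =
      2 * Real.pi * Complex.I * y i * ec (y ⬝ᵥ η) := by
  have h0 : HasFDerivAt (fun η : Fin d → ℝ => y ⬝ᵥ η)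
      (∑ i, y i • ContinuousLinearMap.proj (R := ℝ) (φ := fun _ : Fin d => ℝ) i) η := by
    have : HasFDerivAt (fun η : Fin d → ℝ => ∑ i, y i * η i)
        (∑ i, y i • ContinuousLinearMap.proj (R := ℝ) (φ := fun _ : Fin d => ℝ) i) η :=
      HasFDerivAt.fun_sum fun i _ => (hasFDerivAt_apply i η).const_mul (y i)
    exact this
  have h1 : HasFDerivAt (fun η => ec (y ⬝ᵥ η)) _ η :=
    ((Complex.ofRealCLM.hasFDerivAt.comp η h0).const_mul (2 * Real.pi * Complex.I)).cexp
  refine ⟨h1.differentiableAt, fun i => ?_⟩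
  rw [h1.fderiv]
  have h2 : (∑ j, y j • ContinuousLinearMap.proj (R := ℝ) (φ := fun _ : Fin d => ℝ) j) (Pi.single i 1) = y i := by
    simp [Pi.single_apply]
  simp only [_root_.smul_apply, ContinuousLinearMap.comp_apply, h2]
  simp [ec]
  ring

lemma IsAmp.integral_deriv {P : Type*} [NormedAddCommGroup P] [NormedSpace ℝ P]
    {a : P → (Fin d → ℝ) → ℂ} (ha : IsAmp a) (p : P) (y : Fin d → ℝ) (i : Fin d) :
    2 * Real.pi * Complex.I * y i * ∫ η, a p η * ec (y ⬝ᵥ η) =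
      - ∫ η, fderiv ℝ (a p) η (Pi.single i 1) * ec (y ⬝ᵥ η) := by
  have hc : Continuous fun η : Fin d → ℝ => ec (y ⬝ᵥ η) :=
    continuous_ec.comp (by unfold dotProduct; fun_prop)
  have hint : ∀ b : P → (Fin d → ℝ) → ℂ, IsAmp b → Integrable fun η => b p η * ec (y ⬝ᵥ η) := by
    intro b hb
    refine Continuous.integrable_of_hasCompactSupport ((hb.contDiff p).continuous.mul hc) ?_
    exact (hb.hasCompactSupport p).mul_right
  rw [← integral_mul_fderiv_eq_neg_fderiv_mul_of_integrable (hint _ (ha.deriv (Pi.single i 1))) ?_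
    (hint a ha) (fun x _ => (ha.contDiff p).differentiable (by simp) x)
    (fun x _ => (hasFDerivAt_ec_dot y x).1)]
  · rw [← integral_const_mul]
    refine integral_congr_ae (ae_of_all _ fun η => ?_)
    simp only [(hasFDerivAt_ec_dot y η).2]
    ring
  · simp only [(hasFDerivAt_ec_dot y _).2]
    refine ((hint a ha).const_mul (2 * Real.pi * Complex.I * y i)).congr (ae_of_all _ fun η => ?_)
    simp only
    ring

lemma IsAmp.pow_mul_norm_integral_le {P : Type*} [NormedAddCommGroup P] [NormedSpace ℝ P]
    (M : ℕ) {a : P → (Fin d → ℝ) → ℂ} (ha : IsAmp a) {K : Set P} (hK : IsCompact K) :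
    ∃ C : ℝ, 0 ≤ C ∧ ∀ p ∈ K, ∀ y : Fin d → ℝ, ‖y‖ ^ M * ‖∫ η, a p η * ec (y ⬝ᵥ η)‖ ≤ C := by
  induction M generalizing a with
  | zero => simpa using ha.norm_integral_le hK
  | succ M ih =>
    choose C hC0 hC using fun i : Fin d => ih (ha.deriv (Pi.single i 1))
    refine ⟨∑ i, C i, Finset.sum_nonneg fun i _ => hC0 i, fun p hp y => ?_⟩
    by_cases hd : y = 0
    · rw [hd]; simp; exact Finset.sum_nonneg fun i _ => hC0 i
    have hne : Nonempty (Fin d) := by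
      by_contra h
      rw [not_nonempty_iff] at h
      exact hd (Subsingleton.elim _ _)
    obtain ⟨i, hi⟩ : ∃ i, ‖y‖ = ‖y i‖ := by
      obtain ⟨i, -, hi⟩ := Finset.exists_mem_eq_sup' (Finset.univ_nonempty (α := Fin d)) (fun i => ‖y i‖)
      refine ⟨i, le_antisymm ?_ (norm_le_pi_norm y i)⟩
      refine (pi_norm_le_iff_of_nonneg (norm_nonneg _)).2 fun j => ?_
      rw [← hi]
      exact Finset.le_sup' (fun i => ‖y i‖) (Finset.mem_univ j)
    have h1 := congrArg norm (ha.integral_deriv p y i)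
    rw [norm_neg, norm_mul, norm_mul] at h1
    have h2 : ‖(2 * Real.pi * Complex.I : ℂ)‖ = 2 * Real.pi := by
      simp [abs_of_pos Real.pi_pos]
    rw [h2, Complex.norm_real, ← hi] at h1
    have h3 : (1 : ℝ) ≤ 2 * Real.pi := by linarith [Real.pi_gt_three]
    calc ‖y‖ ^ (M + 1) * ‖∫ η, a p η * ec (y ⬝ᵥ η)‖
        ≤ ‖y‖ ^ M * (2 * Real.pi * ‖y‖ * ‖∫ η, a p η * ec (y ⬝ᵥ η)‖) := by
          rw [pow_succ, mul_assoc]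
          gcongr
          nlinarith [norm_nonneg y]
      _ ≤ C i := by rw [h1]; exact hC i p hp y
      _ ≤ ∑ i, C i := Finset.single_le_sum (f := C) (fun i _ => hC0 i) (Finset.mem_univ i)

/-- `gradT Φ ξ t` is the gradient of `t · Φ` at `ξ`. -/
def gradT (Φ : (Fin d → ℝ) → Fin k → ℝ) (ξ : Fin d → ℝ) (t : Fin k → ℝ) : Fin d → ℝ :=
  fun i => t ⬝ᵥ fderiv ℝ Φ ξ (Pi.single i 1)

lemma dotProduct_fderiv (Φ : (Fin d → ℝ) → Fin k → ℝ) (ξ η : Fin d → ℝ) (t : Fin k → ℝ) :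
    t ⬝ᵥ fderiv ℝ Φ ξ η = gradT Φ ξ t ⬝ᵥ η := by
  have h : η = ∑ i, η i • (Pi.single i (1 : ℝ) : Fin d → ℝ) := by
    ext j; simp [Finset.sum_apply, Pi.single_apply]
  conv_lhs => rw [h]
  rw [map_sum, dotProduct_sum]
  simp only [map_smul, dotProduct_smul, smul_eq_mul]
  conv_rhs => rw [dotProduct]
  exact Finset.sum_congr rfl fun i _ => mul_comm _ _

/-- The position of the wave packet `T` relative to the point `(x, t)`, at scale `ρ`. -/
def offset (Φ : (Fin d → ℝ) → Fin k → ℝ) (ρ : ℝ) (T : Idx d) (w : (Fin d → ℝ) × (Fin k → ℝ)) :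
    Fin d → ℝ :=
  (1 / ρ) • (w.1 + gradT Φ (freq ρ T.1) w.2) + toR T.2

/-- The amplitude of the rescaled wave packets. -/
def packetAmp (Φ : (Fin d → ℝ) → Fin k → ℝ) (p : ℝ × (Fin d → ℝ) × (Fin k → ℝ))
    (η : Fin d → ℝ) : ℂ :=
  (bumpX d η : ℂ) * ec (p.2.2 ⬝ᵥ taylorRem Φ p.1 p.2.1 η)

lemma isAmp_packetAmp {Φ : (Fin d → ℝ) → Fin k → ℝ} (hΦ : ContDiff ℝ (⊤ : ℕ∞) Φ) :
    IsAmp (packetAmp Φ) := by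
  refine ⟨?_, fun p η hη => by rw [packetAmp, bumpX_eq_zero hη]; simp⟩
  have h1 := contDiff_taylorRem hΦ
  have h2 : ContDiff ℝ (⊤ : ℕ∞) fun q : (ℝ × (Fin d → ℝ) × (Fin k → ℝ)) × (Fin d → ℝ) =>
      taylorRem Φ q.1.1 q.1.2.1 q.2 :=
    h1.comp (g := fun p : ℝ × (Fin d → ℝ) × (Fin d → ℝ) => taylorRem Φ p.1 p.2.1 p.2.2)
      (f := fun q : (ℝ × (Fin d → ℝ) × (Fin k → ℝ)) × (Fin d → ℝ) => (q.1.1, q.1.2.1, q.2)) (by fun_prop)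
  have h3 : ContDiff ℝ (⊤ : ℕ∞) fun q : (ℝ × (Fin d → ℝ) × (Fin k → ℝ)) × (Fin d → ℝ) =>
      q.1.2.2 ⬝ᵥ taylorRem Φ q.1.1 q.1.2.1 q.2 := by
    unfold dotProduct
    refine ContDiff.sum fun i _ => ContDiff.mul (by fun_prop) ?_
    exact contDiff_pi.1 h2 i
  unfold Function.uncurry packetAmp
  refine ContDiff.mul ?_ ?_
  · exact Complex.ofRealCLM.contDiff.comp ((bumpX d).contDiff.comp contDiff_snd)
  · unfold ec
    refine ContDiff.cexp (contDiff_const.mul ?_)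
    exact Complex.ofRealCLM.contDiff.comp h3

lemma norm_extE_packet {Φ : (Fin d → ℝ) → Fin k → ℝ} (hΦ : ContDiff ℝ (⊤ : ℕ∞) Φ) {ρ : ℝ}
    (hρ : 0 < ρ) (T : Idx d) (w : (Fin d → ℝ) × (Fin k → ℝ)) :
    ‖extE Φ (packet ρ T) w‖ = (1 / Real.sqrt (ρ ^ d)) *
      ‖∫ η, packetAmp Φ (1 / ρ, freq ρ T.1, ((1 / ρ) ^ 2) • w.2) η * ec (offset Φ ρ T w ⬝ᵥ η)‖ := by
  set a := freq ρ T.1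
  set A : ℝ := Real.sqrt (ρ ^ d)
  have hA0 : 0 < A := Real.sqrt_pos.2 (by positivity)
  set H : (Fin d → ℝ) → ℂ := fun η => packetAmp Φ (1 / ρ, a, ((1 / ρ) ^ 2) • w.2) η * ec (offset Φ ρ T w ⬝ᵥ η)
  have h1 : extE Φ (packet ρ T) w = ∫ ξ, (A * ec (w.1 ⬝ᵥ a + w.2 ⬝ᵥ Φ a)) * H (ρ • (ξ - a)) := by
    rw [extE]
    refine integral_congr_ae (ae_of_all _ fun ξ => ?_)
    simp only
    set η := ρ • (ξ - a) with hη
    have hξ : ξ = a + (1 / ρ) • η := by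
      rw [hη, smul_smul, one_div_mul_cancel hρ.ne', one_smul, add_sub_cancel]
    have h2 : w.1 ⬝ᵥ ξ + w.2 ⬝ᵥ Φ ξ + toR T.2 ⬝ᵥ η = (w.1 ⬝ᵥ a + w.2 ⬝ᵥ Φ a) +
        ((((1 / ρ) ^ 2) • w.2) ⬝ᵥ taylorRem Φ (1 / ρ) a η + offset Φ ρ T w ⬝ᵥ η) := by
      conv_lhs => rw [hξ, taylorRem_eq hΦ]
      simp only [dotProduct_add, dotProduct_smul, smul_dotProduct, add_dotProduct, offset,
        dotProduct_fderiv, smul_eq_mul]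
      ring
    rw [packet]
    change ec (w.1 ⬝ᵥ ξ + w.2 ⬝ᵥ Φ ξ) * (A * bumpX d η * ec (toR T.2 ⬝ᵥ η)) = _
    calc _ = A * bumpX d η * ec (w.1 ⬝ᵥ ξ + w.2 ⬝ᵥ Φ ξ + toR T.2 ⬝ᵥ η) := by
          rw [ec_add _ (toR T.2 ⬝ᵥ η)]; ring
      _ = _ := by
          rw [h2, ec_add, ec_add _ (offset Φ ρ T w ⬝ᵥ η)]
          simp only [H, packetAmp]; ring
  rw [h1, integral_const_mul, integral_sub_right_eq_self (fun ξ => H (ρ • ξ)) a,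
    Measure.integral_comp_smul, norm_mul, norm_mul, norm_ec, mul_one, norm_smul, Complex.norm_real,
    Real.norm_of_nonneg hA0.le, ← mul_assoc]
  congr 1
  rw [Module.finrank_pi, Fintype.card_fin, Real.norm_of_nonneg (abs_nonneg _), abs_of_pos (by positivity)]
  have h3 : A * A = ρ ^ d := Real.mul_self_sqrt (by positivity)
  rw [← h3]
  field_simp

/-- Rapid decay of the wave packets away from their tubes. -/
lemma norm_extE_packet_le {Φ : (Fin d → ℝ) → Fin k → ℝ} (hΦ : ContDiff ℝ (⊤ : ℕ∞) Φ) (M : ℕ)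
    (B : ℝ) : ∃ C : ℝ, 0 ≤ C ∧ ∀ ρ : ℝ, 1 ≤ ρ → ∀ T : Idx d, ‖freq ρ T.1‖ ≤ B →
      ∀ w : (Fin d → ℝ) × (Fin k → ℝ), ‖w.2‖ ≤ B * ρ ^ 2 →
      ‖extE Φ (packet ρ T) w‖ * Real.sqrt (ρ ^ d) * (1 + ‖offset Φ ρ T w‖) ^ M ≤ C := by
  set K : Set (ℝ × (Fin d → ℝ) × (Fin k → ℝ)) :=
    Metric.closedBall 0 1 ×ˢ (Metric.closedBall 0 B ×ˢ Metric.closedBall 0 B)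
  have hK : IsCompact K :=
    (isCompact_closedBall _ _).prod ((isCompact_closedBall _ _).prod (isCompact_closedBall _ _))
  obtain ⟨C1, hC1, h1⟩ := (isAmp_packetAmp hΦ).pow_mul_norm_integral_le 0 hK
  obtain ⟨C2, hC2, h2⟩ := (isAmp_packetAmp hΦ).pow_mul_norm_integral_le M hK
  refine ⟨2 ^ (M - 1) * (C1 + C2), by positivity, fun ρ hρ T hT w hw => ?_⟩
  have hρ0 : 0 < ρ := by linarith
  have hA0 : 0 < Real.sqrt (ρ ^ d) := Real.sqrt_pos.2 (by positivity)
  have hp : ((1 / ρ, freq ρ T.1, ((1 / ρ) ^ 2) • w.2) : ℝ × (Fin d → ℝ) × (Fin k → ℝ)) ∈ K := by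
    refine ⟨?_, ?_, ?_⟩ <;> simp only [mem_closedBall_iff_norm, sub_zero]
    · rw [Real.norm_of_nonneg (by positivity)]; exact (div_le_one hρ0).2 hρ
    · exact hT
    · rw [norm_smul, Real.norm_of_nonneg (by positivity)]
      calc (1 / ρ) ^ 2 * ‖w.2‖ ≤ (1 / ρ) ^ 2 * (B * ρ ^ 2) := by gcongr
        _ = B := by field_simp
  rw [norm_extE_packet hΦ hρ0]
  set J := ‖∫ η, packetAmp Φ (1 / ρ, freq ρ T.1, ((1 / ρ) ^ 2) • w.2) η * ec (offset Φ ρ T w ⬝ᵥ η)‖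
  have h3 := h1 _ hp (offset Φ ρ T w)
  have h4 := h2 _ hp (offset Φ ρ T w)
  rw [pow_zero, one_mul] at h3
  have h5 : 1 / Real.sqrt (ρ ^ d) * J * Real.sqrt (ρ ^ d) = J := by field_simp
  rw [h5]
  calc J * (1 + ‖offset Φ ρ T w‖) ^ M
      ≤ J * (2 ^ (M - 1) * (1 ^ M + ‖offset Φ ρ T w‖ ^ M)) := by
        gcongr
        exact add_pow_le zero_le_one (norm_nonneg _) M
    _ = 2 ^ (M - 1) * (J + ‖offset Φ ρ T w‖ ^ M * J) := by rw [one_pow]; ring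
    _ ≤ _ := by gcongr

end Analysis

section Analysis
variable {d k : ℕ}

/-- Integer vectors in a closed ball. -/
def intBall {n : ℕ} (b : Fin n → ℤ) (r : ℝ) : Finset (Fin n → ℤ) :=
  Fintype.piFinset fun i => Finset.Icc ⌈b i - r⌉ ⌊b i + r⌋

lemma mem_intBall {n : ℕ} {b v : Fin n → ℤ} {r : ℝ} (hr : 0 ≤ r) :
    v ∈ intBall b r ↔ ‖toR v - toR b‖ ≤ r := by
  rw [intBall, Fintype.mem_piFinset, pi_norm_le_iff_of_nonneg hr]
  refine forall_congr' fun i => ?_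
  rw [Finset.mem_Icc, Int.ceil_le, Int.le_floor, Real.norm_eq_abs, abs_le]
  simp only [toR, Pi.sub_apply]
  constructor <;> rintro ⟨h3, h4⟩ <;> constructor <;> linarith

lemma card_intBall_le {n : ℕ} (b : Fin n → ℤ) {r : ℝ} (hr : 0 ≤ r) :
    ((intBall b r).card : ℝ) ≤ (2 * r + 1) ^ n := by
  rw [intBall, Fintype.card_piFinset]
  push_cast
  refine (Finset.prod_le_prod (g := fun _ => 2 * r + 1) (fun _ _ => by positivity) fun i _ => ?_).trans
    (by simp)
  rw [Int.card_Icc]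
  have h1 := Int.le_ceil (b i - r)
  have h2 := Int.floor_le (b i + r)
  have h3 : (((⌊(b i : ℝ) + r⌋ + 1 - ⌈(b i : ℝ) - r⌉).toNat : ℤ) : ℝ) ≤ 2 * r + 1 := by
    rw [Int.toNat_eq_max, Int.cast_max]
    refine max_le ?_ (by push_cast; positivity)
    push_cast
    linarith
  exact_mod_cast h3

lemma summable_int_inv_sq : Summable fun n : ℤ => 1 / (1 + |(n : ℝ)|) ^ 2 := by
  have h0 : Summable fun n : ℕ => 1 / ((n : ℝ) + 1) ^ 2 := by
    have := (summable_nat_add_iff 1).2 (Real.summable_one_div_nat_pow.2 one_lt_two)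
    simpa using this
  refine Summable.of_nat_of_neg ?_ ?_ <;>
  · refine h0.congr fun n => ?_
    simp [add_comm]

/-- The sum of `1 / (1 + |n|) ^ 2` over the integers. -/
def latC : ℝ := ∑' n : ℤ, 1 / (1 + |(n : ℝ)|) ^ 2

lemma latC_nonneg : 0 ≤ latC := tsum_nonneg fun _ => by positivity

lemma sum_int_inv_sq_le (F : Finset ℤ) (b : ℝ) : ∑ n ∈ F, 1 / (1 + |(n : ℝ) + b|) ^ 2 ≤ 4 * latC := by
  have h1 : ∀ n : ℤ, 1 / (1 + |(n : ℝ) + b|) ^ 2 ≤ 4 * (1 / (1 + |((n + round b : ℤ) : ℝ)|) ^ 2) := by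
    intro n
    have h2 := abs_sub_round b
    have h3 : |((n + round b : ℤ) : ℝ)| ≤ |(n : ℝ) + b| + 1 / 2 := by
      have h4 : ((n + round b : ℤ) : ℝ) = ((n : ℝ) + b) - (b - round b) := by push_cast; ring
      rw [h4]
      exact (abs_sub _ _).trans (by linarith)
    rw [mul_one_div, div_le_div_iff₀ (by positivity) (by positivity)]
    have h5 := abs_nonneg ((n + round b : ℤ) : ℝ)
    have h6 := abs_nonneg ((n : ℝ) + b)
    nlinarith
  calc _ ≤ ∑ n ∈ F, 4 * (1 / (1 + |((n + round b : ℤ) : ℝ)|) ^ 2) := Finset.sum_le_sum fun n _ => h1 n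
    _ = 4 * ∑ n ∈ F, (fun m : ℤ => 1 / (1 + |(m : ℝ)|) ^ 2) (Equiv.addRight (round b) n) := by
        rw [← Finset.mul_sum]; rfl
    _ ≤ 4 * ∑' n : ℤ, (fun m : ℤ => 1 / (1 + |(m : ℝ)|) ^ 2) (Equiv.addRight (round b) n) := by
        gcongr
        exact ((Equiv.addRight (round b)).summable_iff.2 summable_int_inv_sq).sum_le_tsum _
          fun _ _ => by positivity
    _ = 4 * latC := by
        rw [(Equiv.addRight (round b)).tsum_eq (fun m : ℤ => 1 / (1 + |(m : ℝ)|) ^ 2)]; rfl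

lemma sum_lattice_le (V : Finset (Fin d → ℤ)) (b : Fin d → ℝ) :
    ∑ v ∈ V, 1 / (1 + ‖toR v + b‖) ^ (2 * d) ≤ (4 * latC) ^ d := by
  classical
  have h1 : ∀ v : Fin d → ℤ, 1 / (1 + ‖toR v + b‖) ^ (2 * d) ≤ ∏ i, 1 / (1 + |(v i : ℝ) + b i|) ^ 2 := by
    intro v
    have h2 : ∏ i : Fin d, 1 / (1 + ‖toR v + b‖) ^ 2 = 1 / (1 + ‖toR v + b‖) ^ (2 * d) := by
      rw [Finset.prod_const, Finset.card_univ, Fintype.card_fin, div_pow, one_pow, ← pow_mul]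
    rw [← h2]
    refine Finset.prod_le_prod (fun _ _ => by positivity) fun i _ => ?_
    gcongr
    exact norm_le_pi_norm (toR v + b) i
  calc _ ≤ ∑ v ∈ V, ∏ i, 1 / (1 + |(v i : ℝ) + b i|) ^ 2 := Finset.sum_le_sum fun v _ => h1 v
    _ ≤ ∑ v ∈ Fintype.piFinset fun i => V.image fun v : Fin d → ℤ => v i,
          ∏ i, 1 / (1 + |(v i : ℝ) + b i|) ^ 2 := by
        refine Finset.sum_le_sum_of_subset_of_nonneg (fun v hv => ?_) fun _ _ _ => by positivity
        exact Fintype.mem_piFinset.2 fun i => Finset.mem_image_of_mem _ hv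
    _ = ∏ i, ∑ n ∈ V.image fun v : Fin d → ℤ => v i, 1 / (1 + |(n : ℝ) + b i|) ^ 2 :=
        (Finset.prod_univ_sum (fun i => V.image fun v : Fin d → ℤ => v i) fun i n => 1 / (1 + |(n : ℝ) + b i|) ^ 2).symm
    _ ≤ ∏ _i : Fin d, 4 * latC := by
        refine Finset.prod_le_prod (fun _ _ => Finset.sum_nonneg fun _ _ => by positivity) fun i _ => ?_
        exact sum_int_inv_sq_le _ _
    _ = _ := by simp

/-- The extension of a superposition of wave packets. -/
def wp (Φ : (Fin d → ℝ) → Fin k → ℝ) (ρ : ℝ) (𝕋 : Finset (Idx d)) (c : Idx d → ℂ)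
    (w : (Fin d → ℝ) × (Fin k → ℝ)) : ℂ :=
  ∑ T ∈ 𝕋, c T * extE Φ (packet ρ T) w

/-- The point with index `z` in the grid of spacing `ρ`. -/
def gridPt (ρ : ℝ) (z : (Fin d → ℤ) × (Fin k → ℤ)) : (Fin d → ℝ) × (Fin k → ℝ) :=
  ρ • (toR z.1, toR z.2)

/-- Incidence between a tube and a ball of radius `ρ`, up to the factor `κ`. -/
def inc (Φ : (Fin d → ℝ) → Fin k → ℝ) (ρ κ : ℝ) (T : Idx d) (z : (Fin d → ℤ) × (Fin k → ℤ)) : Prop :=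
  ‖offset Φ ρ T (gridPt ρ z)‖ ≤ κ

lemma offset_gridPt {Φ : (Fin d → ℝ) → Fin k → ℝ} {ρ : ℝ} (hρ : 0 < ρ) (T : Idx d)
    (z : (Fin d → ℤ) × (Fin k → ℤ)) :
    offset Φ ρ T (gridPt ρ z) = toR z.1 + gradT Φ (freq ρ T.1) (toR z.2) + toR T.2 := by
  ext i
  simp only [offset, gridPt, gradT, Pi.add_apply, Pi.smul_apply, Prod.smul_fst,
    Prod.smul_snd, smul_dotProduct, smul_eq_mul]
  field_simp

lemma gradT_add (Φ : (Fin d → ℝ) → Fin k → ℝ) (ξ : Fin d → ℝ) (t t' : Fin k → ℝ) :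
    gradT Φ ξ (t + t') = gradT Φ ξ t + gradT Φ ξ t' := by
  ext i; simp [gradT, add_dotProduct]

lemma gradT_sub (Φ : (Fin d → ℝ) → Fin k → ℝ) (ξ : Fin d → ℝ) (t t' : Fin k → ℝ) :
    gradT Φ ξ (t - t') = gradT Φ ξ t - gradT Φ ξ t' := by
  ext i; simp [gradT, sub_dotProduct]

lemma abs_dotProduct_le (t s : Fin k → ℝ) : |t ⬝ᵥ s| ≤ k * (‖t‖ * ‖s‖) := by
  calc |t ⬝ᵥ s| ≤ ∑ i, |t i * s i| := Finset.abs_sum_le_sum_abs _ _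
    _ ≤ ∑ _i : Fin k, ‖t‖ * ‖s‖ := by
        refine Finset.sum_le_sum fun i _ => ?_
        rw [abs_mul]
        exact mul_le_mul (norm_le_pi_norm t i) (norm_le_pi_norm s i) (abs_nonneg _) (norm_nonneg _)
    _ = _ := by simp

/-- Local bounds for `Φ` and its derivative. -/
lemma exists_gradT_bounds {Φ : (Fin d → ℝ) → Fin k → ℝ} (hΦ : ContDiff ℝ (⊤ : ℕ∞) Φ) (B : ℝ) :
    ∃ C : ℝ, 1 ≤ C ∧ (∀ ξ, ‖ξ‖ ≤ B → ∀ t, ‖gradT Φ ξ t‖ ≤ C * ‖t‖) ∧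
      (∀ ξ ξ', ‖ξ‖ ≤ B → ‖ξ'‖ ≤ B → ∀ t, ‖gradT Φ ξ t - gradT Φ ξ' t‖ ≤ C * (‖ξ - ξ'‖ * ‖t‖)) ∧
      ∀ ξ ξ', ‖ξ‖ ≤ B → ‖ξ'‖ ≤ B → ‖Φ ξ - Φ ξ'‖ ≤ C * ‖ξ - ξ'‖ := by
  have hd1 : ContDiff ℝ (⊤ : ℕ∞) (fderiv ℝ Φ) := hΦ.fderiv_right (by simp)
  have hd2 : ContDiff ℝ (⊤ : ℕ∞) (fderiv ℝ (fderiv ℝ Φ)) := hd1.fderiv_right (by simp)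
  have hK := isCompact_closedBall (0 : Fin d → ℝ) B
  obtain ⟨C1, h1⟩ := hK.exists_bound_of_continuousOn hd1.continuous.continuousOn
  obtain ⟨C2, h2⟩ := hK.exists_bound_of_continuousOn
    (E := (Fin d → ℝ) →L[ℝ] ((Fin d → ℝ) →L[ℝ] (Fin k → ℝ))) hd2.continuous.continuousOn
  have hmem : ∀ ξ : Fin d → ℝ, ‖ξ‖ ≤ B → ξ ∈ Metric.closedBall (0 : Fin d → ℝ) B := fun ξ h => by
    rwa [mem_closedBall_iff_norm, sub_zero]
  have hL1 : ∀ ξ ξ', ‖ξ‖ ≤ B → ‖ξ'‖ ≤ B → ‖Φ ξ - Φ ξ'‖ ≤ C1 * ‖ξ - ξ'‖ := fun ξ ξ' h h' =>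
    (convex_closedBall _ _).norm_image_sub_le_of_norm_fderiv_le
      (fun x _ => hΦ.differentiable (by simp) x) h1 (hmem _ h') (hmem _ h)
  have hL2 : ∀ ξ ξ', ‖ξ‖ ≤ B → ‖ξ'‖ ≤ B → ‖fderiv ℝ Φ ξ - fderiv ℝ Φ ξ'‖ ≤ C2 * ‖ξ - ξ'‖ :=
    fun ξ ξ' h h' => (convex_closedBall _ _).norm_image_sub_le_of_norm_fderiv_le
      (fun x _ => hd1.differentiable (by simp) x) h2 (hmem _ h') (hmem _ h)
  have hsingle : ∀ i : Fin d, ‖(Pi.single i 1 : Fin d → ℝ)‖ ≤ 1 := fun i =>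
    (pi_norm_le_iff_of_nonneg zero_le_one).2 fun j => by
      by_cases h : j = i
      · subst h; simp
      · simp [h]
  have hg : ∀ (A : (Fin d → ℝ) →L[ℝ] (Fin k → ℝ)) (t : Fin k → ℝ) (b : ℝ), ‖A‖ ≤ b →
      ‖(fun i => t ⬝ᵥ A (Pi.single i 1) : Fin d → ℝ)‖ ≤ k * (‖t‖ * b) := by
    intro A t b hb
    have hb0 := (norm_nonneg A).trans hb
    refine (pi_norm_le_iff_of_nonneg (by positivity)).2 fun i => ?_
    refine (abs_dotProduct_le _ _).trans ?_
    gcongr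
    exact (A.le_opNorm_of_le (hsingle i)).trans (by rwa [mul_one])
  refine ⟨1 + |C1| + k * |C1| + k * |C2|, ?_, fun ξ h t => ?_, fun ξ ξ' h h' t => ?_, fun ξ ξ' h h' => ?_⟩
  · have : 0 ≤ |C1| + k * |C1| + k * |C2| := by positivity
    linarith
  · refine (hg (fderiv ℝ Φ ξ) t _ ((h1 ξ (hmem _ h)).trans (le_abs_self _))).trans ?_
    have : 0 ≤ (1 + |C1| + k * |C2|) * ‖t‖ := by positivity
    linarith
  · have h3 : gradT Φ ξ t - gradT Φ ξ' t = fun i => t ⬝ᵥ (fderiv ℝ Φ ξ - fderiv ℝ Φ ξ') (Pi.single i 1) := by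
      ext i; simp [gradT, dotProduct_sub]
    rw [h3]
    refine (hg _ t (|C2| * ‖ξ - ξ'‖) ((hL2 ξ ξ' h h').trans
      (mul_le_mul_of_nonneg_right (le_abs_self _) (norm_nonneg _)))).trans ?_
    have : 0 ≤ (1 + |C1| + k * |C1|) * (‖ξ - ξ'‖ * ‖t‖) := by positivity
    linarith
  · refine (hL1 ξ ξ' h h').trans ?_
    gcongr
    have := le_abs_self C1
    have : 0 ≤ 1 + k * |C1| + k * |C2| := by positivity
    linarith

open Classical in
/-- The wave packets that are not incident to a ball contribute negligibly there. -/
lemma norm_wp_tail_le {Φ : (Fin d → ℝ) → Fin k → ℝ} (hΦ : ContDiff ℝ (⊤ : ℕ∞) Φ) (M : ℕ) (B : ℝ) :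
    ∃ C : ℝ, 0 ≤ C ∧ ∀ ρ κ : ℝ, 1 ≤ ρ → 1 ≤ κ → ∀ (𝕋 : Finset (Idx d)) (c : Idx d → ℂ),
      (∀ T ∈ 𝕋, ‖freq ρ T.1‖ ≤ B) → ∀ z : (Fin d → ℤ) × (Fin k → ℤ), ‖toR z.2‖ ≤ B * ρ →
      ∀ w ∈ Metric.closedBall (gridPt ρ z) ρ,
      ‖wp Φ ρ (𝕋.filter fun T => ¬ inc Φ ρ κ T z) c w‖ ≤ C * (1 / κ) ^ M * Real.sqrt (∑ T ∈ 𝕋, ‖c T‖ ^ 2) := by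
  obtain ⟨G, hG1, hG, -, -⟩ := exists_gradT_bounds hΦ B
  obtain ⟨D, hD0, hD⟩ := norm_extE_packet_le hΦ (M + d) (|B| + 1)
  set D' := D * (2 + G) ^ (M + d)
  have hG0 : 0 ≤ G := by linarith
  refine ⟨Real.sqrt (D' ^ 2 * ((4 * |B| + 1) ^ d * (4 * latC) ^ d)), by positivity,
    fun ρ κ hρ hκ 𝕋 c h𝕋 z hz w hw => ?_⟩
  have hρ0 : 0 < ρ := by linarith
  have hκ0 : 0 < κ := by linarith
  have hlat := latC_nonneg
  set 𝕋' := 𝕋.filter fun T => ¬ inc Φ ρ κ T z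
  have hwz : ‖w - gridPt ρ z‖ ≤ ρ := by rwa [mem_closedBall_iff_norm] at hw
  have hw2 : ‖w.2‖ ≤ (|B| + 1) * ρ ^ 2 := by
    have h1 : ‖w.2 - (gridPt ρ z).2‖ ≤ ρ := (norm_snd_le (w - gridPt ρ z)).trans hwz
    have h2 : ‖(gridPt ρ z).2‖ ≤ ρ * (B * ρ) := by
      rw [gridPt, Prod.smul_snd, norm_smul, Real.norm_of_nonneg hρ0.le]
      gcongr
    calc ‖w.2‖ = ‖(w.2 - (gridPt ρ z).2) + (gridPt ρ z).2‖ := by rw [sub_add_cancel]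
      _ ≤ ρ + ρ * (B * ρ) := (norm_add_le _ _).trans (add_le_add h1 h2)
      _ ≤ (|B| + 1) * ρ ^ 2 := by nlinarith [le_abs_self B, mul_le_mul_of_nonneg_right (le_abs_self B) (sq_nonneg ρ)]
  have hoff : ∀ T ∈ 𝕋, 1 + ‖offset Φ ρ T (gridPt ρ z)‖ ≤ (2 + G) * (1 + ‖offset Φ ρ T w‖) := by
    intro T hT
    have h1 : offset Φ ρ T (gridPt ρ z) = offset Φ ρ T w -
        (1 / ρ) • ((w - gridPt ρ z).1 + gradT Φ (freq ρ T.1) (w - gridPt ρ z).2) := by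
      simp only [offset, Prod.fst_sub, Prod.snd_sub, gradT_sub]
      module
    have h2 : ‖(1 / ρ) • ((w - gridPt ρ z).1 + gradT Φ (freq ρ T.1) (w - gridPt ρ z).2)‖ ≤ 1 + G := by
      rw [norm_smul, Real.norm_of_nonneg (by positivity), one_div_mul_eq_div, div_le_iff₀ hρ0]
      refine (norm_add_le _ _).trans ?_
      have h3 := hG _ (h𝕋 T hT) (w - gridPt ρ z).2
      have h4 := (norm_snd_le (w - gridPt ρ z)).trans hwz
      have h5 := (norm_fst_le (w - gridPt ρ z)).trans hwz
      nlinarith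
    have h3 : ‖offset Φ ρ T (gridPt ρ z)‖ ≤ ‖offset Φ ρ T w‖ + (1 + G) := by
      rw [h1]; exact (norm_sub_le _ _).trans (by gcongr)
    nlinarith [norm_nonneg (offset Φ ρ T w)]
  have hpk : ∀ T ∈ 𝕋', ‖extE Φ (packet ρ T) w‖ ^ 2 ≤ D' ^ 2 * (1 / ρ) ^ d * (1 / κ) ^ (2 * M) *
      (1 / (1 + ‖toR T.2 + (toR z.1 + gradT Φ (freq ρ T.1) (toR z.2))‖) ^ (2 * d)) := by
    intro T hT
    obtain ⟨hT, hTi⟩ := Finset.mem_filter.1 hT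
    rw [inc, not_le] at hTi
    set o := ‖offset Φ ρ T (gridPt ρ z)‖ with ho
    have ho' : ‖toR T.2 + (toR z.1 + gradT Φ (freq ρ T.1) (toR z.2))‖ = o := by
      rw [ho, offset_gridPt hρ0, add_comm]
    rw [ho']
    have hA0 : 0 < Real.sqrt (ρ ^ d) := Real.sqrt_pos.2 (by positivity)
    have h1 := hD ρ hρ T ((h𝕋 T hT).trans ((le_abs_self B).trans (by linarith))) w hw2
    set x := ‖extE Φ (packet ρ T) w‖
    have h2 : x * Real.sqrt (ρ ^ d) * (1 + o) ^ (M + d) ≤ D' := by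
      calc x * Real.sqrt (ρ ^ d) * (1 + o) ^ (M + d)
          ≤ x * Real.sqrt (ρ ^ d) * ((2 + G) * (1 + ‖offset Φ ρ T w‖)) ^ (M + d) := by
            have := hoff T hT
            gcongr
        _ = (x * Real.sqrt (ρ ^ d) * (1 + ‖offset Φ ρ T w‖) ^ (M + d)) * (2 + G) ^ (M + d) := by
            rw [mul_pow]; ring
        _ ≤ D' := mul_le_mul_of_nonneg_right h1 (by positivity)
    have h3 : x * Real.sqrt (ρ ^ d) * (κ ^ M * (1 + o) ^ d) ≤ D' := by
      refine le_trans ?_ h2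
      rw [pow_add]
      gcongr
      linarith
    have h4 : (x * Real.sqrt (ρ ^ d) * (κ ^ M * (1 + o) ^ d)) ^ 2 ≤ D' ^ 2 := by
      gcongr
    have h5 : Real.sqrt (ρ ^ d) ^ 2 = ρ ^ d := Real.sq_sqrt (by positivity)
    have h6 : (x * Real.sqrt (ρ ^ d) * (κ ^ M * (1 + o) ^ d)) ^ 2 =
        x ^ 2 * (ρ ^ d * κ ^ (2 * M) * (1 + o) ^ (2 * d)) := by
      rw [mul_pow, mul_pow, h5]; ring
    rw [h6] at h4
    have h7 : D' ^ 2 * (1 / ρ) ^ d * (1 / κ) ^ (2 * M) * (1 / (1 + o) ^ (2 * d)) =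
        D' ^ 2 / (ρ ^ d * κ ^ (2 * M) * (1 + o) ^ (2 * d)) := by
      rw [_root_.one_div_pow, _root_.one_div_pow]; field_simp
    rw [h7, le_div_iff₀ (by positivity)]
    exact h4
  by_cases hB : B < 0
  · have : 𝕋' = ∅ := by
      refine Finset.eq_empty_of_forall_notMem fun T hT => ?_
      have := (norm_nonneg _).trans (h𝕋 T (Finset.mem_filter.1 hT).1)
      linarith
    rw [wp, this]
    simp
    positivity
  rw [not_lt] at hB
  have hsum : ∑ T ∈ 𝕋', ‖extE Φ (packet ρ T) w‖ ^ 2 ≤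
      D' ^ 2 * ((4 * |B| + 1) ^ d * (4 * latC) ^ d) * (1 / κ) ^ (2 * M) := by
    set Q := freqSet ρ (0 : Fin d → ℝ) B
    set V := 𝕋.image Prod.snd
    calc _ ≤ ∑ T ∈ 𝕋', D' ^ 2 * (1 / ρ) ^ d * (1 / κ) ^ (2 * M) *
          (1 / (1 + ‖toR T.2 + (toR z.1 + gradT Φ (freq ρ T.1) (toR z.2))‖) ^ (2 * d)) :=
          Finset.sum_le_sum hpk
      _ ≤ ∑ T ∈ Q ×ˢ V, D' ^ 2 * (1 / ρ) ^ d * (1 / κ) ^ (2 * M) *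
          (1 / (1 + ‖toR T.2 + (toR z.1 + gradT Φ (freq ρ T.1) (toR z.2))‖) ^ (2 * d)) := by
          refine Finset.sum_le_sum_of_subset_of_nonneg (fun T hT => ?_) fun _ _ _ => by positivity
          have hT := (Finset.mem_filter.1 hT).1
          refine Finset.mem_product.2 ⟨?_, Finset.mem_image_of_mem _ hT⟩
          rw [mem_freqSet hρ0 hB, sub_zero]
          exact h𝕋 T hT
      _ = D' ^ 2 * (1 / ρ) ^ d * (1 / κ) ^ (2 * M) * ∑ q ∈ Q, ∑ v ∈ V,
          (1 / (1 + ‖toR v + (toR z.1 + gradT Φ (freq ρ q) (toR z.2))‖) ^ (2 * d)) := by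
          rw [← Finset.mul_sum, Finset.sum_product]
      _ ≤ D' ^ 2 * (1 / ρ) ^ d * (1 / κ) ^ (2 * M) * ∑ q ∈ Q, (4 * latC) ^ d := by
          gcongr with q
          exact sum_lattice_le V _
      _ = D' ^ 2 * (1 / ρ) ^ d * (1 / κ) ^ (2 * M) * (Q.card * (4 * latC) ^ d) := by
          rw [Finset.sum_const, nsmul_eq_mul]
      _ ≤ D' ^ 2 * (1 / ρ) ^ d * (1 / κ) ^ (2 * M) * (((4 * B + 1) ^ d * ρ ^ d) * (4 * latC) ^ d) := by
          gcongr
          exact card_freqSet_le hρ 0 hB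
      _ = _ := by
          rw [abs_of_nonneg hB, _root_.one_div_pow ρ]; field_simp
  have hCS : ‖wp Φ ρ 𝕋' c w‖ ≤ Real.sqrt (∑ T ∈ 𝕋', ‖c T‖ ^ 2) *
      Real.sqrt (∑ T ∈ 𝕋', ‖extE Φ (packet ρ T) w‖ ^ 2) := by
    refine (norm_sum_le _ _).trans ?_
    simp only [norm_mul]
    exact Real.sum_mul_le_sqrt_mul_sqrt _ _ _
  refine hCS.trans ?_
  rw [mul_comm]
  have h8 : Real.sqrt (∑ T ∈ 𝕋', ‖extE Φ (packet ρ T) w‖ ^ 2) ≤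
      Real.sqrt (D' ^ 2 * ((4 * |B| + 1) ^ d * (4 * latC) ^ d)) * (1 / κ) ^ M := by
    refine (Real.sqrt_le_sqrt hsum).trans (le_of_eq ?_)
    rw [Real.sqrt_mul (by positivity), mul_comm 2 M, pow_mul, Real.sqrt_sq (by positivity)]
  gcongr
  exact Finset.filter_subset _ _

end Analysis

section Analysis
variable {d k : ℕ}

lemma integrable_ec_mul {Φ : (Fin d → ℝ) → Fin k → ℝ} (hΦ : Measurable Φ) {f : (Fin d → ℝ) → ℂ}
    (hf : Integrable f) (w : (Fin d → ℝ) × (Fin k → ℝ)) :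
    Integrable fun ξ => ec (w.1 ⬝ᵥ ξ + w.2 ⬝ᵥ Φ ξ) * f ξ := by
  refine hf.bdd_mul (c := 1) ?_ (ae_of_all _ fun ξ => (norm_ec _).le)
  refine (measurable_ec.comp ?_).aestronglyMeasurable
  unfold dotProduct
  fun_prop

lemma wp_eq_extE {Φ : (Fin d → ℝ) → Fin k → ℝ} (hΦ : Measurable Φ) {ρ : ℝ} (hρ : 0 < ρ)
    (𝕋 : Finset (Idx d)) (c : Idx d → ℂ) : wp Φ ρ 𝕋 c = extE Φ (synth ρ 𝕋 c) := by
  funext w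
  rw [wp, extE]
  simp only [synth, Finset.mul_sum]
  rw [integral_finsetSum]
  · refine Finset.sum_congr rfl fun T _ => ?_
    rw [extE, ← integral_const_mul]
    refine integral_congr_ae (ae_of_all _ fun ξ => ?_)
    simp only
    ring
  · intro T _
    exact integrable_ec_mul hΦ ((integrable_packet hρ T).const_mul _) w

lemma continuous_extE {Φ : (Fin d → ℝ) → Fin k → ℝ} (hΦ : Measurable Φ) {f : (Fin d → ℝ) → ℂ}
    (hf : Integrable f) : Continuous (extE Φ f) := by
  refine continuous_of_dominated (bound := fun ξ => ‖f ξ‖)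
    (fun w => (integrable_ec_mul hΦ hf w).aestronglyMeasurable)
    (fun w => ae_of_all _ fun ξ => ?_) hf.norm (ae_of_all _ fun ξ => ?_)
  · rw [norm_mul, norm_ec, one_mul]
  · refine (continuous_ec.comp ?_).mul continuous_const
    unfold dotProduct
    fun_prop

lemma continuous_wp {Φ : (Fin d → ℝ) → Fin k → ℝ} (hΦ : Measurable Φ) {ρ : ℝ} (hρ : 0 < ρ)
    (𝕋 : Finset (Idx d)) (c : Idx d → ℂ) : Continuous (wp Φ ρ 𝕋 c) :=
  wp_eq_extE hΦ hρ 𝕋 c ▸ continuous_extE hΦ (integrable_synth hρ 𝕋 c)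

/-- The constant in the energy estimate for wave packets. -/
def enC (d k : ℕ) : ℝ := 2 ^ (d + 1) * majC d k * 3 ^ d

lemma enC_nonneg (d k : ℕ) : 0 ≤ enC d k := by
  have := majC_nonneg d k
  unfold enC; positivity

lemma lintegral_wp_sq_le {Φ : (Fin d → ℝ) → Fin k → ℝ} (hΦ : Measurable Φ) {ρ : ℝ} (hρ : 0 < ρ)
    (𝕋 : Finset (Idx d)) (c : Idx d → ℂ) {R : ℝ} (hR : 0 < R) (w₀ : (Fin d → ℝ) × (Fin k → ℝ)) :
    ∫⁻ w in Metric.closedBall w₀ R, ‖wp Φ ρ 𝕋 c w‖ₑ ^ 2 ≤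
      ENNReal.ofReal (enC d k * R ^ k * ∑ T ∈ 𝕋, ‖c T‖ ^ 2) := by
  have h0 := majC_nonneg d k
  rw [wp_eq_extE hΦ hρ]
  refine (lintegral_extE_sq_le hΦ (integrable_synth hρ 𝕋 c) hR w₀).trans ?_
  refine (mul_le_mul_right (lintegral_synth_sq_le hρ 𝕋 c) _).trans (le_of_eq ?_)
  rw [← ENNReal.ofReal_mul (by positivity), enC]
  congr 1
  ring

/-- Almost resonant quadruples of wave packets. -/
def quad (Φ : (Fin d → ℝ) → Fin k → ℝ) (ρ A : ℝ) (x y : Idx d × Idx d) : Prop :=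
  ‖(freq ρ x.1.1 + freq ρ x.2.1) - (freq ρ y.1.1 + freq ρ y.2.1)‖ ≤ A / ρ ∧
  ‖(Φ (freq ρ x.1.1) + Φ (freq ρ x.2.1)) - (Φ (freq ρ y.1.1) + Φ (freq ρ y.2.1))‖ ≤ A / ρ

lemma quad_symm {Φ : (Fin d → ℝ) → Fin k → ℝ} {ρ A : ℝ} {x y : Idx d × Idx d} (h : quad Φ ρ A x y) :
    quad Φ ρ A y x := by
  rw [quad, norm_sub_rev, norm_sub_rev (Φ _ + _)]
  exact h

lemma lintegral_four_packets_le {ρ : ℝ} (hρ : 0 < ρ) (x y : Idx d × Idx d) :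
    ∫⁻ p : ((Fin d → ℝ) × (Fin d → ℝ)) × ((Fin d → ℝ) × (Fin d → ℝ)),
      (‖packet ρ x.1 p.1.1‖ₑ * ‖packet ρ x.2 p.1.2‖ₑ) * (‖packet ρ y.1 p.2.1‖ₑ * ‖packet ρ y.2 p.2.2‖ₑ) ≤
      ENNReal.ofReal (1 / (ρ ^ d) ^ 2) := by
  have hm : ∀ T : Idx d, Measurable fun ξ => ‖packet ρ T ξ‖ₑ := fun T => (continuous_packet ρ T).enorm.measurable
  have h2 : ∀ x : Idx d × Idx d, Measurable fun p : (Fin d → ℝ) × (Fin d → ℝ) =>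
      ‖packet ρ x.1 p.1‖ₑ * ‖packet ρ x.2 p.2‖ₑ := fun x =>
    ((hm x.1).comp measurable_fst).mul ((hm x.2).comp measurable_snd)
  have h3 : ∀ x : Idx d × Idx d, ∫⁻ p : (Fin d → ℝ) × (Fin d → ℝ),
      ‖packet ρ x.1 p.1‖ₑ * ‖packet ρ x.2 p.2‖ₑ ≤ ENNReal.ofReal (1 / ρ ^ d) := by
    intro x
    rw [Measure.volume_eq_prod, lintegral_prod_mul (hm x.1).aemeasurable (hm x.2).aemeasurable]
    refine (mul_le_mul' (lintegral_packet_le hρ _) (lintegral_packet_le hρ _)).trans (le_of_eq ?_)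
    rw [← ENNReal.ofReal_mul (by positivity), div_mul_div_comm, one_mul,
      Real.mul_self_sqrt (by positivity)]
  rw [Measure.volume_eq_prod, lintegral_prod_mul (h2 x).aemeasurable (h2 y).aemeasurable]
  refine (mul_le_mul' (h3 x) (h3 y)).trans (le_of_eq ?_)
  rw [← ENNReal.ofReal_mul (by positivity), div_mul_div_comm, one_mul, sq]

open Classical in
/-- Bilinear `L²` bound on a ball of radius `ρ` by the number of almost resonant quadruples. -/
lemma lintegral_wp_mul_sq_le {Φ : (Fin d → ℝ) → Fin k → ℝ} (hΦ : ContDiff ℝ (⊤ : ℕ∞) Φ) (B : ℝ) :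
    ∃ A C : ℝ, 0 ≤ A ∧ 0 ≤ C ∧ ∀ ρ : ℝ, 1 ≤ ρ → ∀ (𝕋₁ 𝕋₂ : Finset (Idx d)) (c₁ c₂ : Idx d → ℂ),
      (∀ T ∈ 𝕋₁, ‖freq ρ T.1‖ ≤ B) → (∀ T ∈ 𝕋₂, ‖freq ρ T.1‖ ≤ B) →
      ∀ w₀ : (Fin d → ℝ) × (Fin k → ℝ),
      ∫⁻ w in Metric.closedBall w₀ ρ, ‖wp Φ ρ 𝕋₁ c₁ w * wp Φ ρ 𝕋₂ c₂ w‖ₑ ^ 2 ≤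
        ENNReal.ofReal (C * (ρ ^ k / ρ ^ d) * ∑ x ∈ 𝕋₁ ×ˢ 𝕋₂, ∑ y ∈ 𝕋₁ ×ˢ 𝕋₂,
          if quad Φ ρ A x y then ‖c₁ x.1‖ * ‖c₂ x.2‖ * (‖c₁ y.1‖ * ‖c₂ y.2‖) else 0) := by
  obtain ⟨G, hG1, -, -, hG⟩ := exists_gradT_bounds hΦ (B + 1)
  have hmaj := majC_nonneg d k
  refine ⟨3 + 2 * G, majC d k, by positivity, hmaj, fun ρ hρ 𝕋₁ 𝕋₂ c₁ c₂ h1 h2 w₀ => ?_⟩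
  have hρ0 : 0 < ρ := by linarith
  have hΦm : Measurable Φ := hΦ.continuous.measurable
  have hsupp : ∀ (T : Idx d) (ξ : Fin d → ℝ), ‖freq ρ T.1‖ ≤ B → packet ρ T ξ ≠ 0 →
      ‖freq ρ T.1 - ξ‖ ≤ 1 / (2 * ρ) ∧ ‖Φ (freq ρ T.1) - Φ ξ‖ ≤ G / (2 * ρ) := by
    intro T ξ hT hne
    have h3 : ‖freq ρ T.1 - ξ‖ ≤ 1 / (2 * ρ) := by
      by_contra h
      refine hne (packet_eq_zero hρ0 ?_)
      rw [norm_sub_rev]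
      exact (not_le.1 h).le
    refine ⟨h3, (hG _ _ (by linarith) ?_).trans ?_⟩
    · have h4 : 1 / (2 * ρ) ≤ 1 := by rw [div_le_one (by positivity)]; linarith
      calc ‖ξ‖ = ‖freq ρ T.1 - (freq ρ T.1 - ξ)‖ := by congr 1; abel
        _ ≤ B + 1 := (norm_sub_le _ _).trans (by linarith)
    · calc G * ‖freq ρ T.1 - ξ‖ ≤ G * (1 / (2 * ρ)) := by gcongr
        _ = _ := by ring
  have hfour : ∀ {n : ℕ} (a b c e a' b' c' e' : Fin n → ℝ), ‖a + b - (c + e)‖ ≤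
      ‖a' + b' - (c' + e')‖ + (‖a - a'‖ + ‖b - b'‖ + (‖c - c'‖ + ‖e - e'‖)) := by
    intro n a b c e a' b' c' e'
    calc ‖a + b - (c + e)‖ = ‖(a' + b' - (c' + e')) + (((a - a') + (b - b')) - ((c - c') + (e - e')))‖ := by
          congr 1; abel
      _ ≤ _ := (norm_add_le _ _).trans (add_le_add le_rfl ((norm_sub_le _ _).trans
          (add_le_add (norm_add_le _ _) (norm_add_le _ _))))
  rw [wp_eq_extE hΦm hρ0, wp_eq_extE hΦm hρ0]
  refine (lintegral_extE_mul_sq_le hΦm (integrable_synth hρ0 𝕋₁ c₁) (integrable_synth hρ0 𝕋₂ c₂)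
    hρ0 w₀).trans ?_
  set χ : ((Fin d → ℝ) × (Fin d → ℝ)) × ((Fin d → ℝ) × (Fin d → ℝ)) → ℝ≥0∞ := fun p =>
    if ‖(p.1.1 + p.1.2) - (p.2.1 + p.2.2)‖ ≤ 1 / ρ ∧
      ‖(Φ p.1.1 + Φ p.1.2) - (Φ p.2.1 + Φ p.2.2)‖ ≤ 1 / ρ then 1 else 0
  set Pk : Idx d × Idx d → Idx d × Idx d → ((Fin d → ℝ) × (Fin d → ℝ)) × ((Fin d → ℝ) × (Fin d → ℝ)) → ℝ≥0∞ :=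
    fun x y p => (‖packet ρ x.1 p.1.1‖ₑ * ‖packet ρ x.2 p.1.2‖ₑ) *
      (‖packet ρ y.1 p.2.1‖ₑ * ‖packet ρ y.2 p.2.2‖ₑ) with hPk
  have hPkm : ∀ x y, Measurable (Pk x y) := by
    intro x y
    have hm : ∀ T : Idx d, Measurable fun ξ => ‖packet ρ T ξ‖ₑ := fun T =>
      (continuous_packet ρ T).enorm.measurable
    exact ((((hm x.1).comp (measurable_fst.comp measurable_fst)).mul
      ((hm x.2).comp (measurable_snd.comp measurable_fst))).mul
      (((hm y.1).comp (measurable_fst.comp measurable_snd)).mul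
      ((hm y.2).comp (measurable_snd.comp measurable_snd))))
  set K : Idx d × Idx d → Idx d × Idx d → ℝ≥0∞ := fun x y =>
    if quad Φ ρ (3 + 2 * G) x y then ‖c₁ x.1‖ₑ * ‖c₂ x.2‖ₑ * (‖c₁ y.1‖ₑ * ‖c₂ y.2‖ₑ) else 0
  have hsyn : ∀ (𝕋 : Finset (Idx d)) (c : Idx d → ℂ) ξ, ‖synth ρ 𝕋 c ξ‖ₑ ≤ ∑ T ∈ 𝕋, ‖c T‖ₑ * ‖packet ρ T ξ‖ₑ := by
    intro 𝕋 c ξ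
    rw [synth]
    refine (enorm_sum_le _ _).trans (le_of_eq ?_)
    simp only [enorm_mul]
  have hpt : ∀ p : ((Fin d → ℝ) × (Fin d → ℝ)) × ((Fin d → ℝ) × (Fin d → ℝ)),
      ‖synth ρ 𝕋₁ c₁ p.1.1‖ₑ * ‖synth ρ 𝕋₂ c₂ p.1.2‖ₑ * (‖synth ρ 𝕋₁ c₁ p.2.1‖ₑ * ‖synth ρ 𝕋₂ c₂ p.2.2‖ₑ) * χ p ≤
      ∑ x ∈ 𝕋₁ ×ˢ 𝕋₂, ∑ y ∈ 𝕋₁ ×ˢ 𝕋₂, K x y * Pk x y p := by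
    intro p
    calc _ ≤ (∑ T ∈ 𝕋₁, ‖c₁ T‖ₑ * ‖packet ρ T p.1.1‖ₑ) * (∑ T ∈ 𝕋₂, ‖c₂ T‖ₑ * ‖packet ρ T p.1.2‖ₑ) *
          ((∑ T ∈ 𝕋₁, ‖c₁ T‖ₑ * ‖packet ρ T p.2.1‖ₑ) * (∑ T ∈ 𝕋₂, ‖c₂ T‖ₑ * ‖packet ρ T p.2.2‖ₑ)) * χ p := by
          gcongr <;> exact hsyn _ _ _
      _ = ∑ x ∈ 𝕋₁ ×ˢ 𝕋₂, ∑ y ∈ 𝕋₁ ×ˢ 𝕋₂,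
          (‖c₁ x.1‖ₑ * ‖packet ρ x.1 p.1.1‖ₑ * (‖c₂ x.2‖ₑ * ‖packet ρ x.2 p.1.2‖ₑ)) *
          (‖c₁ y.1‖ₑ * ‖packet ρ y.1 p.2.1‖ₑ * (‖c₂ y.2‖ₑ * ‖packet ρ y.2 p.2.2‖ₑ)) * χ p := by
          rw [Finset.sum_mul_sum, Finset.sum_mul_sum, ← Finset.sum_product', ← Finset.sum_product',
            Finset.sum_mul_sum, Finset.sum_mul]
          simp only [Finset.sum_mul]
      _ ≤ _ := by
          refine Finset.sum_le_sum fun x hx => Finset.sum_le_sum fun y hy => ?_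
          obtain ⟨hx1, hx2⟩ := Finset.mem_product.1 hx
          obtain ⟨hy1, hy2⟩ := Finset.mem_product.1 hy
          by_cases hP : Pk x y p = 0
          · have h0 : (‖c₁ x.1‖ₑ * ‖packet ρ x.1 p.1.1‖ₑ * (‖c₂ x.2‖ₑ * ‖packet ρ x.2 p.1.2‖ₑ)) *
              (‖c₁ y.1‖ₑ * ‖packet ρ y.1 p.2.1‖ₑ * (‖c₂ y.2‖ₑ * ‖packet ρ y.2 p.2.2‖ₑ)) * χ p =
              ‖c₁ x.1‖ₑ * ‖c₂ x.2‖ₑ * (‖c₁ y.1‖ₑ * ‖c₂ y.2‖ₑ) * Pk x y p * χ p := by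
              simp only [hPk]; ring
            rw [h0, hP]; simp
          · by_cases hχ : χ p = 0
            · rw [hχ, mul_zero]; exact bot_le
            have hχ' : ‖(p.1.1 + p.1.2) - (p.2.1 + p.2.2)‖ ≤ 1 / ρ ∧
                ‖(Φ p.1.1 + Φ p.1.2) - (Φ p.2.1 + Φ p.2.2)‖ ≤ 1 / ρ := by
              by_contra h
              exact hχ (if_neg h)
            have hχ1 : χ p = 1 := if_pos hχ'
            simp only [hPk, mul_eq_zero, not_or, enorm_eq_zero] at hP
            obtain ⟨⟨p1, p2⟩, p3, p4⟩ := hP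
            have q1 := hsupp _ _ (h1 _ hx1) p1
            have q2 := hsupp _ _ (h2 _ hx2) p2
            have q3 := hsupp _ _ (h1 _ hy1) p3
            have q4 := hsupp _ _ (h2 _ hy2) p4
            have hq : quad Φ ρ (3 + 2 * G) x y := by
              have e1 : 1 / ρ + (1 / (2 * ρ) + 1 / (2 * ρ) + (1 / (2 * ρ) + 1 / (2 * ρ))) = 3 / ρ := by
                field_simp; norm_num
              have e2 : 1 / ρ + (G / (2 * ρ) + G / (2 * ρ) + (G / (2 * ρ) + G / (2 * ρ))) = (1 + 2 * G) / ρ := by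
                field_simp; ring
              constructor
              · refine (hfour _ _ _ _ p.1.1 p.1.2 p.2.1 p.2.2).trans ?_
                calc _ ≤ 1 / ρ + (1 / (2 * ρ) + 1 / (2 * ρ) + (1 / (2 * ρ) + 1 / (2 * ρ))) :=
                      add_le_add hχ'.1 (add_le_add (add_le_add q1.1 q2.1) (add_le_add q3.1 q4.1))
                  _ ≤ (3 + 2 * G) / ρ := by rw [e1]; gcongr; linarith
              · refine (hfour _ _ _ _ (Φ p.1.1) (Φ p.1.2) (Φ p.2.1) (Φ p.2.2)).trans ?_
                calc _ ≤ 1 / ρ + (G / (2 * ρ) + G / (2 * ρ) + (G / (2 * ρ) + G / (2 * ρ))) :=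
                      add_le_add hχ'.2 (add_le_add (add_le_add q1.2 q2.2) (add_le_add q3.2 q4.2))
                  _ ≤ (3 + 2 * G) / ρ := by rw [e2]; gcongr; norm_num
            have hK : K x y = ‖c₁ x.1‖ₑ * ‖c₂ x.2‖ₑ * (‖c₁ y.1‖ₑ * ‖c₂ y.2‖ₑ) := if_pos hq
            rw [hχ1, hK, hPk]
            refine le_of_eq ?_
            ring
  have hint : ∫⁻ p, ‖synth ρ 𝕋₁ c₁ p.1.1‖ₑ * ‖synth ρ 𝕋₂ c₂ p.1.2‖ₑ *
      (‖synth ρ 𝕋₁ c₁ p.2.1‖ₑ * ‖synth ρ 𝕋₂ c₂ p.2.2‖ₑ) * χ p ≤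
      ∑ x ∈ 𝕋₁ ×ˢ 𝕋₂, ∑ y ∈ 𝕋₁ ×ˢ 𝕋₂, K x y * ENNReal.ofReal (1 / (ρ ^ d) ^ 2) := by
    refine (lintegral_mono hpt).trans ?_
    rw [lintegral_finsetSum _ fun x _ => Finset.measurable_fun_sum _ fun y _ => (hPkm x y).const_mul _]
    refine Finset.sum_le_sum fun x _ => ?_
    rw [lintegral_finsetSum _ fun y _ => (hPkm x y).const_mul _]
    refine Finset.sum_le_sum fun y _ => ?_
    rw [lintegral_const_mul _ (hPkm x y)]
    gcongr
    exact lintegral_four_packets_le hρ0 x y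
  refine (mul_le_mul_right hint _).trans (le_of_eq ?_)
  have hKr : ∀ x y, K x y = ENNReal.ofReal (if quad Φ ρ (3 + 2 * G) x y then
      ‖c₁ x.1‖ * ‖c₂ x.2‖ * (‖c₁ y.1‖ * ‖c₂ y.2‖) else 0) := by
    intro x y
    simp only [K]
    split_ifs
    · rw [ENNReal.ofReal_mul (by positivity), ENNReal.ofReal_mul (by positivity),
        ENNReal.ofReal_mul (by positivity)]
      simp only [ofReal_norm]
    · simp
  simp only [hKr, ← Finset.sum_mul]
  have hnn : ∀ x y : Idx d × Idx d, 0 ≤ if quad Φ ρ (3 + 2 * G) x y then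
      ‖c₁ x.1‖ * ‖c₂ x.2‖ * (‖c₁ y.1‖ * ‖c₂ y.2‖) else 0 := fun x y => by
    split_ifs <;> positivity
  have hS : ∑ x ∈ 𝕋₁ ×ˢ 𝕋₂, ∑ y ∈ 𝕋₁ ×ˢ 𝕋₂, ENNReal.ofReal (if quad Φ ρ (3 + 2 * G) x y then
      ‖c₁ x.1‖ * ‖c₂ x.2‖ * (‖c₁ y.1‖ * ‖c₂ y.2‖) else 0) = ENNReal.ofReal (∑ x ∈ 𝕋₁ ×ˢ 𝕋₂,
      ∑ y ∈ 𝕋₁ ×ˢ 𝕋₂, if quad Φ ρ (3 + 2 * G) x y then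
      ‖c₁ x.1‖ * ‖c₂ x.2‖ * (‖c₁ y.1‖ * ‖c₂ y.2‖) else 0) := by
    rw [ENNReal.ofReal_sum_of_nonneg fun x _ => Finset.sum_nonneg fun y _ => hnn x y]
    exact Finset.sum_congr rfl fun x _ => (ENNReal.ofReal_sum_of_nonneg fun y _ => hnn x y).symm
  rw [hS]
  rw [← ENNReal.ofReal_mul (Finset.sum_nonneg fun x _ => Finset.sum_nonneg fun y _ => hnn x y),
    ← ENNReal.ofReal_mul (by positivity)]
  congr 1
  rw [pow_add]
  field_simp

end Analysis

section Geometry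
variable {d k : ℕ}

/-- The transpose of `L : ℝ^d → ℝ^k` applied to `t`. -/
def adjApp (L : (Fin d → ℝ) →L[ℝ] (Fin k → ℝ)) (t : Fin k → ℝ) : Fin d → ℝ :=
  fun i => t ⬝ᵥ L (Pi.single i 1)

lemma gradT_eq_adjApp (Φ : (Fin d → ℝ) → Fin k → ℝ) (ξ : Fin d → ℝ) (t : Fin k → ℝ) :
    gradT Φ ξ t = adjApp (fderiv ℝ Φ ξ) t := rfl

lemma adjApp_smul (L : (Fin d → ℝ) →L[ℝ] (Fin k → ℝ)) (a : ℝ) (t : Fin k → ℝ) :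
    adjApp L (a • t) = a • adjApp L t := by
  funext i; simp [adjApp, smul_dotProduct]

lemma sub_adjApp (L L' : (Fin d → ℝ) →L[ℝ] (Fin k → ℝ)) (t : Fin k → ℝ) :
    adjApp (L - L') t = adjApp L t - adjApp L' t := by
  funext i; simp [adjApp, dotProduct_sub]

lemma smul_adjApp (a : ℝ) (L : (Fin d → ℝ) →L[ℝ] (Fin k → ℝ)) (t : Fin k → ℝ) :
    adjApp (a • L) t = a • adjApp L t := by
  funext i; simp [adjApp, dotProduct_smul]

lemma norm_adjApp_le (L : (Fin d → ℝ) →L[ℝ] (Fin k → ℝ)) (t : Fin k → ℝ) :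
    ‖adjApp L t‖ ≤ k * (‖L‖ * ‖t‖) := by
  refine (pi_norm_le_iff_of_nonneg (by positivity)).2 fun i => ?_
  rw [Real.norm_eq_abs]
  refine (abs_dotProduct_le _ _).trans ?_
  have h : ‖L (Pi.single i 1)‖ ≤ ‖L‖ * 1 :=
    L.le_of_opNorm_le le_rfl _ |>.trans (by rw [Pi.norm_single]; simp)
  calc _ ≤ k * (‖t‖ * (‖L‖ * 1)) := by gcongr
    _ = _ := by ring

lemma continuous_adjApp_uncurry :
    Continuous fun p : ((Fin d → ℝ) →L[ℝ] (Fin k → ℝ)) × (Fin k → ℝ) => adjApp p.1 p.2 := by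
  unfold adjApp dotProduct
  refine continuous_pi fun i => continuous_finsetSum _ fun j _ => ?_
  refine Continuous.mul (by fun_prop) ?_
  have h : Continuous fun p : ((Fin d → ℝ) →L[ℝ] (Fin k → ℝ)) × (Fin k → ℝ) =>
    p.1 (Pi.single i 1) := by fun_prop
  exact (continuous_apply j).comp h

/-- Infinitesimal nondegeneracy of a pair of a linear map and its first variation. -/
def NonDeg (L : (Fin d → ℝ) →L[ℝ] (Fin k → ℝ))
    (B : (Fin d → ℝ) →L[ℝ] (Fin d → ℝ) →L[ℝ] (Fin k → ℝ)) : Prop :=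
  ∀ τ : Fin k → ℝ, τ ≠ 0 → ∀ (σ : Fin k → ℝ) (u : Fin d → ℝ),
    adjApp L σ + adjApp (B u) τ = 0 → L u = 0 → σ = 0 ∧ u = 0

lemma NonDeg.exists_bound (hk : 1 ≤ k) {L : (Fin d → ℝ) →L[ℝ] (Fin k → ℝ)}
    {B : (Fin d → ℝ) →L[ℝ] (Fin d → ℝ) →L[ℝ] (Fin k → ℝ)} (h : NonDeg L B) :
    ∃ c : ℝ, 0 < c ∧ ∀ (τ σ : Fin k → ℝ) (u : Fin d → ℝ),
      c * (‖σ‖ + ‖τ‖ * ‖u‖) ≤ ‖adjApp L σ + adjApp (B u) τ‖ + ‖τ‖ * ‖L u‖ := by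
  set S : Set (((Fin k → ℝ) × (Fin d → ℝ)) × (Fin k → ℝ)) :=
    Metric.sphere 0 1 ×ˢ Metric.sphere 0 1
  set f : ((Fin k → ℝ) × (Fin d → ℝ)) × (Fin k → ℝ) → ℝ := fun p =>
    ‖adjApp L p.1.1 + adjApp (B p.1.2) p.2‖ + ‖L p.1.2‖
  have hS : IsCompact S := (isCompact_sphere _ _).prod (isCompact_sphere _ _)
  have hf : Continuous f := by
    have h1 : Continuous fun p : ((Fin k → ℝ) × (Fin d → ℝ)) × (Fin k → ℝ) => adjApp L p.1.1 :=
      continuous_adjApp_uncurry.comp (by fun_prop :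
        Continuous fun p : ((Fin k → ℝ) × (Fin d → ℝ)) × (Fin k → ℝ) => (L, p.1.1))
    have h2 : Continuous fun p : ((Fin k → ℝ) × (Fin d → ℝ)) × (Fin k → ℝ) =>
        adjApp (B p.1.2) p.2 :=
      continuous_adjApp_uncurry.comp (by fun_prop :
        Continuous fun p : ((Fin k → ℝ) × (Fin d → ℝ)) × (Fin k → ℝ) => (B p.1.2, p.2))
    fun_prop
  have hne : Nonempty (Fin k) := ⟨⟨0, hk⟩⟩
  have hnt : Nontrivial (Fin k → ℝ) := inferInstance
  have hSn : S.Nonempty := by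
    have h1 : (Metric.sphere (0 : (Fin k → ℝ) × (Fin d → ℝ)) 1).Nonempty :=
      NormedSpace.sphere_nonempty.2 zero_le_one
    have h2 : (Metric.sphere (0 : Fin k → ℝ) 1).Nonempty :=
      NormedSpace.sphere_nonempty.2 zero_le_one
    exact h1.prod h2
  obtain ⟨p0, hp0, hmin⟩ := hS.exists_isMinOn hSn hf.continuousOn
  have hc : 0 < f p0 := by
    have h0 : 0 ≤ f p0 := by positivity
    refine h0.lt_of_ne fun h1 => ?_
    have h2 : ‖adjApp L p0.1.1 + adjApp (B p0.1.2) p0.2‖ = 0 ∧ ‖L p0.1.2‖ = 0 := by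
      have a1 := norm_nonneg (adjApp L p0.1.1 + adjApp (B p0.1.2) p0.2)
      have a2 := norm_nonneg (L p0.1.2)
      have h1' : 0 = ‖adjApp L p0.1.1 + adjApp (B p0.1.2) p0.2‖ + ‖L p0.1.2‖ := h1
      constructor <;> linarith
    have hτ : p0.2 ≠ 0 := by
      intro h3
      have := hp0.2
      simp [h3] at this
    obtain ⟨h3, h4⟩ := h p0.2 hτ _ _ (norm_eq_zero.1 h2.1) (norm_eq_zero.1 h2.2)
    have h5 := hp0.1
    have h6 : p0.1 = 0 := Prod.ext h3 h4
    simp [h6] at h5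
  have hunit : ∀ (τ σ : Fin k → ℝ) (u : Fin d → ℝ), ‖τ‖ = 1 →
      f p0 * max ‖σ‖ ‖u‖ ≤ ‖adjApp L σ + adjApp (B u) τ‖ + ‖L u‖ := by
    intro τ σ u hτ
    set n := ‖((σ, u) : (Fin k → ℝ) × (Fin d → ℝ))‖ with hn
    have hnm : max ‖σ‖ ‖u‖ = n := (Prod.norm_mk σ u).symm
    rw [hnm]
    rcases (norm_nonneg ((σ, u) : (Fin k → ℝ) × (Fin d → ℝ))).eq_or_lt with h0 | h0
    · rw [hn, ← h0, mul_zero]; positivity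
    · have hm := hmin (a := ((n⁻¹ • σ, n⁻¹ • u), τ)) (by
        refine ⟨?_, by simpa using hτ⟩
        have : ((n⁻¹ • σ, n⁻¹ • u) : (Fin k → ℝ) × (Fin d → ℝ)) = n⁻¹ • (σ, u) := rfl
        rw [mem_sphere_zero_iff_norm, this, norm_smul, Real.norm_eq_abs, abs_of_pos (inv_pos.2 h0)]
        exact inv_mul_cancel₀ h0.ne')
      have hm' : f p0 ≤ n⁻¹ * (‖adjApp L σ + adjApp (B u) τ‖ + ‖L u‖) := by
        refine (show f p0 ≤ f ((n⁻¹ • σ, n⁻¹ • u), τ) from hm).trans (le_of_eq ?_)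
        simp only [f]
        rw [adjApp_smul, map_smul, map_smul, smul_adjApp, ← smul_add, norm_smul, norm_smul,
          Real.norm_eq_abs, abs_of_pos (inv_pos.2 h0)]
        ring
      rw [inv_mul_eq_div, le_div_iff₀ h0] at hm'
      exact hm'
  refine ⟨f p0 / 2, by positivity, fun τ σ u => ?_⟩
  by_cases hτ : τ = 0
  · obtain ⟨τ', hτ'⟩ : (Metric.sphere (0 : Fin k → ℝ) 1).Nonempty :=
      NormedSpace.sphere_nonempty.2 zero_le_one
    have h1 := hunit τ' σ 0 (by simpa using hτ')
    have h2 : adjApp (0 : (Fin d → ℝ) →L[ℝ] (Fin k → ℝ)) τ' = 0 := by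
      funext i; simp [adjApp]
    have h3 : adjApp (B u) 0 = 0 := by funext i; simp [adjApp]
    rw [map_zero, map_zero, h2] at h1
    rw [hτ, h3]
    simp only [norm_zero, add_zero, zero_mul] at h1 ⊢
    have h4 : ‖σ‖ ≤ max ‖σ‖ 0 := le_max_left _ _
    nlinarith [norm_nonneg σ]
  · have hn : 0 < ‖τ‖ := norm_pos_iff.2 hτ
    have h1 := hunit (‖τ‖⁻¹ • τ) σ (‖τ‖ • u) (by
      rw [norm_smul, norm_inv, norm_norm, inv_mul_cancel₀ hn.ne'])
    rw [map_smul, map_smul, smul_adjApp, adjApp_smul, smul_smul, mul_inv_cancel₀ hn.ne', one_smul,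
      norm_smul, norm_smul, norm_norm] at h1
    refine le_trans ?_ h1
    have h2 := le_max_left ‖σ‖ (‖τ‖ * ‖u‖)
    have h3 := le_max_right ‖σ‖ (‖τ‖ * ‖u‖)
    nlinarith

/-- Nondegeneracy of `Φ` at the ordered pair of points `(ν, ν')`. -/
def TransCond (Φ : (Fin d → ℝ) → Fin k → ℝ) (ν ν' : Fin d → ℝ) : Prop :=
  NonDeg (fderiv ℝ Φ ν - fderiv ℝ Φ ν') (fderiv ℝ (fderiv ℝ Φ) ν)

lemma exists_ball_strict {E F : Type*} [NormedAddCommGroup E] [NormedSpace ℝ E]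
    [NormedAddCommGroup F] [NormedSpace ℝ F] {f : E → F} {x : E} (hf : ContDiff ℝ 1 f)
    {e : ℝ} (he : 0 < e) : ∃ r : ℝ, 0 < r ∧ ∀ y z, ‖y - x‖ ≤ r → ‖z - x‖ ≤ r →
      ‖f y - f z - fderiv ℝ f x (y - z)‖ ≤ e * ‖y - z‖ := by
  have h := (hf.contDiffAt (x := x)).hasStrictFDerivAt (by simp)
  have h1 := (h.isLittleO.def he)
  rw [Metric.eventually_nhds_iff] at h1
  obtain ⟨r, hr, h2⟩ := h1
  refine ⟨r / 2, by positivity, fun y z hy hz => ?_⟩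
  refine h2 (y := (y, z)) ?_
  rw [Prod.dist_eq, dist_eq_norm, dist_eq_norm]
  exact max_lt (by simp only; linarith) (by simp only; linarith)

lemma TransCond.exists_ball (hk : 1 ≤ k) {Φ : (Fin d → ℝ) → Fin k → ℝ}
    (hΦ : ContDiff ℝ (⊤ : ℕ∞) Φ) {ν ν' : Fin d → ℝ} (h : TransCond Φ ν ν') :
    ∃ r c : ℝ, 0 < r ∧ 0 < c ∧ r ≤ 1 ∧ ∀ ξ' ξ'' ξ₀ δ : Fin d → ℝ, ‖ξ' - ν‖ ≤ r → ‖ξ'' - ν‖ ≤ r →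
      ‖ξ₀ - ν'‖ ≤ r → ‖δ - (ν' - ν)‖ ≤ 2 * r → ∀ σ τ : Fin k → ℝ,
      c * (‖σ‖ + ‖τ‖ * ‖ξ' - ξ''‖) ≤
        ‖(gradT Φ ξ' σ - gradT Φ ξ₀ σ) + (gradT Φ ξ' τ - gradT Φ ξ'' τ)‖ +
        ‖τ‖ * ‖(Φ (ξ' + δ) - Φ (ξ'' + δ)) - (Φ ξ' - Φ ξ'')‖ := by
  obtain ⟨c, hc, hb⟩ := h.exists_bound hk
  have hΦ1 : ContDiff ℝ 1 Φ := hΦ.of_le (by exact_mod_cast le_top)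
  have hΦ2 : ContDiff ℝ 1 (fderiv ℝ Φ) :=
    (hΦ.fderiv_right (m := ((⊤ : ℕ∞) : WithTop ℕ∞)) (by simp)).of_le (by exact_mod_cast le_top)
  set e : ℝ := c / (2 * (2 * k + 2)) with he
  have hepos : 0 < e := by positivity
  obtain ⟨r1, hr1, g1⟩ := exists_ball_strict (x := ν) hΦ1 hepos
  obtain ⟨r2, hr2, g2⟩ := exists_ball_strict (x := ν') hΦ1 hepos
  obtain ⟨r3, hr3, g3⟩ := exists_ball_strict (x := ν) hΦ2 hepos
  have hcont : ∀ x, ∃ r : ℝ, 0 < r ∧ ∀ y, ‖y - x‖ ≤ r → ‖fderiv ℝ Φ y - fderiv ℝ Φ x‖ ≤ e := by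
    intro x
    have h1 := (Metric.continuous_iff.1 hΦ2.continuous) x e hepos
    obtain ⟨r, hr, h2⟩ := h1
    refine ⟨r / 2, by positivity, fun y hy => ?_⟩
    rw [← dist_eq_norm]
    exact (h2 y (by rw [dist_eq_norm]; linarith)).le
  obtain ⟨r4, hr4, g4⟩ := hcont ν
  obtain ⟨r5, hr5, g5⟩ := hcont ν'
  obtain ⟨r, hr, hr1', hrr1, hrr2, hrr3, hrr4, hrr5⟩ : ∃ r : ℝ, 0 < r ∧ r ≤ 1 ∧ r ≤ r1 ∧ 3 * r ≤ r2 ∧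
      r ≤ r3 ∧ r ≤ r4 ∧ r ≤ r5 := by
    refine ⟨min 1 (min r1 (min (r2 / 3) (min r3 (min r4 r5)))), by positivity, ?_, ?_, ?_, ?_, ?_, ?_⟩
    · simp
    · simp
    · have : min 1 (min r1 (min (r2 / 3) (min r3 (min r4 r5)))) ≤ r2 / 3 := by simp
      linarith
    all_goals simp
  refine ⟨r, c / 2, hr, by positivity, hr1', fun ξ' ξ'' ξ₀ δ h' h'' h₀ hδ σ τ => ?_⟩
  set u := ξ' - ξ'' with hu
  have k1 := g1 ξ' ξ'' (h'.trans hrr1) (h''.trans hrr1)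
  have k2 := g2 (ξ' + δ) (ξ'' + δ)
    (by
      calc ‖ξ' + δ - ν'‖ = ‖(ξ' - ν) + (δ - (ν' - ν))‖ := by congr 1; abel
        _ ≤ _ := (norm_add_le _ _).trans (by linarith))
    (by
      calc ‖ξ'' + δ - ν'‖ = ‖(ξ'' - ν) + (δ - (ν' - ν))‖ := by congr 1; abel
        _ ≤ _ := (norm_add_le _ _).trans (by linarith))
  rw [add_sub_add_right_eq_sub] at k2
  have k3 := g3 ξ' ξ'' (h'.trans hrr3) (h''.trans hrr3)
  have k4 := g4 ξ' (h'.trans hrr4)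
  have k5 := g5 ξ₀ (h₀.trans hrr5)
  rw [← hu] at k1 k2 k3
  have hbase := hb τ σ u
  have e1 : ‖adjApp (fderiv ℝ Φ ν - fderiv ℝ Φ ν') σ + adjApp (fderiv ℝ (fderiv ℝ Φ) ν u) τ‖ ≤
      ‖(gradT Φ ξ' σ - gradT Φ ξ₀ σ) + (gradT Φ ξ' τ - gradT Φ ξ'' τ)‖ +
      (k * (e * ‖σ‖) + k * (e * ‖σ‖) + k * (e * ‖u‖ * ‖τ‖)) := by
    have e2 : adjApp (fderiv ℝ Φ ν - fderiv ℝ Φ ν') σ + adjApp (fderiv ℝ (fderiv ℝ Φ) ν u) τ =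
        ((gradT Φ ξ' σ - gradT Φ ξ₀ σ) + (gradT Φ ξ' τ - gradT Φ ξ'' τ)) -
        (adjApp (fderiv ℝ Φ ξ' - fderiv ℝ Φ ν) σ - adjApp (fderiv ℝ Φ ξ₀ - fderiv ℝ Φ ν') σ +
        adjApp (fderiv ℝ Φ ξ' - fderiv ℝ Φ ξ'' - fderiv ℝ (fderiv ℝ Φ) ν u) τ) := by
      simp only [gradT_eq_adjApp, sub_adjApp]
      abel
    rw [e2]
    refine (norm_sub_le _ _).trans (add_le_add le_rfl ?_)
    refine (norm_add_le _ _).trans (add_le_add ((norm_sub_le _ _).trans (add_le_add ?_ ?_)) ?_)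
    · exact (norm_adjApp_le _ _).trans (by gcongr)
    · exact (norm_adjApp_le _ _).trans (by gcongr)
    · exact (norm_adjApp_le _ _).trans (by gcongr)
  have e3 : ‖(fderiv ℝ Φ ν - fderiv ℝ Φ ν') u‖ ≤
      ‖(Φ (ξ' + δ) - Φ (ξ'' + δ)) - (Φ ξ' - Φ ξ'')‖ + (e * ‖u‖ + e * ‖u‖) := by
    have e4 : (fderiv ℝ Φ ν - fderiv ℝ Φ ν') u = -(((Φ (ξ' + δ) - Φ (ξ'' + δ)) - (Φ ξ' - Φ ξ'')) -
        ((Φ (ξ' + δ) - Φ (ξ'' + δ) - fderiv ℝ Φ ν' u) - (Φ ξ' - Φ ξ'' - fderiv ℝ Φ ν u))) := by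
      rw [_root_.sub_apply]
      abel
    rw [e4, norm_neg]
    exact (norm_sub_le _ _).trans (add_le_add le_rfl ((norm_sub_le _ _).trans (add_le_add k2 k1)))
  have e5 := mul_le_mul_of_nonneg_left e3 (norm_nonneg τ)
  have hce : c = e * (2 * (2 * k + 2)) := by rw [he]; field_simp
  have hs := norm_nonneg σ
  have htu : 0 ≤ ‖τ‖ * ‖u‖ := by positivity
  have hkk : (0 : ℝ) ≤ k := Nat.cast_nonneg k
  have a1 : 0 ≤ e * ‖σ‖ := by positivity
  have a2 : 0 ≤ e * (‖τ‖ * ‖u‖) := by positivity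
  have a3 : 0 ≤ k * (e * (‖τ‖ * ‖u‖)) := by positivity
  rw [hce] at hbase ⊢
  nlinarith

end Geometry

section Transversality
variable {d k : ℕ}

lemma exists_orthonormal_rows {D : Matrix (Fin k) (Fin d) ℝ}
    (hD : LinearIndependent ℝ fun j : Fin k => D j) :
    ∃ N : Matrix (Fin (d - k)) (Fin d) ℝ, N * Nᵀ = 1 ∧ N * Dᵀ = 0 ∧
      ∀ u, D *ᵥ u = 0 → ∃ a, u = a ᵥ* N := by
  set K : Submodule ℝ (EuclideanSpace ℝ (Fin d)) :=
    LinearMap.ker (D.mulVecLin ∘ₗ (WithLp.linearEquiv 2 ℝ (Fin d → ℝ)).toLinearMap) with hK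
  have hmem : ∀ v : EuclideanSpace ℝ (Fin d), v ∈ K ↔ D *ᵥ v.ofLp = 0 := fun v => Iff.rfl
  have hrank : D.rank = k := by
    have := LinearIndependent.rank_matrix (M := D) hD
    simpa using this
  have hfin : Module.finrank ℝ K = d - k := by
    have h1 := LinearMap.finrank_range_add_finrank_ker
      (D.mulVecLin ∘ₗ (WithLp.linearEquiv 2 ℝ (Fin d → ℝ)).toLinearMap)
    rw [LinearMap.range_comp_of_range_eq_top _ (LinearEquiv.range _)] at h1
    rw [finrank_euclideanSpace, Fintype.card_fin] at h1
    change D.rank + Module.finrank ℝ K = d at h1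
    omega
  set b := (stdOrthonormalBasis ℝ K).reindex (finCongr hfin)
  refine ⟨Matrix.of fun i j => (b i : EuclideanSpace ℝ (Fin d)) j, ?_, ?_, ?_⟩
  · ext i j
    have h1 := orthonormal_iff_ite.1 b.orthonormal i j
    rw [Submodule.coe_inner, PiLp.inner_apply] at h1
    rw [Matrix.mul_apply, Matrix.one_apply, ← h1]
    refine Finset.sum_congr rfl fun l _ => ?_
    simp [mul_comm]
  · ext i j
    have h1 := (hmem _).1 (b i).2
    have h2 := congrFun h1 j
    rw [Matrix.mul_apply]
    simp only [Matrix.mulVec, dotProduct, Pi.zero_apply] at h2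
    simp only [Matrix.of_apply, Matrix.transpose_apply, Matrix.zero_apply]
    rw [← h2]
    exact Finset.sum_congr rfl fun l _ => mul_comm _ _
  · intro u hu
    set v : K := ⟨WithLp.toLp 2 u, (hmem _).2 hu⟩ with hv
    refine ⟨fun i => b.repr v i, ?_⟩
    have h1 := b.sum_repr v
    have h2 := congrArg (fun x : K => (x : EuclideanSpace ℝ (Fin d))) h1
    simp only [AddSubmonoidClass.coe_finsetSum, Submodule.coe_smul] at h2
    funext j
    have h3 := congrArg (fun x : EuclideanSpace ℝ (Fin d) => x j) h2
    simp only [WithLp.ofLp_sum, Finset.sum_apply, PiLp.smul_apply, smul_eq_mul] at h3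
    simp only [Matrix.vecMul, dotProduct, Matrix.of_apply]
    exact h3.symm

lemma fderiv_coord {Φ : (Fin d → ℝ) → Fin k → ℝ} (hΦ : ContDiff ℝ (⊤ : ℕ∞) Φ) (x v : Fin d → ℝ)
    (l : Fin k) : fderiv ℝ (fun y => Φ y l) x v = fderiv ℝ Φ x v l := by
  have h1 : DifferentiableAt ℝ Φ x := hΦ.differentiable (by simp) x
  have h2 := hasFDerivAt_pi'.1 h1.hasFDerivAt l
  rw [h2.fderiv]
  rfl

lemma hessPhi_apply {Φ : (Fin d → ℝ) → Fin k → ℝ} (hΦ : ContDiff ℝ (⊤ : ℕ∞) Φ) (ν : Fin d → ℝ)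
    (l : Fin k) (i j : Fin d) : hessPhi d (fun x => Φ x l) ν i j =
      fderiv ℝ (fderiv ℝ Φ) ν (Pi.single i 1) (Pi.single j 1) l := by
  have h1 : DifferentiableAt ℝ (fderiv ℝ Φ) ν :=
    (hΦ.fderiv_right (m := ((⊤ : ℕ∞) : WithTop ℕ∞)) (by simp)).differentiable (by simp) ν
  have h2 := h1.hasFDerivAt.clm_apply (hasFDerivAt_const (Pi.single j (1 : ℝ) : Fin d → ℝ) ν)
  have h3 := hasFDerivAt_pi'.1 h2 l
  simp only [hessPhi, Matrix.of_apply, fderiv_coord hΦ]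
  rw [h3.fderiv]
  simp

lemma adjApp_fderiv_fderiv {Φ : (Fin d → ℝ) → Fin k → ℝ} (hΦ : ContDiff ℝ (⊤ : ℕ∞) Φ)
    (ν u : Fin d → ℝ) (τ : Fin k → ℝ) :
    adjApp (fderiv ℝ (fderiv ℝ Φ) ν u) τ = u ᵥ* tHess d k Φ τ ν := by
  funext i
  have hu : u = ∑ j, u j • Pi.single j (1 : ℝ) := by
    funext l
    simp [Finset.sum_apply, Pi.single_apply]
  simp only [adjApp, tHess, Matrix.vecMul, dotProduct, Matrix.sum_apply, Matrix.smul_apply,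
    hessPhi_apply hΦ, smul_eq_mul]
  conv_lhs => rw [hu]
  simp only [map_sum, map_smul, _root_.sum_apply, _root_.smul_apply, Finset.sum_apply,
    Pi.smul_apply, smul_eq_mul, Finset.mul_sum]
  rw [Finset.sum_comm]
  exact Finset.sum_congr rfl fun j _ => Finset.sum_congr rfl fun l _ => by ring

lemma Dmat_apply {Φ : (Fin d → ℝ) → Fin k → ℝ} (hΦ : ContDiff ℝ (⊤ : ℕ∞) Φ) (ν₁ ν₂ : Fin d → ℝ)
    (j : Fin k) (i : Fin d) : Dmat d k Φ ν₁ ν₂ j i =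
      (fderiv ℝ Φ ν₂ - fderiv ℝ Φ ν₁) (Pi.single i 1) j := by
  simp only [Dmat, gradPhi, Matrix.of_apply, fderiv_coord hΦ]
  simp

lemma mulVec_Dmat {Φ : (Fin d → ℝ) → Fin k → ℝ} (hΦ : ContDiff ℝ (⊤ : ℕ∞) Φ)
    (ν₁ ν₂ u : Fin d → ℝ) : Dmat d k Φ ν₁ ν₂ *ᵥ u = (fderiv ℝ Φ ν₂ - fderiv ℝ Φ ν₁) u := by
  have hu : u = ∑ j, u j • Pi.single j (1 : ℝ) := by
    funext l
    simp [Finset.sum_apply, Pi.single_apply]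
  funext j
  simp only [Matrix.mulVec, dotProduct, Dmat_apply hΦ]
  conv_rhs => rw [hu]
  simp only [map_sum, map_smul, Finset.sum_apply, Pi.smul_apply, smul_eq_mul]
  exact Finset.sum_congr rfl fun l _ => by ring

lemma vecMul_Dmat {Φ : (Fin d → ℝ) → Fin k → ℝ} (hΦ : ContDiff ℝ (⊤ : ℕ∞) Φ)
    (ν₁ ν₂ : Fin d → ℝ) (σ : Fin k → ℝ) :
    σ ᵥ* Dmat d k Φ ν₁ ν₂ = adjApp (fderiv ℝ Φ ν₂ - fderiv ℝ Φ ν₁) σ := by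
  funext i
  simp only [Matrix.vecMul, dotProduct, Dmat_apply hΦ, adjApp]

lemma tHess_smul (Φ : (Fin d → ℝ) → Fin k → ℝ) (s : ℝ) (t : Fin k → ℝ) (ν : Fin d → ℝ) :
    tHess d k Φ (s • t) ν = s • tHess d k Φ t ν := by
  simp [tHess, Finset.smul_sum, smul_smul]

lemma eq_zero_of_vecMul_Dmat_add {Φ : (Fin d → ℝ) → Fin k → ℝ} {ν₁ ν₂ ν : Fin d → ℝ}
    (hind : LinearIndependent ℝ (fun j : Fin k => Dmat d k Φ ν₁ ν₂ j))
    (hN : ∀ N : Matrix (Fin (d - k)) (Fin d) ℝ, N * Nᵀ = 1 → N * (Dmat d k Φ ν₁ ν₂)ᵀ = 0 →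
      ∀ t : Fin k → ℝ, (∑ i, t i ^ 2) = 1 → (N * tHess d k Φ t ν * Nᵀ).det ≠ 0)
    {τ σ : Fin k → ℝ} {u : Fin d → ℝ} (hτ : τ ≠ 0)
    (h : σ ᵥ* Dmat d k Φ ν₁ ν₂ + u ᵥ* tHess d k Φ τ ν = 0) (hu : Dmat d k Φ ν₁ ν₂ *ᵥ u = 0) :
    σ = 0 ∧ u = 0 := by
  obtain ⟨N, hN1, hN2, hN3⟩ := exists_orthonormal_rows hind
  obtain ⟨a, rfl⟩ := hN3 u hu
  have hpos : 0 < ∑ i, τ i ^ 2 := by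
    obtain ⟨i, hi⟩ := Function.ne_iff.1 hτ
    exact Finset.sum_pos' (fun _ _ => sq_nonneg _) ⟨i, Finset.mem_univ _, by have : τ i ≠ 0 := hi; positivity⟩
  set s := (√(∑ i, τ i ^ 2))⁻¹ with hs
  have h1 := hN N hN1 hN2 (s • τ) (by
    simp only [Pi.smul_apply, smul_eq_mul, mul_pow, ← Finset.mul_sum]
    rw [hs, inv_pow, Real.sq_sqrt hpos.le, inv_mul_cancel₀ hpos.ne'])
  have hDN : Dmat d k Φ ν₁ ν₂ * Nᵀ = 0 := by
    have := congrArg Matrix.transpose hN2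
    simpa [Matrix.transpose_mul] using this
  have h2 : a ᵥ* (N * tHess d k Φ τ ν * Nᵀ) = 0 := by
    have h3 := congrArg (fun v => v ᵥ* Nᵀ) h
    simp only [Matrix.add_vecMul, Matrix.vecMul_vecMul, hDN, Matrix.vecMul_zero, zero_add,
      Matrix.zero_vecMul] at h3
    exact h3
  have h4 : a ᵥ* (N * tHess d k Φ (s • τ) ν * Nᵀ) = 0 := by
    rw [tHess_smul, Matrix.mul_smul, Matrix.smul_mul, Matrix.vecMul_smul, h2, smul_zero]
  have ha : a = 0 := Matrix.eq_zero_of_vecMul_eq_zero h1 h4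
  subst ha
  simp only [Matrix.zero_vecMul, add_zero] at h ⊢
  refine ⟨?_, trivial⟩
  have h5 := Matrix.vecMul_injective_iff.2 hind
  exact h5 (h.trans (Matrix.zero_vecMul _).symm)

lemma transCond_of_left {Φ : (Fin d → ℝ) → Fin k → ℝ} (hΦ : ContDiff ℝ (⊤ : ℕ∞) Φ)
    {ν₁ ν₂ : Fin d → ℝ} (hind : LinearIndependent ℝ (fun j : Fin k => Dmat d k Φ ν₁ ν₂ j))
    (hN : ∀ N : Matrix (Fin (d - k)) (Fin d) ℝ, N * Nᵀ = 1 → N * (Dmat d k Φ ν₁ ν₂)ᵀ = 0 →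
      ∀ t : Fin k → ℝ, (∑ i, t i ^ 2) = 1 → (N * tHess d k Φ t ν₁ * Nᵀ).det ≠ 0) :
    TransCond Φ ν₁ ν₂ := by
  intro τ hτ σ u h1 h2
  have h := eq_zero_of_vecMul_Dmat_add (σ := -σ) hind hN hτ (u := u) (by
    rw [Matrix.neg_vecMul, vecMul_Dmat hΦ, ← adjApp_fderiv_fderiv hΦ, ← h1]
    simp only [sub_adjApp]
    abel) (by
    rw [mulVec_Dmat hΦ, ← neg_eq_zero, ← h2]
    simp)
  exact ⟨neg_eq_zero.1 h.1, h.2⟩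

lemma transCond_of_right {Φ : (Fin d → ℝ) → Fin k → ℝ} (hΦ : ContDiff ℝ (⊤ : ℕ∞) Φ)
    {ν₁ ν₂ : Fin d → ℝ} (hind : LinearIndependent ℝ (fun j : Fin k => Dmat d k Φ ν₁ ν₂ j))
    (hN : ∀ N : Matrix (Fin (d - k)) (Fin d) ℝ, N * Nᵀ = 1 → N * (Dmat d k Φ ν₁ ν₂)ᵀ = 0 →
      ∀ t : Fin k → ℝ, (∑ i, t i ^ 2) = 1 → (N * tHess d k Φ t ν₂ * Nᵀ).det ≠ 0) :
    TransCond Φ ν₂ ν₁ := by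
  intro τ hτ σ u h1 h2
  exact eq_zero_of_vecMul_Dmat_add hind hN hτ
    (by rw [vecMul_Dmat hΦ, ← adjApp_fderiv_fderiv hΦ, ← h1]) (by rw [mulVec_Dmat hΦ, ← h2])

end Transversality

section Counting
variable {d k : ℕ}

lemma norm_toR_sub_freq {ρ : ℝ} (hρ : 0 < ρ) (q q' : Fin d → ℤ) :
    ‖toR q - toR q'‖ = 2 * ρ * ‖freq ρ q - freq ρ q'‖ := by
  rw [freq, freq, ← smul_sub, norm_smul, Real.norm_eq_abs, abs_of_pos (by positivity)]
  field_simp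

/-- The incidences counted in the far part of the bilinear interaction: `p = ((T₁', T₂), z)`. -/
def farInc (Φ : (Fin d → ℝ) → Fin k → ℝ) (ρ κ A : ℝ) (z₀ : (Fin d → ℤ) × (Fin k → ℤ))
    (T₁ T₂' T₂o : Idx d) (p : (Idx d × Idx d) × ((Fin d → ℤ) × (Fin k → ℤ))) : Prop :=
  inc Φ ρ κ p.1.1 z₀ ∧ inc Φ ρ κ p.1.2 z₀ ∧ quad Φ ρ A (T₁, p.1.2) (p.1.1, T₂') ∧
    inc Φ ρ κ p.1.1 p.2 ∧ inc Φ ρ κ T₂o p.2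

set_option maxHeartbeats 1000000 in
lemma TransCond.exists_close (hk : 1 ≤ k) {Φ : (Fin d → ℝ) → Fin k → ℝ}
    (hΦ : ContDiff ℝ (⊤ : ℕ∞) Φ) {ν ν' : Fin d → ℝ} (h : TransCond Φ ν ν') :
    ∃ r : ℝ, 0 < r ∧ r ≤ 1 ∧ ∀ A B : ℝ, 0 ≤ A → 0 ≤ B → ∃ K : ℝ, 0 ≤ K ∧ ∀ ρ κ : ℝ, 1 ≤ κ →
      4 * κ ^ 2 ≤ ρ → ∀ (z₀ : (Fin d → ℤ) × (Fin k → ℤ)) (T₁ T₂' T₂o : Idx d)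
      (p p' : (Idx d × Idx d) × ((Fin d → ℤ) × (Fin k → ℤ))),
      ‖freq ρ T₁.1 - ν‖ ≤ r → ‖freq ρ p.1.1.1 - ν‖ ≤ r → ‖freq ρ p'.1.1.1 - ν‖ ≤ r →
      ‖freq ρ T₂'.1 - ν'‖ ≤ r → ‖freq ρ T₂o.1 - ν'‖ ≤ r →
      ‖freq ρ p.1.2.1 - ν'‖ ≤ r → ‖freq ρ p'.1.2.1 - ν'‖ ≤ r →
      ‖toR z₀.2‖ ≤ B * ρ → ‖toR p.2.2‖ ≤ B * ρ →
      ρ / κ ≤ max ‖toR p.2.1 - toR z₀.1‖ ‖toR p.2.2 - toR z₀.2‖ →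
      farInc Φ ρ κ A z₀ T₁ T₂' T₂o p → farInc Φ ρ κ A z₀ T₁ T₂' T₂o p' →
      (‖toR p'.1.1.1 - toR p.1.1.1‖ ≤ K * κ ^ 2 ∧ ‖toR p'.1.1.2 - toR p.1.1.2‖ ≤ K * κ ^ 2) ∧
      (‖toR p'.1.2.1 - toR p.1.2.1‖ ≤ K * κ ^ 2 ∧ ‖toR p'.1.2.2 - toR p.1.2.2‖ ≤ K * κ ^ 2) ∧
      ‖toR p'.2.1 - toR p.2.1‖ ≤ K * κ ^ 2 ∧ ‖toR p'.2.2 - toR p.2.2‖ ≤ K * κ ^ 2 := by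
  obtain ⟨r, c, hr, hc, hr1, hb⟩ := h.exists_ball hk hΦ
  obtain ⟨G, hG1, hGb, hGl, hGΦ⟩ := exists_gradT_bounds hΦ (‖ν‖ + ‖ν'‖ + 4)
  refine ⟨r, hr, hr1, fun A B hA hB => ?_⟩
  set K1 : ℝ := 6 + 4 * B * A * (G + 1) with hK1
  set K2 : ℝ := 2 * G * (K1 / c) with hK2
  have hK1p : 0 ≤ K1 := by positivity
  have hK2p : 0 ≤ K2 := by positivity
  refine ⟨2 * K2 + 4 * A + 2 + G * B * (K2 + 2 * A) + (1 + G) * (K1 / c), by positivity, ?_⟩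
  rintro ρ κ hκ hρκ ⟨x0, t0⟩ T₁ T₂' T₂o ⟨⟨⟨q1, v1⟩, ⟨q2, v2⟩⟩, ⟨x, t⟩⟩
    ⟨⟨⟨q1', v1'⟩, ⟨q2', v2'⟩⟩, ⟨x', t'⟩⟩ hf1 hf2 hf3 hf4 hf5 hf6 hf7 ht0 ht hfar
    ⟨i1, i2, i3, i4, i5⟩ ⟨j1, j2, j3, j4, j5⟩
  have hρ : 0 < ρ := by nlinarith
  simp only [inc, offset_gridPt hρ] at i1 i2 i4 i5 j1 j2 j4 j5
  simp only [quad] at i3 j3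
  simp only at hf2 hf3 hf6 hf7 ht0 ht hfar ⊢
  set ξb := freq ρ q1
  set ξ := freq ρ q1'
  set ηb := freq ρ q2
  set η := freq ρ q2'
  set ξ1 := freq ρ T₁.1
  set η2 := freq ρ T₂'.1
  set ξo := freq ρ T₂o.1
  set δ := η2 - ξ1 with hδ
  have hν : ∀ {y : Fin d → ℝ}, ‖y - ν‖ ≤ r → ‖y‖ ≤ ‖ν‖ + ‖ν'‖ + 4 := fun {y} hy => by
    have h1 := norm_le_norm_add_norm_sub' y ν
    have h2 := norm_nonneg ν'
    linarith
  have hν' : ∀ {y : Fin d → ℝ}, ‖y - ν'‖ ≤ 3 * r → ‖y‖ ≤ ‖ν‖ + ‖ν'‖ + 4 := fun {y} hy => by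
    have h1 := norm_le_norm_add_norm_sub' y ν'
    have h2 := norm_nonneg ν
    linarith
  have hδν : ‖δ - (ν' - ν)‖ ≤ 2 * r := by
    calc ‖δ - (ν' - ν)‖ = ‖(η2 - ν') - (ξ1 - ν)‖ := by rw [hδ]; congr 1; abel
      _ ≤ _ := (norm_sub_le _ _).trans (by linarith)
  have hshift : ∀ {y : Fin d → ℝ}, ‖y - ν‖ ≤ r → ‖y + δ - ν'‖ ≤ 3 * r := fun {y} hy => by
    calc ‖y + δ - ν'‖ = ‖(y - ν) + (δ - (ν' - ν))‖ := by congr 1; abel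
      _ ≤ _ := (norm_add_le _ _).trans (by linarith)
  have hquad : ∀ {y e : Fin d → ℝ}, ‖y - ν‖ ≤ r → ‖e - ν'‖ ≤ r →
      ‖(ξ1 + e) - (y + η2)‖ ≤ A / ρ → ‖(Φ ξ1 + Φ e) - (Φ y + Φ η2)‖ ≤ A / ρ →
      ‖e - (y + δ)‖ ≤ A / ρ ∧ ‖Φ (y + δ) - Φ y - (Φ η2 - Φ ξ1)‖ ≤ (G + 1) * (A / ρ) := by
    intro y e hy he a1 a2
    have a3 : ‖e - (y + δ)‖ ≤ A / ρ := by
      rw [hδ]; convert a1 using 2; abel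
    refine ⟨a3, ?_⟩
    have a4 : ‖Φ e - Φ (y + δ)‖ ≤ G * (A / ρ) :=
      (hGΦ _ _ (hν' (by linarith)) (hν' (hshift hy))).trans (by gcongr)
    calc _ = ‖((Φ ξ1 + Φ e) - (Φ y + Φ η2)) - (Φ e - Φ (y + δ))‖ := by congr 1; abel
      _ ≤ A / ρ + G * (A / ρ) := (norm_sub_le _ _).trans (add_le_add a2 a4)
      _ = _ := by ring
  obtain ⟨b1, b2⟩ := hquad hf2 hf6 i3.1 i3.2
  obtain ⟨b3, b4⟩ := hquad hf3 hf7 j3.1 j3.2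
  set σ := toR t' - toR t with hσ
  set τ := toR t - toR t0 with hτ
  have hcons : ∀ a b : Fin d → ℝ, ‖a‖ ≤ κ → ‖b‖ ≤ κ → ‖a - b‖ ≤ 2 * κ := fun a b ha hb' =>
    (norm_sub_le _ _).trans (by linarith)
  have m1 := hcons _ _ i4 i1
  have m2 := hcons _ _ j4 j1
  have m3 := hcons _ _ j5 i5
  have m4 := hcons _ _ j1 i1
  have m5 := hcons _ _ j2 i2
  have hσ1 : toR t' = σ + τ + toR t0 := by rw [hσ, hτ]; abel
  have hτ1 : toR t = τ + toR t0 := by rw [hτ]; abel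
  have hmain := hb ξ ξb ξo δ hf3 hf2 hf5 hδν σ τ
  have hn1 : ‖(gradT Φ ξ σ - gradT Φ ξo σ) + (gradT Φ ξ τ - gradT Φ ξb τ)‖ ≤ 6 * κ := by
    have e1 : (gradT Φ ξ σ - gradT Φ ξo σ) + (gradT Φ ξ τ - gradT Φ ξb τ) =
        ((toR x' + gradT Φ ξ (toR t') + toR v1') - (toR x0 + gradT Φ ξ (toR t0) + toR v1')) -
        ((toR x + gradT Φ ξb (toR t) + toR v1) - (toR x0 + gradT Φ ξb (toR t0) + toR v1)) -
        ((toR x' + gradT Φ ξo (toR t') + toR T₂o.2) - (toR x + gradT Φ ξo (toR t) + toR T₂o.2)) := by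
      rw [hσ1, hτ1]
      simp only [gradT_add]
      abel
    rw [e1]
    refine (norm_sub_le _ _).trans ((add_le_add (norm_sub_le _ _) le_rfl).trans ?_)
    linarith
  have hn2 : ‖(Φ (ξ + δ) - Φ (ξb + δ)) - (Φ ξ - Φ ξb)‖ ≤ 2 * ((G + 1) * (A / ρ)) := by
    have e1 : (Φ (ξ + δ) - Φ (ξb + δ)) - (Φ ξ - Φ ξb) =
        (Φ (ξ + δ) - Φ ξ - (Φ η2 - Φ ξ1)) - (Φ (ξb + δ) - Φ ξb - (Φ η2 - Φ ξ1)) := by abel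
    rw [e1]
    exact (norm_sub_le _ _).trans (by linarith)
  have hτB : ‖τ‖ ≤ 2 * (B * ρ) := (norm_sub_le _ _).trans (by linarith)
  have hn3 : ‖τ‖ * ‖(Φ (ξ + δ) - Φ (ξb + δ)) - (Φ ξ - Φ ξb)‖ ≤ 4 * B * A * (G + 1) := by
    calc _ ≤ 2 * (B * ρ) * (2 * ((G + 1) * (A / ρ))) := by gcongr
      _ = _ := by field_simp; ring
  have hn4 : ‖σ‖ + ‖τ‖ * ‖ξ - ξb‖ ≤ K1 / c * κ := by
    rw [div_mul_eq_mul_div, le_div_iff₀ hc, hK1]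
    have h0 : 0 ≤ 4 * B * A * (G + 1) := by positivity
    have h1 := le_mul_of_one_le_right h0 hκ
    rw [mul_comm, add_mul]
    linarith
  have hu0 := norm_nonneg (ξ - ξb)
  have hσκ : ‖σ‖ ≤ K1 / c * κ := by
    have : 0 ≤ ‖τ‖ * ‖ξ - ξb‖ := by positivity
    linarith
  have hτκ : ‖τ‖ * ‖ξ - ξb‖ ≤ K1 / c * κ := by linarith [norm_nonneg σ]
  have hτlow : ρ / (2 * κ) ≤ G * ‖τ‖ := by
    have e0 : ‖toR x - toR x0‖ ≤ G * ‖τ‖ + 2 * κ := by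
      have e1 : toR x - toR x0 = ((toR x + gradT Φ ξb (toR t) + toR v1) -
          (toR x0 + gradT Φ ξb (toR t0) + toR v1)) - gradT Φ ξb τ := by
        rw [hτ1, gradT_add]; abel
      rw [e1]
      exact (norm_sub_le _ _).trans (by linarith [hGb ξb (hν hf2) τ])
    have e2 : 2 * κ ≤ ρ / (2 * κ) := by rw [le_div_iff₀ (by positivity)]; nlinarith
    have e3 : ρ / κ = ρ / (2 * κ) + ρ / (2 * κ) := by field_simp; norm_num
    have e4 : ‖τ‖ ≤ G * ‖τ‖ := le_mul_of_one_le_left (norm_nonneg _) hG1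
    have e5 : 0 < ρ / (2 * κ) := by positivity
    rcases le_max_iff.1 hfar with h1 | h1
    · linarith
    · linarith
  have hu : ρ * ‖ξ - ξb‖ ≤ K2 * κ ^ 2 := by
    have e1 : ρ / (2 * κ) * ‖ξ - ξb‖ ≤ G * (K1 / c * κ) := by
      calc _ ≤ G * ‖τ‖ * ‖ξ - ξb‖ := by gcongr
        _ = G * (‖τ‖ * ‖ξ - ξb‖) := by ring
        _ ≤ _ := by gcongr
    calc ρ * ‖ξ - ξb‖ = 2 * κ * (ρ / (2 * κ) * ‖ξ - ξb‖) := by field_simp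
      _ ≤ 2 * κ * (G * (K1 / c * κ)) := by gcongr
      _ = _ := by rw [hK2]; ring
  have hη : ρ * ‖η - ηb‖ ≤ (K2 + 2 * A) * κ ^ 2 := by
    have e1 : ‖η - ηb‖ ≤ ‖ξ - ξb‖ + 2 * (A / ρ) := by
      have e2 : η - ηb = (ξ - ξb) + ((η - (ξ + δ)) - (ηb - (ξb + δ))) := by abel
      rw [e2]
      refine (norm_add_le _ _).trans (add_le_add le_rfl ((norm_sub_le _ _).trans (by linarith)))
    have e3 : ρ * (2 * (A / ρ)) = 2 * A := by field_simp
    have e4 : 1 ≤ κ ^ 2 := one_le_pow₀ hκ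
    have e5 : 2 * A ≤ 2 * A * κ ^ 2 := le_mul_of_one_le_right (by positivity) e4
    calc ρ * ‖η - ηb‖ ≤ ρ * (‖ξ - ξb‖ + 2 * (A / ρ)) := by gcongr
      _ = ρ * ‖ξ - ξb‖ + ρ * (2 * (A / ρ)) := by ring
      _ ≤ _ := by rw [e3]; linarith
  have hκ2 : κ ≤ κ ^ 2 := by nlinarith
  have hκ0 : 0 ≤ κ ^ 2 := by positivity
  have hvel : ∀ (a b : Fin d → ℝ) (M : ℝ), ‖a‖ ≤ ‖ν‖ + ‖ν'‖ + 4 → ‖b‖ ≤ ‖ν‖ + ‖ν'‖ + 4 →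
      ρ * ‖a - b‖ ≤ M * κ ^ 2 →
      ‖gradT Φ a (toR t0) - gradT Φ b (toR t0)‖ ≤ G * B * M * κ ^ 2 := by
    intro a b M ha hb' hab
    calc _ ≤ G * (‖a - b‖ * ‖toR t0‖) := hGl _ _ ha hb' _
      _ ≤ G * (‖a - b‖ * (B * ρ)) := by gcongr
      _ = G * B * (ρ * ‖a - b‖) := by ring
      _ ≤ G * B * (M * κ ^ 2) := by gcongr
      _ = _ := by ring
  have P1 : 0 ≤ K2 * κ ^ 2 := by positivity
  have P2 : 0 ≤ A * κ ^ 2 := by positivity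
  have P3 : 0 ≤ G * B * (K2 + 2 * A) * κ ^ 2 := by positivity
  have P4 : 0 ≤ (K1 / c) * κ ^ 2 := by positivity
  have P5 : 0 ≤ G * (K1 / c) * κ ^ 2 := by positivity
  have hσκ2 : ‖σ‖ ≤ K1 / c * κ ^ 2 := hσκ.trans (by gcongr)
  have hexp : (2 * K2 + 4 * A + 2 + G * B * (K2 + 2 * A) + (1 + G) * (K1 / c)) * κ ^ 2 =
      2 * (K2 * κ ^ 2) + 4 * (A * κ ^ 2) + 2 * κ ^ 2 + G * B * (K2 + 2 * A) * κ ^ 2 +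
      (K1 / c) * κ ^ 2 + G * (K1 / c) * κ ^ 2 := by ring
  rw [hexp]
  refine ⟨⟨?_, ?_⟩, ⟨?_, ?_⟩, ?_, ?_⟩
  · rw [norm_toR_sub_freq hρ]; linarith
  · have e1 : toR v1' - toR v1 = ((toR x0 + gradT Φ ξ (toR t0) + toR v1') -
        (toR x0 + gradT Φ ξb (toR t0) + toR v1)) -
        (gradT Φ ξ (toR t0) - gradT Φ ξb (toR t0)) := by abel
    have e2 := hvel ξ ξb K2 (hν hf3) (hν hf2) hu
    have e3 : G * B * K2 * κ ^ 2 ≤ G * B * (K2 + 2 * A) * κ ^ 2 := by gcongr; linarith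
    rw [e1]
    exact (norm_sub_le _ _).trans (by linarith)
  · rw [norm_toR_sub_freq hρ]; linarith
  · have e1 : toR v2' - toR v2 = ((toR x0 + gradT Φ η (toR t0) + toR v2') -
        (toR x0 + gradT Φ ηb (toR t0) + toR v2)) -
        (gradT Φ η (toR t0) - gradT Φ ηb (toR t0)) := by abel
    have e2 := hvel η ηb (K2 + 2 * A) (hν' (by linarith)) (hν' (by linarith)) hη
    rw [e1]
    exact (norm_sub_le _ _).trans (by linarith)
  · have e1 : toR x' - toR x = ((toR x' + gradT Φ ξo (toR t') + toR T₂o.2) -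
        (toR x + gradT Φ ξo (toR t) + toR T₂o.2)) - gradT Φ ξo σ := by
      rw [hσ, gradT_sub]; abel
    have e2 := hGb ξo (hν' (by linarith)) σ
    have e3 : G * ‖σ‖ ≤ G * (K1 / c) * κ ^ 2 := by
      rw [mul_assoc]; gcongr
    rw [e1]
    exact (norm_sub_le _ _).trans (by linarith)
  · linarith

open Classical in
lemma TransCond.exists_count (hk : 1 ≤ k) {Φ : (Fin d → ℝ) → Fin k → ℝ}
    (hΦ : ContDiff ℝ (⊤ : ℕ∞) Φ) {ν ν' : Fin d → ℝ} (h : TransCond Φ ν ν') :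
    ∃ r : ℝ, 0 < r ∧ r ≤ 1 ∧ ∀ A B : ℝ, 0 ≤ A → 0 ≤ B → ∃ C : ℝ, 0 ≤ C ∧ ∀ ρ κ : ℝ, 1 ≤ κ →
      4 * κ ^ 2 ≤ ρ → ∀ 𝕋₁ 𝕋₂ : Finset (Idx d), (∀ T ∈ 𝕋₁, ‖freq ρ T.1 - ν‖ ≤ r) →
      (∀ T ∈ 𝕋₂, ‖freq ρ T.1 - ν'‖ ≤ r) → ∀ Z : Finset ((Fin d → ℤ) × (Fin k → ℤ)),
      (∀ z ∈ Z, ‖toR z.2‖ ≤ B * ρ) → ∀ z₀ : (Fin d → ℤ) × (Fin k → ℤ), ‖toR z₀.2‖ ≤ B * ρ →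
      (∀ z ∈ Z, ρ / κ ≤ max ‖toR z.1 - toR z₀.1‖ ‖toR z.2 - toR z₀.2‖) →
      ∀ T₁ ∈ 𝕋₁, ∀ T₂' ∈ 𝕋₂, ∀ T₂o ∈ 𝕋₂,
      ((((𝕋₁ ×ˢ 𝕋₂) ×ˢ Z).filter (farInc Φ ρ κ A z₀ T₁ T₂' T₂o)).card : ℝ) ≤
        C * κ ^ (2 * (5 * d + k)) := by
  obtain ⟨r, hr, hr1, H⟩ := h.exists_close hk hΦ
  refine ⟨r, hr, hr1, fun A B hA hB => ?_⟩
  obtain ⟨K, hK, H⟩ := H A B hA hB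
  refine ⟨(2 * K + 1) ^ (5 * d + k), by positivity, ?_⟩
  intro ρ κ hκ hρκ 𝕋₁ 𝕋₂ h1 h2 Z hZ z₀ hz₀ hfar T₁ hT₁ T₂' hT₂' T₂o hT₂o
  rcases Finset.eq_empty_or_nonempty
    (((𝕋₁ ×ˢ 𝕋₂) ×ˢ Z).filter (farInc Φ ρ κ A z₀ T₁ T₂' T₂o)) with he | ⟨p, hp⟩
  · rw [he]; simp; positivity
  have hmem : ∀ {p}, p ∈ ((𝕋₁ ×ˢ 𝕋₂) ×ˢ Z).filter (farInc Φ ρ κ A z₀ T₁ T₂' T₂o) →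
      p.1.1 ∈ 𝕋₁ ∧ p.1.2 ∈ 𝕋₂ ∧ p.2 ∈ Z ∧ farInc Φ ρ κ A z₀ T₁ T₂' T₂o p := by
    intro p hp
    simp only [Finset.mem_filter, Finset.mem_product] at hp
    exact ⟨hp.1.1.1, hp.1.1.2, hp.1.2, hp.2⟩
  obtain ⟨p1, p2, p3, p4⟩ := hmem hp
  set E : ℝ := K * κ ^ 2
  have hE : 0 ≤ E := by positivity
  have hsub : ((𝕋₁ ×ˢ 𝕋₂) ×ˢ Z).filter (farInc Φ ρ κ A z₀ T₁ T₂' T₂o) ⊆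
      ((intBall p.1.1.1 E ×ˢ intBall p.1.1.2 E) ×ˢ (intBall p.1.2.1 E ×ˢ intBall p.1.2.2 E)) ×ˢ
        (intBall p.2.1 E ×ˢ intBall p.2.2 E) := by
    intro p' hp'
    obtain ⟨p1', p2', p3', p4'⟩ := hmem hp'
    have := H ρ κ hκ hρκ z₀ T₁ T₂' T₂o p p' (h1 _ hT₁) (h1 _ p1) (h1 _ p1') (h2 _ hT₂') (h2 _ hT₂o)
      (h2 _ p2) (h2 _ p2') hz₀ (hZ _ p3) (hfar _ p3) p4 p4'
    obtain ⟨a1, a2, a3⟩ := this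
    simp only [Finset.mem_product, mem_intBall hE]
    exact ⟨⟨a1, a2⟩, a3⟩
  have hcard := Finset.card_le_card hsub
  simp only [Finset.card_product] at hcard
  have hcard' : ((((𝕋₁ ×ˢ 𝕋₂) ×ˢ Z).filter (farInc Φ ρ κ A z₀ T₁ T₂' T₂o)).card : ℝ) ≤
      (2 * E + 1) ^ d * (2 * E + 1) ^ d * ((2 * E + 1) ^ d * (2 * E + 1) ^ d) *
        ((2 * E + 1) ^ d * (2 * E + 1) ^ k) := by
    refine (Nat.cast_le.2 hcard).trans ?_
    push_cast
    gcongr <;> exact card_intBall_le _ hE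
  refine hcard'.trans ?_
  have h3 : 2 * E + 1 ≤ (2 * K + 1) * κ ^ 2 := by
    have : 1 ≤ κ ^ 2 := one_le_pow₀ hκ
    simp only [E]; linarith
  calc _ = (2 * E + 1) ^ (5 * d + k) := by ring
    _ ≤ ((2 * K + 1) * κ ^ 2) ^ (5 * d + k) := by gcongr
    _ = _ := by rw [mul_pow, ← pow_mul]

end Counting

section Weights

variable {α β ζ : Type*}

/-- The weighted number of second-family tubes met by `a` along the points of `G`. -/
def massAlong (G : Finset ζ) (𝕋₂ : Finset β) (i₁ : α → ζ → ℝ) (i₂ : β → ζ → ℝ) (n₂ : β → ℝ) (a : α) :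
    ℝ :=
  ∑ z ∈ G, ∑ b ∈ 𝕋₂, i₁ a z * i₂ b z * n₂ b ^ 2

lemma massAlong_nonneg (G : Finset ζ) (𝕋₂ : Finset β) {i₁ : α → ζ → ℝ} {i₂ : β → ζ → ℝ} (n₂ : β → ℝ)
    (h1 : ∀ a z, 0 ≤ i₁ a z) (h2 : ∀ b z, 0 ≤ i₂ b z) (a : α) : 0 ≤ massAlong G 𝕋₂ i₁ i₂ n₂ a :=
  Finset.sum_nonneg fun z _ => Finset.sum_nonneg fun b _ =>
    mul_nonneg (mul_nonneg (h1 a z) (h2 b z)) (sq_nonneg _)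

lemma massAlong_mono {G G' : Finset ζ} (hG : G' ⊆ G) (𝕋₂ : Finset β) {i₁ : α → ζ → ℝ}
    {i₂ : β → ζ → ℝ} (n₂ : β → ℝ) (h1 : ∀ a z, 0 ≤ i₁ a z) (h2 : ∀ b z, 0 ≤ i₂ b z) (a : α) :
    massAlong G' 𝕋₂ i₁ i₂ n₂ a ≤ massAlong G 𝕋₂ i₁ i₂ n₂ a :=
  Finset.sum_le_sum_of_subset_of_nonneg hG fun z _ _ => Finset.sum_nonneg fun b _ =>
    mul_nonneg (mul_nonneg (h1 a z) (h2 b z)) (sq_nonneg _)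

lemma two_mul_weight_le {m m' M M' X Y : ℝ} (hM : 0 ≤ M) (hM' : 0 ≤ M') (h : M ≤ m) (h' : M' ≤ m') :
    2 * (M / m * (M' / m') * (X * Y)) ≤ X ^ 2 * (M' / m) + Y ^ 2 * (M / m') := by
  have hm : 0 ≤ m := hM.trans h
  have hm' : 0 ≤ m' := hM'.trans h'
  rcases hm.eq_or_lt with h0 | h0
  · rw [← h0]; simp; positivity
  rcases hm'.eq_or_lt with h0' | h0'
  · rw [← h0']; simp; positivity
  have e1 : X ^ 2 * (M' / m) + Y ^ 2 * (M / m') - 2 * (M / m * (M' / m') * (X * Y)) =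
      ((X * M' - Y * M) ^ 2 + X ^ 2 * M' * (m' - M') + Y ^ 2 * M * (m - M)) / (m * m') := by
    field_simp; ring
  have e2 : 0 ≤ ((X * M' - Y * M) ^ 2 + X ^ 2 * M' * (m' - M') + Y ^ 2 * M * (m - M)) / (m * m') := by
    have a1 : 0 ≤ m' - M' := by linarith
    have a2 : 0 ≤ m - M := by linarith
    positivity
  linarith

lemma sum_far_interaction_le {𝕋₁ : Finset α} {𝕋₂ : Finset β} {G Zf Z' : Finset ζ} (hZf : Zf ⊆ G)
    (hZ' : Z' ⊆ G) {i₁ : α → ζ → ℝ} {i₂ : β → ζ → ℝ} {q : α × β → α × β → ℝ}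
    (hi1 : ∀ a z, 0 ≤ i₁ a z) (hi2 : ∀ b z, 0 ≤ i₂ b z) (hq : ∀ x y, 0 ≤ q x y)
    (hqs : ∀ x y, q x y = q y x) {n₁ e₁ : α → ℝ} {n₂ e₂ : β → ℝ} (he1 : ∀ a, 0 ≤ e₁ a)
    (he2 : ∀ b, 0 ≤ e₂ b) (hn1 : ∀ a, e₁ a ≤ n₁ a) (hn2 : ∀ b, e₂ b ≤ n₂ b)
    (hw : ∀ a ∈ 𝕋₁, massAlong G 𝕋₂ i₁ i₂ n₂ a * e₁ a ≤ massAlong Zf 𝕋₂ i₁ i₂ n₂ a * n₁ a)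
    {K : ℝ} (hK0 : 0 ≤ K) (hK : ∀ z₀ ∈ Z', ∀ a ∈ 𝕋₁, ∀ b' ∈ 𝕋₂, ∀ o ∈ 𝕋₂,
      ∑ a' ∈ 𝕋₁, ∑ b ∈ 𝕋₂, ∑ z ∈ Zf,
        i₁ a' z₀ * i₂ b z₀ * q (a, b) (a', b') * (i₁ a' z * i₂ o z) ≤ K) :
    ∑ z ∈ Z', ∑ x ∈ 𝕋₁ ×ˢ 𝕋₂, ∑ y ∈ 𝕋₁ ×ˢ 𝕋₂,
      (i₁ x.1 z * i₂ x.2 z) * (i₁ y.1 z * i₂ y.2 z) * q x y *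
        (e₁ x.1 * e₂ x.2 * (e₁ y.1 * e₂ y.2)) ≤
      K * (∑ a ∈ 𝕋₁, n₁ a ^ 2) * ∑ b ∈ 𝕋₂, n₂ b ^ 2 := by
  set m := massAlong G 𝕋₂ i₁ i₂ n₂ with hm
  set M := massAlong Zf 𝕋₂ i₁ i₂ n₂ with hM
  have hn1' : ∀ a, 0 ≤ n₁ a := fun a => (he1 a).trans (hn1 a)
  have hn2' : ∀ b, 0 ≤ n₂ b := fun b => (he2 b).trans (hn2 b)
  have hM0 : ∀ a, 0 ≤ M a := massAlong_nonneg Zf 𝕋₂ n₂ hi1 hi2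
  have hMm : ∀ a, M a ≤ m a := massAlong_mono hZf 𝕋₂ n₂ hi1 hi2
  have hm0 : ∀ a, 0 ≤ m a := fun a => (hM0 a).trans (hMm a)
  -- a far coefficient is controlled by the ratio `M / m`
  have hfac : ∀ z ∈ Z', ∀ x ∈ 𝕋₁ ×ˢ 𝕋₂, (i₁ x.1 z * i₂ x.2 z) * (e₁ x.1 * e₂ x.2) ≤
      (i₁ x.1 z * i₂ x.2 z) * (M x.1 / m x.1 * (n₁ x.1 * n₂ x.2)) := by
    rintro z hz ⟨a, b⟩ hx
    obtain ⟨ha, hb⟩ := Finset.mem_product.1 hx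
    simp only at ha hb ⊢
    have hii : 0 ≤ i₁ a z * i₂ b z := mul_nonneg (hi1 a z) (hi2 b z)
    rcases (hm0 a).eq_or_lt with h0 | h0
    · have h1 : i₁ a z * i₂ b z * n₂ b ^ 2 ≤ m a := by
        refine le_trans ?_ (Finset.single_le_sum (f := fun z => ∑ b ∈ 𝕋₂, i₁ a z * i₂ b z * n₂ b ^ 2)
          (fun z _ => Finset.sum_nonneg fun b _ =>
            mul_nonneg (mul_nonneg (hi1 a z) (hi2 b z)) (sq_nonneg _)) (hZ' hz))
        exact Finset.single_le_sum (f := fun b => i₁ a z * i₂ b z * n₂ b ^ 2)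
          (fun b _ => mul_nonneg (mul_nonneg (hi1 a z) (hi2 b z)) (sq_nonneg _)) hb
      rw [← h0] at h1
      have h2 : i₁ a z * i₂ b z * n₂ b ^ 2 = 0 := le_antisymm h1 (mul_nonneg hii (sq_nonneg _))
      rcases mul_eq_zero.1 h2 with h3 | h3
      · rw [h3]; simp
      · have h4 : n₂ b = 0 := by simpa using h3
        have h5 : e₂ b = 0 := le_antisymm (h4 ▸ hn2 b) (he2 b)
        rw [h4, h5]; simp
    · refine mul_le_mul_of_nonneg_left ?_ hii
      have h1 : e₁ a ≤ M a / m a * n₁ a := by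
        rw [div_mul_eq_mul_div, le_div_iff₀ h0, mul_comm]
        exact hw a ha
      calc e₁ a * e₂ b ≤ M a / m a * n₁ a * n₂ b :=
            mul_le_mul h1 (hn2 b) (he2 b) ((he1 a).trans h1)
        _ = _ := by ring
  set W : ζ → α × β → α × β → ℝ := fun z x y => (i₁ x.1 z * i₂ x.2 z) * (i₁ y.1 z * i₂ y.2 z) * q x y
    with hW
  have hW0 : ∀ z x y, 0 ≤ W z x y := fun z x y => mul_nonneg (mul_nonneg
    (mul_nonneg (hi1 _ _) (hi2 _ _)) (mul_nonneg (hi1 _ _) (hi2 _ _))) (hq _ _)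
  set f : ζ → α × β → α × β → ℝ := fun z x y => W z x y * ((n₁ x.1 * n₂ y.2) ^ 2 * (M y.1 / m x.1))
    with hf
  have hterm : ∀ z ∈ Z', ∀ x ∈ 𝕋₁ ×ˢ 𝕋₂, ∀ y ∈ 𝕋₁ ×ˢ 𝕋₂,
      W z x y * (e₁ x.1 * e₂ x.2 * (e₁ y.1 * e₂ y.2)) ≤ (f z x y + f z y x) / 2 := by
    intro z hz x hx y hy
    have h1 := mul_le_mul (hfac z hz x hx) (hfac z hz y hy)
      (mul_nonneg (mul_nonneg (hi1 _ _) (hi2 _ _)) (mul_nonneg (he1 _) (he2 _)))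
      (mul_nonneg (mul_nonneg (hi1 _ _) (hi2 _ _)) (mul_nonneg (div_nonneg (hM0 _) (hm0 _))
        (mul_nonneg (hn1' _) (hn2' _))))
    have h2 := mul_le_mul_of_nonneg_right h1 (hq x y)
    have h3 := mul_le_mul_of_nonneg_left (two_mul_weight_le (X := n₁ x.1 * n₂ y.2)
      (Y := n₁ y.1 * n₂ x.2) (hM0 x.1) (hM0 y.1) (hMm x.1) (hMm y.1)) (hW0 z x y)
    have h4 : W z y x = W z x y := by simp only [hW]; rw [hqs y x]; ring
    simp only [hf, h4]
    simp only [hW] at h3 ⊢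
    linarith
  have hinner : ∀ z ∈ Z', ∀ a ∈ 𝕋₁, ∀ b' ∈ 𝕋₂,
      ∑ a' ∈ 𝕋₁, ∑ b ∈ 𝕋₂, i₁ a' z * i₂ b z * q (a, b) (a', b') * M a' ≤ K * ∑ o ∈ 𝕋₂, n₂ o ^ 2 := by
    intro z hz a ha b' hb'
    have e1 : ∑ a' ∈ 𝕋₁, ∑ b ∈ 𝕋₂, i₁ a' z * i₂ b z * q (a, b) (a', b') * M a' =
        ∑ o ∈ 𝕋₂, (∑ a' ∈ 𝕋₁, ∑ b ∈ 𝕋₂, ∑ z' ∈ Zf,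
          i₁ a' z * i₂ b z * q (a, b) (a', b') * (i₁ a' z' * i₂ o z')) * n₂ o ^ 2 := by
      simp only [hM, massAlong, Finset.mul_sum, Finset.sum_mul]
      rw [Finset.sum_comm (s := 𝕋₂) (t := 𝕋₁)]
      refine Finset.sum_congr rfl fun a' _ => ?_
      rw [Finset.sum_comm (s := 𝕋₂) (t := 𝕋₂)]
      refine Finset.sum_congr rfl fun b _ => ?_
      rw [Finset.sum_comm]
      refine Finset.sum_congr rfl fun o _ => Finset.sum_congr rfl fun z' _ => ?_
      ring
    rw [e1, Finset.mul_sum]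
    exact Finset.sum_le_sum fun o ho => mul_le_mul_of_nonneg_right (hK z hz a ha b' hb' o ho)
      (sq_nonneg _)
  set N₂ := ∑ o ∈ 𝕋₂, n₂ o ^ 2 with hN2
  have hN20 : 0 ≤ N₂ := Finset.sum_nonneg fun _ _ => sq_nonneg _
  calc _ ≤ ∑ z ∈ Z', ∑ x ∈ 𝕋₁ ×ˢ 𝕋₂, ∑ y ∈ 𝕋₁ ×ˢ 𝕋₂, (f z x y + f z y x) / 2 :=
        Finset.sum_le_sum fun z hz => Finset.sum_le_sum fun x hx => Finset.sum_le_sum fun y hy =>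
          hterm z hz x hx y hy
    _ = ∑ z ∈ Z', ∑ x ∈ 𝕋₁ ×ˢ 𝕋₂, ∑ y ∈ 𝕋₁ ×ˢ 𝕋₂, f z x y := by
        refine Finset.sum_congr rfl fun z _ => ?_
        simp only [← Finset.sum_div, Finset.sum_add_distrib]
        rw [Finset.sum_comm (f := fun x y => f z y x)]
        ring
    _ = ∑ z ∈ Z', ∑ a ∈ 𝕋₁, ∑ b' ∈ 𝕋₂, n₁ a ^ 2 / m a * (i₁ a z * i₂ b' z * n₂ b' ^ 2) *
          ∑ a' ∈ 𝕋₁, ∑ b ∈ 𝕋₂, i₁ a' z * i₂ b z * q (a, b) (a', b') * M a' := by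
        refine Finset.sum_congr rfl fun z _ => ?_
        simp only [Finset.sum_product, Finset.mul_sum]
        refine Finset.sum_congr rfl fun a _ => ?_
        rw [Finset.sum_comm]
        conv_rhs => rw [Finset.sum_comm]
        refine Finset.sum_congr rfl fun a' _ => ?_
        rw [Finset.sum_comm]
        refine Finset.sum_congr rfl fun b' _ => Finset.sum_congr rfl fun b _ => ?_
        simp only [hf, hW]
        ring
    _ ≤ ∑ z ∈ Z', ∑ a ∈ 𝕋₁, ∑ b' ∈ 𝕋₂, n₁ a ^ 2 / m a * (i₁ a z * i₂ b' z * n₂ b' ^ 2) *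
          (K * N₂) :=
        Finset.sum_le_sum fun z hz => Finset.sum_le_sum fun a ha => Finset.sum_le_sum fun b' hb' =>
          mul_le_mul_of_nonneg_left (hinner z hz a ha b' hb') (mul_nonneg
            (div_nonneg (sq_nonneg _) (hm0 a))
            (mul_nonneg (mul_nonneg (hi1 _ _) (hi2 _ _)) (sq_nonneg _)))
    _ = ∑ a ∈ 𝕋₁, n₁ a ^ 2 / m a * massAlong Z' 𝕋₂ i₁ i₂ n₂ a * (K * N₂) := by
        rw [Finset.sum_comm]
        simp only [massAlong, Finset.mul_sum, Finset.sum_mul]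
    _ ≤ ∑ a ∈ 𝕋₁, n₁ a ^ 2 * (K * N₂) := by
        refine Finset.sum_le_sum fun a _ => mul_le_mul_of_nonneg_right ?_ (mul_nonneg hK0 hN20)
        rcases (hm0 a).eq_or_lt with h0 | h0
        · rw [← h0]; simp; positivity
        · rw [div_mul_eq_mul_div, div_le_iff₀ h0]
          exact mul_le_mul_of_nonneg_left (massAlong_mono hZ' 𝕋₂ n₂ hi1 hi2 a) (sq_nonneg _)
    _ = _ := by rw [← Finset.sum_mul]; ring

end Weights

section FarEstimate

variable {d k : ℕ}

open Classical in
/-- Indicator of incidence between a wave packet and a grid ball. -/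
def incI (Φ : (Fin d → ℝ) → Fin k → ℝ) (ρ κ : ℝ) (T : Idx d) (z : (Fin d → ℤ) × (Fin k → ℤ)) : ℝ :=
  if inc Φ ρ κ T z then 1 else 0

open Classical in
/-- Indicator of almost resonant quadruples. -/
def quadI (Φ : (Fin d → ℝ) → Fin k → ℝ) (ρ A : ℝ) (x y : Idx d × Idx d) : ℝ :=
  if quad Φ ρ A x y then 1 else 0

lemma incI_nonneg (Φ : (Fin d → ℝ) → Fin k → ℝ) (ρ κ : ℝ) (T : Idx d)
    (z : (Fin d → ℤ) × (Fin k → ℤ)) : 0 ≤ incI Φ ρ κ T z := by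
  rw [incI]; split_ifs <;> norm_num

lemma quadI_nonneg (Φ : (Fin d → ℝ) → Fin k → ℝ) (ρ A : ℝ) (x y : Idx d × Idx d) :
    0 ≤ quadI Φ ρ A x y := by
  rw [quadI]; split_ifs <;> norm_num

lemma quadI_comm (Φ : (Fin d → ℝ) → Fin k → ℝ) (ρ A : ℝ) (x y : Idx d × Idx d) :
    quadI Φ ρ A x y = quadI Φ ρ A y x := by
  have h : quad Φ ρ A x y ↔ quad Φ ρ A y x := ⟨quad_symm, quad_symm⟩
  by_cases hq : quad Φ ρ A x y
  · simp [quadI, hq, h.1 hq]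
  · simp [quadI, hq, mt h.2 hq]

open Classical in
lemma lintegral_wp_inc_mul_sq_le {Φ : (Fin d → ℝ) → Fin k → ℝ} (hΦ : ContDiff ℝ (⊤ : ℕ∞) Φ) (B : ℝ) :
    ∃ A C : ℝ, 0 ≤ A ∧ 0 ≤ C ∧ ∀ ρ κ : ℝ, 1 ≤ ρ → ∀ (𝕋₁ 𝕋₂ : Finset (Idx d)) (c₁ c₂ : Idx d → ℂ),
      (∀ T ∈ 𝕋₁, ‖freq ρ T.1‖ ≤ B) → (∀ T ∈ 𝕋₂, ‖freq ρ T.1‖ ≤ B) →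
      ∀ z : (Fin d → ℤ) × (Fin k → ℤ),
      ∫⁻ w in Metric.closedBall (gridPt ρ z) ρ,
        ‖wp Φ ρ (𝕋₁.filter fun T => inc Φ ρ κ T z) c₁ w *
          wp Φ ρ (𝕋₂.filter fun T => inc Φ ρ κ T z) c₂ w‖ₑ ^ 2 ≤
        ENNReal.ofReal (C * (ρ ^ k / ρ ^ d) * ∑ x ∈ 𝕋₁ ×ˢ 𝕋₂, ∑ y ∈ 𝕋₁ ×ˢ 𝕋₂,
          (incI Φ ρ κ x.1 z * incI Φ ρ κ x.2 z) * (incI Φ ρ κ y.1 z * incI Φ ρ κ y.2 z) *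
            quadI Φ ρ A x y * (‖c₁ x.1‖ * ‖c₂ x.2‖ * (‖c₁ y.1‖ * ‖c₂ y.2‖))) := by
  obtain ⟨A, C, hA, hC, H⟩ := lintegral_wp_mul_sq_le hΦ B
  refine ⟨A, C, hA, hC, fun ρ κ hρ 𝕋₁ 𝕋₂ c₁ c₂ h1 h2 z => ?_⟩
  refine (H ρ hρ _ _ c₁ c₂ (fun T hT => h1 T (Finset.mem_filter.1 hT).1)
    (fun T hT => h2 T (Finset.mem_filter.1 hT).1) _).trans (le_of_eq ?_)
  congr 2
  rw [← Finset.filter_product, Finset.sum_filter]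
  refine Finset.sum_congr rfl fun x _ => ?_
  rw [Finset.sum_filter]
  by_cases hx1 : inc Φ ρ κ x.1 z <;> by_cases hx2 : inc Φ ρ κ x.2 z <;>
    simp only [hx1, hx2, incI, and_true, and_false, if_true, if_false, mul_zero, zero_mul,
      Finset.sum_const_zero, and_self]
  refine Finset.sum_congr rfl fun y _ => ?_
  by_cases hy1 : inc Φ ρ κ y.1 z <;> by_cases hy2 : inc Φ ρ κ y.2 z <;> 
    by_cases hq : quad Φ ρ A x y <;> simp [hy1, hy2, quadI, hq]

open Classical in
/-- Total contribution of the incident far wave packets. -/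
lemma TransCond.exists_sum_inc_le (hk : 1 ≤ k) {Φ : (Fin d → ℝ) → Fin k → ℝ}
    (hΦ : ContDiff ℝ (⊤ : ℕ∞) Φ) {ν ν' : Fin d → ℝ} (h : TransCond Φ ν ν') :
    ∃ r : ℝ, 0 < r ∧ r ≤ 1 ∧ ∀ B : ℝ, 0 ≤ B → ∃ C : ℝ, 0 ≤ C ∧ ∀ ρ κ : ℝ, 1 ≤ κ →
      4 * κ ^ 2 ≤ ρ → ∀ 𝕋₁ 𝕋₂ : Finset (Idx d), (∀ T ∈ 𝕋₁, ‖freq ρ T.1 - ν‖ ≤ r) →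
      (∀ T ∈ 𝕋₂, ‖freq ρ T.1 - ν'‖ ≤ r) → (∀ T ∈ 𝕋₁, ‖freq ρ T.1‖ ≤ B) →
      (∀ T ∈ 𝕋₂, ‖freq ρ T.1‖ ≤ B) → ∀ G Zf Z' : Finset ((Fin d → ℤ) × (Fin k → ℤ)),
      (∀ z ∈ G, ‖toR z.2‖ ≤ B * ρ) → Zf ⊆ G → Z' ⊆ G →
      (∀ z ∈ Zf, ∀ z₀ ∈ Z', ρ / κ ≤ max ‖toR z.1 - toR z₀.1‖ ‖toR z.2 - toR z₀.2‖) →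
      ∀ c₁ c₂ e₁ e₂ : Idx d → ℂ, (∀ T, ‖e₁ T‖ ≤ ‖c₁ T‖) → (∀ T, ‖e₂ T‖ ≤ ‖c₂ T‖) →
      (∀ T ∈ 𝕋₁, massAlong G 𝕋₂ (incI Φ ρ κ) (incI Φ ρ κ) (fun T => ‖c₂ T‖) T * ‖e₁ T‖ ≤
        massAlong Zf 𝕋₂ (incI Φ ρ κ) (incI Φ ρ κ) (fun T => ‖c₂ T‖) T * ‖c₁ T‖) →
      ∑ z ∈ Z', ∫⁻ w in Metric.closedBall (gridPt ρ z) ρ,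
        ‖wp Φ ρ (𝕋₁.filter fun T => inc Φ ρ κ T z) e₁ w *
          wp Φ ρ (𝕋₂.filter fun T => inc Φ ρ κ T z) e₂ w‖ₑ ^ 2 ≤
        ENNReal.ofReal (C * (ρ ^ k / ρ ^ d) * κ ^ (2 * (5 * d + k)) *
          ((∑ T ∈ 𝕋₁, ‖c₁ T‖ ^ 2) * ∑ T ∈ 𝕋₂, ‖c₂ T‖ ^ 2)) := by
  obtain ⟨r, hr, hr1, H⟩ := h.exists_count hk hΦ
  refine ⟨r, hr, hr1, fun B hB => ?_⟩
  obtain ⟨A, C, hA, hC, H2⟩ := lintegral_wp_inc_mul_sq_le (d := d) (k := k) hΦ B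
  obtain ⟨K, hK, H⟩ := H A B hA hB
  refine ⟨C * K, by positivity, ?_⟩
  intro ρ κ hκ hρκ 𝕋₁ 𝕋₂ h1 h2 h1' h2' G Zf Z' hG hZf hZ' hfar c₁ c₂ e₁ e₂ hc1 hc2 hw
  have hρ : 1 ≤ ρ := by nlinarith
  have hnn : ∀ z, 0 ≤ ∑ x ∈ 𝕋₁ ×ˢ 𝕋₂, ∑ y ∈ 𝕋₁ ×ˢ 𝕋₂,
      (incI Φ ρ κ x.1 z * incI Φ ρ κ x.2 z) * (incI Φ ρ κ y.1 z * incI Φ ρ κ y.2 z) *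
        quadI Φ ρ A x y * (‖e₁ x.1‖ * ‖e₂ x.2‖ * (‖e₁ y.1‖ * ‖e₂ y.2‖)) := fun z =>
    Finset.sum_nonneg fun x _ => Finset.sum_nonneg fun y _ => by
      have := incI_nonneg Φ ρ κ x.1 z
      have := incI_nonneg Φ ρ κ x.2 z
      have := incI_nonneg Φ ρ κ y.1 z
      have := incI_nonneg Φ ρ κ y.2 z
      have := quadI_nonneg Φ ρ A x y
      positivity
  refine (Finset.sum_le_sum fun z _ => H2 ρ κ hρ 𝕋₁ 𝕋₂ e₁ e₂ h1' h2' z).trans ?_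
  rw [← ENNReal.ofReal_sum_of_nonneg fun z _ => mul_nonneg (by positivity) (hnn z),
    ← Finset.mul_sum]
  refine ENNReal.ofReal_le_ofReal ?_
  have key := sum_far_interaction_le (𝕋₁ := 𝕋₁) (𝕋₂ := 𝕋₂) hZf hZ' (incI_nonneg Φ ρ κ)
    (incI_nonneg Φ ρ κ) (quadI_nonneg Φ ρ A) (quadI_comm Φ ρ A) (n₁ := fun T => ‖c₁ T‖)
    (e₁ := fun T => ‖e₁ T‖) (n₂ := fun T => ‖c₂ T‖) (e₂ := fun T => ‖e₂ T‖)
    (fun _ => norm_nonneg _) (fun _ => norm_nonneg _) hc1 hc2 hw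
    (K := K * κ ^ (2 * (5 * d + k))) (by positivity) ?_
  · calc _ ≤ C * (ρ ^ k / ρ ^ d) * (K * κ ^ (2 * (5 * d + k)) * (∑ T ∈ 𝕋₁, ‖c₁ T‖ ^ 2) *
        ∑ T ∈ 𝕋₂, ‖c₂ T‖ ^ 2) := mul_le_mul_of_nonneg_left key (by positivity)
      _ = _ := by ring
  · intro z₀ hz₀ a ha b' hb' o ho
    refine le_trans (le_of_eq ?_) (H ρ κ hκ hρκ 𝕋₁ 𝕋₂ h1 h2 Zf (fun z hz => hG z (hZf hz)) z₀
      (hG z₀ (hZ' hz₀)) (fun z hz => hfar z hz z₀ hz₀) a ha b' hb' o ho)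
    rw [Finset.card_filter, Nat.cast_sum, Finset.sum_product, Finset.sum_product]
    refine Finset.sum_congr rfl fun a' _ => Finset.sum_congr rfl fun b _ =>
      Finset.sum_congr rfl fun z _ => ?_
    simp only [farInc, incI, quadI]
    by_cases p1 : inc Φ ρ κ a' z₀ <;> by_cases p2 : inc Φ ρ κ b z₀ <;>
      by_cases p3 : quad Φ ρ A (a, b) (a', b') <;> by_cases p4 : inc Φ ρ κ a' z <;>
      by_cases p5 : inc Φ ρ κ o z <;> simp [p1, p2, p3, p4, p5]

open Classical in
lemma wp_filter_add (Φ : (Fin d → ℝ) → Fin k → ℝ) (ρ : ℝ) (𝕋 : Finset (Idx d)) (c : Idx d → ℂ)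
    (P : Idx d → Prop) (w : (Fin d → ℝ) × (Fin k → ℝ)) :
    wp Φ ρ 𝕋 c w = wp Φ ρ (𝕋.filter P) c w + wp Φ ρ (𝕋.filter fun T => ¬ P T) c w := by
  simp only [wp]
  exact (Finset.sum_filter_add_sum_filter_not 𝕋 P _).symm

lemma enorm_add_three_sq_le (a b c : ℂ) :
    ‖a + b + c‖ₑ ^ 2 ≤ 3 * (‖a‖ₑ ^ 2 + ‖b‖ₑ ^ 2 + ‖c‖ₑ ^ 2) := by
  have h : ‖a + b + c‖ ^ 2 ≤ 3 * (‖a‖ ^ 2 + ‖b‖ ^ 2 + ‖c‖ ^ 2) := by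
    have h1 := norm_add₃_le (a := a) (b := b) (c := c)
    have h0 := norm_nonneg (a + b + c)
    nlinarith [sq_nonneg (‖a‖ - ‖b‖), sq_nonneg (‖a‖ - ‖c‖), sq_nonneg (‖b‖ - ‖c‖)]
  have h2 := ENNReal.ofReal_le_ofReal h
  rw [ENNReal.ofReal_mul (by norm_num), ENNReal.ofReal_add (by positivity) (by positivity),
    ENNReal.ofReal_add (by positivity) (by positivity), ENNReal.ofReal_pow (norm_nonneg _),
    ENNReal.ofReal_pow (norm_nonneg _), ENNReal.ofReal_pow (norm_nonneg _),
    ENNReal.ofReal_pow (norm_nonneg _)] at h2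
  simpa [ofReal_norm] using h2

lemma lintegral_add_three_sq_le {α : Type*} [MeasurableSpace α] (μ : Measure α) {F a b c : α → ℂ}
    (hF : ∀ w, F w = a w + b w + c w) (hb : Measurable b) (hc : Measurable c) :
    ∫⁻ w, ‖F w‖ₑ ^ 2 ∂μ ≤
      3 * ((∫⁻ w, ‖a w‖ₑ ^ 2 ∂μ) + (∫⁻ w, ‖b w‖ₑ ^ 2 ∂μ) + ∫⁻ w, ‖c w‖ₑ ^ 2 ∂μ) := by
  rw [← lintegral_add_right _ (hb.enorm.pow_const 2), ← lintegral_add_right _ (hc.enorm.pow_const 2),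
    ← lintegral_const_mul' _ _ (by norm_num)]
  refine lintegral_mono fun w => ?_
  rw [hF w]
  exact enorm_add_three_sq_le _ _ _

lemma lintegral_mul_sq_le_of_norm_le {α : Type*} [MeasurableSpace α] (μ : Measure α) {s : Set α}
    (hs : MeasurableSet s) {F G : α → ℂ} {a b : ℝ} (ha : 0 ≤ a) (hF : ∀ w ∈ s, ‖F w‖ ≤ a)
    (hG : ∫⁻ w in s, ‖G w‖ₑ ^ 2 ∂μ ≤ ENNReal.ofReal b) :
    ∫⁻ w in s, ‖F w * G w‖ₑ ^ 2 ∂μ ≤ ENNReal.ofReal (a ^ 2 * b) := by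
  calc ∫⁻ w in s, ‖F w * G w‖ₑ ^ 2 ∂μ
      ≤ ∫⁻ w in s, ENNReal.ofReal (a ^ 2) * ‖G w‖ₑ ^ 2 ∂μ := by
        refine setLIntegral_mono' hs fun w hw => ?_
        rw [enorm_mul, mul_pow]
        gcongr
        rw [ENNReal.ofReal_pow ha, ← ofReal_norm]
        gcongr
        exact hF w hw
    _ = ENNReal.ofReal (a ^ 2) * ∫⁻ w in s, ‖G w‖ₑ ^ 2 ∂μ :=
        lintegral_const_mul' _ _ ENNReal.ofReal_ne_top
    _ ≤ ENNReal.ofReal (a ^ 2) * ENNReal.ofReal b := by gcongr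
    _ = _ := (ENNReal.ofReal_mul (by positivity)).symm

/-- The `L²` bound for the far part of the bilinear interaction. -/
lemma TransCond.exists_sum_far_le (hk : 1 ≤ k) {Φ : (Fin d → ℝ) → Fin k → ℝ}
    (hΦ : ContDiff ℝ (⊤ : ℕ∞) Φ) {ν ν' : Fin d → ℝ} (h : TransCond Φ ν ν') :
    ∃ r : ℝ, 0 < r ∧ r ≤ 1 ∧ ∀ (M : ℕ) (B : ℝ), 0 ≤ B → ∃ C : ℝ, 0 ≤ C ∧ ∀ ρ κ : ℝ, 1 ≤ κ →
      4 * κ ^ 2 ≤ ρ → ∀ 𝕋₁ 𝕋₂ : Finset (Idx d), (∀ T ∈ 𝕋₁, ‖freq ρ T.1 - ν‖ ≤ r) →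
      (∀ T ∈ 𝕋₂, ‖freq ρ T.1 - ν'‖ ≤ r) → (∀ T ∈ 𝕋₁, ‖freq ρ T.1‖ ≤ B) →
      (∀ T ∈ 𝕋₂, ‖freq ρ T.1‖ ≤ B) → ∀ G Zf Z' : Finset ((Fin d → ℤ) × (Fin k → ℤ)),
      (∀ z ∈ G, ‖toR z.2‖ ≤ B * ρ) → (G.card : ℝ) * ρ ^ d ≤ B * κ ^ (2 * M) →
      Zf ⊆ G → Z' ⊆ G →
      (∀ z ∈ Zf, ∀ z₀ ∈ Z', ρ / κ ≤ max ‖toR z.1 - toR z₀.1‖ ‖toR z.2 - toR z₀.2‖) →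
      ∀ c₁ c₂ e₁ e₂ : Idx d → ℂ, (∀ T, ‖e₁ T‖ ≤ ‖c₁ T‖) → (∀ T, ‖e₂ T‖ ≤ ‖c₂ T‖) →
      (∀ T ∈ 𝕋₁, massAlong G 𝕋₂ (incI Φ ρ κ) (incI Φ ρ κ) (fun T => ‖c₂ T‖) T * ‖e₁ T‖ ≤
        massAlong Zf 𝕋₂ (incI Φ ρ κ) (incI Φ ρ κ) (fun T => ‖c₂ T‖) T * ‖c₁ T‖) →
      ∑ z ∈ Z', ∫⁻ w in Metric.closedBall (gridPt ρ z) ρ, ‖wp Φ ρ 𝕋₁ e₁ w * wp Φ ρ 𝕋₂ e₂ w‖ₑ ^ 2 ≤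
        ENNReal.ofReal (C * (ρ ^ k / ρ ^ d) * κ ^ (2 * (5 * d + k)) *
          ((∑ T ∈ 𝕋₁, ‖c₁ T‖ ^ 2) * ∑ T ∈ 𝕋₂, ‖c₂ T‖ ^ 2)) := by
  classical
  obtain ⟨r, hr, hr1, H⟩ := h.exists_sum_inc_le hk hΦ
  refine ⟨r, hr, hr1, fun M B hB => ?_⟩
  obtain ⟨C, hC, H⟩ := H B hB
  obtain ⟨D, hD, HD⟩ := norm_wp_tail_le (d := d) (k := k) hΦ M B
  have hen := enC_nonneg d k
  have hΦm : Measurable Φ := hΦ.continuous.measurable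
  refine ⟨3 * (C + 2 * (D ^ 2 * enC d k * B)), by positivity, ?_⟩
  intro ρ κ hκ hρκ 𝕋₁ 𝕋₂ h1 h2 h1' h2' G Zf Z' hG hcard hZf hZ' hfar c₁ c₂ e₁ e₂ hc1 hc2 hw
  have hρ : 1 ≤ ρ := by nlinarith
  have hρ0 : 0 < ρ := by linarith
  have hmain := H ρ κ hκ hρκ 𝕋₁ 𝕋₂ h1 h2 h1' h2' G Zf Z' hG hZf hZ' hfar c₁ c₂ e₁ e₂ hc1 hc2 hw
  set N₁ := ∑ T ∈ 𝕋₁, ‖c₁ T‖ ^ 2 with hN1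
  set N₂ := ∑ T ∈ 𝕋₂, ‖c₂ T‖ ^ 2 with hN2
  have hN1' : ∑ T ∈ 𝕋₁, ‖e₁ T‖ ^ 2 ≤ N₁ := Finset.sum_le_sum fun T _ => by
    have := hc1 T; gcongr
  have hN2' : ∑ T ∈ 𝕋₂, ‖e₂ T‖ ^ 2 ≤ N₂ := Finset.sum_le_sum fun T _ => by
    have := hc2 T; gcongr
  have hN1n : 0 ≤ N₁ := Finset.sum_nonneg fun _ _ => sq_nonneg _
  have hN2n : 0 ≤ N₂ := Finset.sum_nonneg fun _ _ => sq_nonneg _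
  set τ := D ^ 2 * (1 / κ) ^ (2 * M) * (enC d k * ρ ^ k) * (N₁ * N₂) with hτ
  have hτ0 : 0 ≤ τ := by positivity
  -- the two tail contributions on one ball
  have ht1 : ∀ z ∈ Z', ∫⁻ w in Metric.closedBall (gridPt ρ z) ρ,
      ‖wp Φ ρ (𝕋₁.filter fun T => ¬ inc Φ ρ κ T z) e₁ w * wp Φ ρ 𝕋₂ e₂ w‖ₑ ^ 2 ≤
        ENNReal.ofReal τ := by
    intro z hz
    have hb := lintegral_mul_sq_le_of_norm_le volume (Metric.isClosed_closedBall.measurableSet)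
      (a := D * (1 / κ) ^ M * Real.sqrt N₁) (b := enC d k * ρ ^ k * N₂)
      (by positivity) (fun w hw => (HD ρ κ hρ hκ 𝕋₁ e₁ h1' z (hG z (hZ' hz)) w hw).trans
        (by gcongr)) ((lintegral_wp_sq_le hΦm hρ0 𝕋₂ e₂ hρ0 (gridPt ρ z)).trans
          (ENNReal.ofReal_le_ofReal (by gcongr)))
    refine hb.trans (le_of_eq ?_)
    congr 1
    rw [hτ, mul_pow, mul_pow, Real.sq_sqrt hN1n, ← pow_mul, mul_comm M 2]; ring
  have ht2 : ∀ z ∈ Z', ∫⁻ w in Metric.closedBall (gridPt ρ z) ρ,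
      ‖wp Φ ρ (𝕋₁.filter fun T => inc Φ ρ κ T z) e₁ w *
        wp Φ ρ (𝕋₂.filter fun T => ¬ inc Φ ρ κ T z) e₂ w‖ₑ ^ 2 ≤ ENNReal.ofReal τ := by
    intro z hz
    have hN1'' : ∑ T ∈ 𝕋₁.filter (fun T => inc Φ ρ κ T z), ‖e₁ T‖ ^ 2 ≤ N₁ :=
      (Finset.sum_le_sum_of_subset_of_nonneg (Finset.filter_subset _ _)
        fun _ _ _ => sq_nonneg _).trans hN1'
    have hb := lintegral_mul_sq_le_of_norm_le volume (Metric.isClosed_closedBall.measurableSet)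
      (a := D * (1 / κ) ^ M * Real.sqrt N₂) (b := enC d k * ρ ^ k * N₁)
      (by positivity) (fun w hw => (HD ρ κ hρ hκ 𝕋₂ e₂ h2' z (hG z (hZ' hz)) w hw).trans
        (by gcongr)) ((lintegral_wp_sq_le hΦm hρ0 (𝕋₁.filter fun T => inc Φ ρ κ T z) e₁ hρ0
          (gridPt ρ z)).trans (ENNReal.ofReal_le_ofReal (by gcongr)))
    simp only [mul_comm (wp Φ ρ (𝕋₁.filter fun T => inc Φ ρ κ T z) e₁ _)]
    refine hb.trans (le_of_eq ?_)
    congr 1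
    rw [hτ, mul_pow, mul_pow, Real.sq_sqrt hN2n, ← pow_mul, mul_comm M 2]; ring
  have hz : ∀ z ∈ Z', ∫⁻ w in Metric.closedBall (gridPt ρ z) ρ,
      ‖wp Φ ρ 𝕋₁ e₁ w * wp Φ ρ 𝕋₂ e₂ w‖ₑ ^ 2 ≤
      3 * ((∫⁻ w in Metric.closedBall (gridPt ρ z) ρ,
        ‖wp Φ ρ (𝕋₁.filter fun T => inc Φ ρ κ T z) e₁ w *
          wp Φ ρ (𝕋₂.filter fun T => inc Φ ρ κ T z) e₂ w‖ₑ ^ 2) + ENNReal.ofReal (2 * τ)) := by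
    intro z hz
    refine (lintegral_add_three_sq_le (volume.restrict (Metric.closedBall (gridPt ρ z) ρ))
      (a := fun w => wp Φ ρ (𝕋₁.filter fun T => inc Φ ρ κ T z) e₁ w *
        wp Φ ρ (𝕋₂.filter fun T => inc Φ ρ κ T z) e₂ w)
      (b := fun w => wp Φ ρ (𝕋₁.filter fun T => ¬ inc Φ ρ κ T z) e₁ w * wp Φ ρ 𝕋₂ e₂ w)
      (c := fun w => wp Φ ρ (𝕋₁.filter fun T => inc Φ ρ κ T z) e₁ w *
        wp Φ ρ (𝕋₂.filter fun T => ¬ inc Φ ρ κ T z) e₂ w) (fun w => ?_)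
      ((continuous_wp hΦm hρ0 _ e₁).mul (continuous_wp hΦm hρ0 𝕋₂ e₂)).measurable
      ((continuous_wp hΦm hρ0 _ e₁).mul (continuous_wp hΦm hρ0 _ e₂)).measurable).trans ?_
    · rw [wp_filter_add Φ ρ 𝕋₁ e₁ (fun T => inc Φ ρ κ T z) w,
        wp_filter_add Φ ρ 𝕋₂ e₂ (fun T => inc Φ ρ κ T z) w]
      ring
    · rw [add_assoc, two_mul τ, ENNReal.ofReal_add hτ0 hτ0]
      exact mul_le_mul_right (add_le_add_right (add_le_add (ht1 z hz) (ht2 z hz)) _) _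
  refine (Finset.sum_le_sum hz).trans ?_
  rw [← Finset.mul_sum, Finset.sum_add_distrib, Finset.sum_const, nsmul_eq_mul]
  have hcardτ : (Z'.card : ℝ) * (2 * τ) ≤
      2 * (D ^ 2 * enC d k * B) * (ρ ^ k / ρ ^ d) * κ ^ (2 * (5 * d + k)) * (N₁ * N₂) := by
    have hc : (Z'.card : ℝ) ≤ G.card := by exact_mod_cast Finset.card_le_card hZ'
    have hc2 : (Z'.card : ℝ) * (1 / κ) ^ (2 * M) ≤ B / ρ ^ d := by
      have hκ0 : 0 < κ := by linarith
      rw [_root_.one_div_pow, mul_one_div, div_le_div_iff₀ (by positivity) (by positivity)]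
      exact (mul_le_mul_of_nonneg_right hc (by positivity)).trans hcard
    have hκ1 : 1 ≤ κ ^ (2 * (5 * d + k)) := one_le_pow₀ hκ
    calc (Z'.card : ℝ) * (2 * τ)
        = ((Z'.card : ℝ) * (1 / κ) ^ (2 * M)) * (2 * (D ^ 2 * enC d k * ρ ^ k) * (N₁ * N₂)) := by
          rw [hτ]; ring
      _ ≤ (B / ρ ^ d) * (2 * (D ^ 2 * enC d k * ρ ^ k) * (N₁ * N₂)) :=
          mul_le_mul_of_nonneg_right hc2 (by positivity)
      _ = 2 * (D ^ 2 * enC d k * B) * (ρ ^ k / ρ ^ d) * 1 * (N₁ * N₂) := by ring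
      _ ≤ _ := by gcongr
  calc 3 * (_ + (Z'.card : ℝ≥0∞) * ENNReal.ofReal (2 * τ))
      ≤ 3 * (ENNReal.ofReal (C * (ρ ^ k / ρ ^ d) * κ ^ (2 * (5 * d + k)) * (N₁ * N₂)) +
        ENNReal.ofReal ((Z'.card : ℝ) * (2 * τ))) := by
        rw [ENNReal.ofReal_mul (p := (Z'.card : ℝ)) (by positivity), ENNReal.ofReal_natCast]
        gcongr
    _ = ENNReal.ofReal (3 * (C * (ρ ^ k / ρ ^ d) * κ ^ (2 * (5 * d + k)) * (N₁ * N₂) +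
        (Z'.card : ℝ) * (2 * τ))) := by
        rw [ENNReal.ofReal_mul (p := 3) (by norm_num),
          ENNReal.ofReal_add (by positivity) (by positivity), ENNReal.ofReal_ofNat]
    _ ≤ _ := by
        refine ENNReal.ofReal_le_ofReal ?_
        linarith

end FarEstimate

section Interpolation

/-- The exponent of the bilinear estimate. -/
def pexp (d k : ℕ) : ℝ := ((d : ℝ) + 3 * k) / ((d : ℝ) + k)

lemma one_le_pexp {d k : ℕ} (hk : 1 ≤ k) : 1 ≤ pexp d k := by
  have : (0 : ℝ) < k := by exact_mod_cast hk
  rw [pexp, le_div_iff₀ (by positivity)]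
  linarith

lemma rpow_interp_le {d k : ℕ} (hdk : k ≤ d) (hk : 1 ≤ k) {A C ρ κ N : ℝ} (hA : 0 ≤ A) (hC : 0 ≤ C)
    (hρ : 1 ≤ ρ) (hκ : 1 ≤ κ) (hN : 0 ≤ N) (E : ℕ) :
    (A * ρ ^ (2 * k) * N) ^ (2 - pexp d k) *
        (C * (ρ ^ k / ρ ^ d) * κ ^ E * N ^ 2) ^ (pexp d k - 1) ≤
      ((A + 1) * (C + 1) * κ ^ E * N) ^ pexp d k := by
  have hk0 : (0 : ℝ) < k := by exact_mod_cast hk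
  have hdk' : (k : ℝ) ≤ d := by exact_mod_cast hdk
  have hp1 := one_le_pexp (d := d) hk
  have hp2 : pexp d k ≤ 2 := by
    rw [pexp, div_le_iff₀ (by positivity)]; linarith
  have hρ0 : 0 < ρ := by linarith
  set p := pexp d k with hp
  have hκE : 1 ≤ κ ^ E := one_le_pow₀ hκ
  have e1 : (ρ ^ (2 * k)) ^ (2 - p) * (ρ ^ k / ρ ^ d) ^ (p - 1) = 1 := by
    rw [← Real.rpow_natCast ρ (2 * k), ← Real.rpow_natCast ρ k, ← Real.rpow_natCast ρ d,
      ← Real.rpow_sub hρ0, ← Real.rpow_mul hρ0.le, ← Real.rpow_mul hρ0.le, ← Real.rpow_add hρ0]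
    have : ((2 * k : ℕ) : ℝ) * (2 - p) + ((k : ℝ) - d) * (p - 1) = 0 := by
      rw [hp, pexp]; push_cast; field_simp; ring
    rw [this, Real.rpow_zero]
  have e2 : N ^ (2 - p) * (N ^ 2) ^ (p - 1) = N ^ p := by
    rw [← Real.rpow_natCast N 2, ← Real.rpow_mul hN, ← Real.rpow_add_of_nonneg hN (by linarith)
      (by push_cast; linarith)]
    congr 1; push_cast; ring
  have e3 : A ^ (2 - p) ≤ (A + 1) ^ p :=
    (Real.rpow_le_rpow hA (by linarith) (by linarith)).trans
      (Real.rpow_le_rpow_of_exponent_le (by linarith) (by linarith))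
  have e4 : C ^ (p - 1) ≤ (C + 1) ^ p :=
    (Real.rpow_le_rpow hC (by linarith) (by linarith)).trans
      (Real.rpow_le_rpow_of_exponent_le (by linarith) (by linarith))
  have e5 : (κ ^ E) ^ (p - 1) ≤ (κ ^ E) ^ p :=
    Real.rpow_le_rpow_of_exponent_le hκE (by linarith)
  have hκ0 : 0 ≤ κ ^ E := by linarith
  have hq : 0 ≤ ρ ^ k / ρ ^ d := by positivity
  rw [Real.mul_rpow (by positivity) hN, Real.mul_rpow hA (by positivity),
    Real.mul_rpow (by positivity) (by positivity), Real.mul_rpow (by positivity) hκ0,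
    Real.mul_rpow hC hq, Real.mul_rpow (by positivity) hN, Real.mul_rpow (by positivity) hκ0,
    Real.mul_rpow (by positivity) (by positivity)]
  calc _ = (A ^ (2 - p) * C ^ (p - 1)) * (κ ^ E) ^ (p - 1) * (N ^ (2 - p) * (N ^ 2) ^ (p - 1)) *
        ((ρ ^ (2 * k)) ^ (2 - p) * (ρ ^ k / ρ ^ d) ^ (p - 1)) := by ring
    _ = (A ^ (2 - p) * C ^ (p - 1)) * (κ ^ E) ^ (p - 1) * N ^ p := by rw [e1, e2, mul_one]
    _ ≤ _ := by gcongr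

lemma eLpNorm_interp_le {α : Type*} [MeasurableSpace α] {μ : Measure α} {d k : ℕ} (hdk : k ≤ d)
    (hk : 1 ≤ k) {h : α → ℂ} (hm : AEMeasurable h μ) {A C ρ κ N : ℝ} (hA : 0 ≤ A) (hC : 0 ≤ C)
    (hρ : 1 ≤ ρ) (hκ : 1 ≤ κ) (hN : 0 ≤ N) {E : ℕ}
    (h1 : ∫⁻ x, ‖h x‖ₑ ∂μ ≤ ENNReal.ofReal (A * ρ ^ (2 * k) * N))
    (h2 : ∫⁻ x, ‖h x‖ₑ ^ 2 ∂μ ≤ ENNReal.ofReal (C * (ρ ^ k / ρ ^ d) * κ ^ E * N ^ 2)) :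
    eLpNorm h (ENNReal.ofReal (pexp d k)) μ ≤
      ENNReal.ofReal ((A + 1) * (C + 1) * κ ^ E * N) := by
  have hk0 : (0 : ℝ) < k := by exact_mod_cast hk
  have hdk' : (k : ℝ) ≤ d := by exact_mod_cast hdk
  have hp1 := one_le_pexp (d := d) hk
  have hp2 : pexp d k ≤ 2 := by
    rw [pexp, div_le_iff₀ (by positivity)]; linarith
  have hreal := rpow_interp_le hdk hk hA hC hρ hκ hN E
  set p := pexp d k with hp
  rw [eLpNorm_eq_lintegral_rpow_enorm_toReal (by simp; linarith) ENNReal.ofReal_ne_top,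
    ENNReal.toReal_ofReal (by linarith), one_div]
  refine (ENNReal.rpow_inv_le_iff (by linarith)).2 ?_
  have hH := ENNReal.lintegral_mul_norm_pow_le (μ := μ) (f := fun x => ‖h x‖ₑ)
    (g := fun x => ‖h x‖ₑ ^ 2) hm.enorm (hm.enorm.pow_const 2) (p := 2 - p) (q := p - 1)
    (by linarith) (by linarith) (by ring)
  have hpt : ∀ x, ‖h x‖ₑ ^ p = ‖h x‖ₑ ^ (2 - p) * (‖h x‖ₑ ^ 2) ^ (p - 1) := fun x => by
    rw [← ENNReal.rpow_natCast, ← ENNReal.rpow_mul, ← ENNReal.rpow_add_of_nonneg _ _ (by linarith)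
      (by push_cast; linarith)]
    congr 1; push_cast; ring
  simp only [hpt]
  refine hH.trans ?_
  refine (mul_le_mul' (ENNReal.rpow_le_rpow h1 (by linarith))
    (ENNReal.rpow_le_rpow h2 (by linarith))).trans ?_
  have hκ0 : 0 ≤ κ := by linarith
  have hρ0 : 0 ≤ ρ := by linarith
  rw [ENNReal.ofReal_rpow_of_nonneg (by positivity) (by linarith),
    ENNReal.ofReal_rpow_of_nonneg (by positivity) (by linarith),
    ENNReal.ofReal_rpow_of_nonneg (by positivity) (by linarith), ← ENNReal.ofReal_mul (by positivity)]
  exact ENNReal.ofReal_le_ofReal hreal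

lemma lintegral_enorm_mul_le {α : Type*} [MeasurableSpace α] {μ : Measure α} {F G : α → ℂ}
    (hF : AEMeasurable F μ) (hG : AEMeasurable G μ) {a b : ℝ} (ha : 0 ≤ a) (hb : 0 ≤ b)
    (h1 : ∫⁻ x, ‖F x‖ₑ ^ 2 ∂μ ≤ ENNReal.ofReal (a ^ 2))
    (h2 : ∫⁻ x, ‖G x‖ₑ ^ 2 ∂μ ≤ ENNReal.ofReal (b ^ 2)) :
    ∫⁻ x, ‖F x * G x‖ₑ ∂μ ≤ ENNReal.ofReal (a * b) := by
  have hH := ENNReal.lintegral_mul_norm_pow_le (μ := μ) (f := fun x => ‖F x‖ₑ ^ 2)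
    (g := fun x => ‖G x‖ₑ ^ 2) (hF.enorm.pow_const 2) (hG.enorm.pow_const 2) (p := 1 / 2)
    (q := 1 / 2) (by norm_num) (by norm_num) (by norm_num)
  have hpt : ∀ x : ℝ≥0∞, (x ^ 2) ^ (1 / 2 : ℝ) = x := fun x => by
    rw [← ENNReal.rpow_natCast, ← ENNReal.rpow_mul]; norm_num
  simp only [hpt] at hH
  simp only [enorm_mul]
  refine hH.trans ((mul_le_mul' (ENNReal.rpow_le_rpow h1 (by norm_num))
    (ENNReal.rpow_le_rpow h2 (by norm_num))).trans (le_of_eq ?_))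
  rw [ENNReal.ofReal_pow ha, ENNReal.ofReal_pow hb, hpt, hpt, ENNReal.ofReal_mul ha]

end Interpolation

section Covering

lemma eLpNorm_restrict_union_le {α : Type*} [MeasurableSpace α] {μ : Measure α} {p : ℝ} (hp : 1 ≤ p)
    (h : α → ℂ) (s t : Set α) :
    eLpNorm h (ENNReal.ofReal p) (μ.restrict (s ∪ t)) ≤
      eLpNorm h (ENNReal.ofReal p) (μ.restrict s) + eLpNorm h (ENNReal.ofReal p) (μ.restrict t) := by
  have h0 : ENNReal.ofReal p ≠ 0 := by simp; linarith
  simp only [eLpNorm_eq_lintegral_rpow_enorm_toReal h0 ENNReal.ofReal_ne_top]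
  rw [ENNReal.toReal_ofReal (by linarith)]
  have hp1 : 1 / p ≤ 1 := by rw [div_le_one (by linarith)]; exact hp
  exact (ENNReal.rpow_le_rpow (lintegral_union_le _ _ _) (by positivity)).trans
    (ENNReal.rpow_add_le_add_rpow _ _ (by positivity) hp1)

lemma eLpNorm_restrict_biUnion_le {α ι : Type*} [MeasurableSpace α] {μ : Measure α} {p : ℝ}
    (hp : 1 ≤ p) (h : α → ℂ) (t : Finset ι) (U : ι → Set α) :
    eLpNorm h (ENNReal.ofReal p) (μ.restrict (⋃ i ∈ t, U i)) ≤
      ∑ i ∈ t, eLpNorm h (ENNReal.ofReal p) (μ.restrict (U i)) := by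
  classical
  induction t using Finset.induction_on with
  | empty => simp
  | insert a t ha ih =>
    rw [Finset.sum_insert ha, Finset.set_biUnion_insert]
    exact (eLpNorm_restrict_union_le hp h _ _).trans (add_le_add le_rfl ih)

lemma setLIntegral_biUnion_le {α ι : Type*} [MeasurableSpace α] {μ : Measure α} (h : α → ℝ≥0∞)
    (t : Finset ι) (U : ι → Set α) :
    ∫⁻ x in ⋃ i ∈ t, U i, h x ∂μ ≤ ∑ i ∈ t, ∫⁻ x in U i, h x ∂μ := by
  classical
  induction t using Finset.induction_on with
  | empty => simp
  | insert a t ha ih =>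
    rw [Finset.sum_insert ha, Finset.set_biUnion_insert]
    exact (lintegral_union_le _ _ _).trans (add_le_add le_rfl ih)

end Covering

section Grid

variable {d k : ℕ}

/-- The grid points whose `ρ`-balls cover the ball of radius `ρ ^ 2` about the origin. -/
def gridSet (d k : ℕ) (ρ : ℝ) : Finset ((Fin d → ℤ) × (Fin k → ℤ)) :=
  intBall 0 (ρ + 1) ×ˢ intBall 0 (ρ + 1)

@[simp] lemma toR_zero : toR (0 : Fin d → ℤ) = 0 := by ext i; simp [toR]

lemma mem_gridSet {ρ : ℝ} (hρ : 0 ≤ ρ) {z : (Fin d → ℤ) × (Fin k → ℤ)} :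
    z ∈ gridSet d k ρ ↔ ‖toR z.1‖ ≤ ρ + 1 ∧ ‖toR z.2‖ ≤ ρ + 1 := by
  rw [gridSet, Finset.mem_product, mem_intBall (by linarith), mem_intBall (by linarith), toR_zero,
    toR_zero, sub_zero, sub_zero]

lemma card_gridSet_le {ρ : ℝ} (hρ : 1 ≤ ρ) : ((gridSet d k ρ).card : ℝ) ≤ (5 * ρ) ^ (d + k) := by
  rw [gridSet, Finset.card_product, Nat.cast_mul, pow_add]
  have h : 2 * (ρ + 1) + 1 ≤ 5 * ρ := by linarith
  exact mul_le_mul ((card_intBall_le _ (by linarith)).trans (by gcongr))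
    ((card_intBall_le _ (by linarith)).trans (by gcongr)) (Nat.cast_nonneg _) (by positivity)

lemma norm_toR_floor_sub {n : ℕ} (x : Fin n → ℝ) : ‖toR (fun i => ⌊x i⌋) - x‖ ≤ 1 := by
  rw [pi_norm_le_iff_of_nonneg (by norm_num)]
  intro i
  rw [Pi.sub_apply, toR, Real.norm_eq_abs, abs_le]
  have h1 := Int.floor_le (x i)
  have h2 := Int.lt_floor_add_one (x i)
  constructor <;> linarith

lemma exists_gridPt {ρ : ℝ} (hρ : 0 < ρ) (w : (Fin d → ℝ) × (Fin k → ℝ))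
    (hw : w ∈ Metric.closedBall 0 (ρ ^ 2)) :
    ∃ z ∈ gridSet d k ρ, w ∈ Metric.closedBall (gridPt ρ z) ρ := by
  rw [mem_closedBall_zero_iff, Prod.norm_def, max_le_iff] at hw
  have key : ∀ (n : ℕ) (x : Fin n → ℝ), ‖x‖ ≤ ρ ^ 2 →
      ‖toR (fun i => ⌊(ρ⁻¹ • x) i⌋)‖ ≤ ρ + 1 ∧ ‖x - ρ • toR (fun i => ⌊(ρ⁻¹ • x) i⌋)‖ ≤ ρ := by
    intro n x hx
    have h1 := norm_toR_floor_sub (ρ⁻¹ • x)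
    set v := toR (fun i => ⌊(ρ⁻¹ • x) i⌋)
    have h2 : ‖ρ⁻¹ • x‖ ≤ ρ := by
      rw [norm_smul, norm_inv, Real.norm_of_nonneg hρ.le, inv_mul_le_iff₀ hρ]
      linarith [sq ρ]
    have h3 : x - ρ • v = -(ρ • (v - ρ⁻¹ • x)) := by
      rw [smul_sub, smul_smul, mul_inv_cancel₀ hρ.ne', one_smul]; abel
    constructor
    · calc ‖v‖ = ‖(v - ρ⁻¹ • x) + ρ⁻¹ • x‖ := by congr 1; abel
        _ ≤ ‖v - ρ⁻¹ • x‖ + ‖ρ⁻¹ • x‖ := norm_add_le _ _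
        _ ≤ _ := by linarith
    · rw [h3, norm_neg, norm_smul, Real.norm_of_nonneg hρ.le]
      nlinarith
  refine ⟨(fun i => ⌊(ρ⁻¹ • w.1) i⌋, fun i => ⌊(ρ⁻¹ • w.2) i⌋),
    (mem_gridSet hρ.le).2 ⟨(key d w.1 hw.1).1, (key k w.2 hw.2).1⟩, ?_⟩
  rw [mem_closedBall_iff_norm, gridPt, Prod.norm_def, max_le_iff]
  exact ⟨(key d w.1 hw.1).2, (key k w.2 hw.2).2⟩

lemma closedBall_gridPt_subset {ρ : ℝ} (hρ : 1 ≤ ρ) {z : (Fin d → ℤ) × (Fin k → ℤ)}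
    (hz : z ∈ gridSet d k ρ) :
    Metric.closedBall (gridPt ρ z) ρ ⊆ Metric.closedBall 0 (3 * ρ ^ 2) := by
  intro w hw
  have hz' := (mem_gridSet (by linarith)).1 hz
  rw [mem_closedBall_iff_norm] at hw
  rw [mem_closedBall_zero_iff]
  have h1 : ‖gridPt ρ z‖ ≤ ρ * (ρ + 1) := by
    have : gridPt ρ z = ρ • (toR z.1, toR z.2) := rfl
    rw [this, norm_smul, Real.norm_of_nonneg (by linarith), Prod.norm_def]
    exact mul_le_mul_of_nonneg_left (max_le hz'.1 hz'.2) (by linarith)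
  calc ‖w‖ = ‖(w - gridPt ρ z) + gridPt ρ z‖ := by congr 1; abel
    _ ≤ ‖w - gridPt ρ z‖ + ‖gridPt ρ z‖ := norm_add_le _ _
    _ ≤ _ := by nlinarith

/-- The union of the `ρ`-balls around the grid points in `Z`. -/
def ballUnion (ρ : ℝ) (Z : Finset ((Fin d → ℤ) × (Fin k → ℤ))) : Set ((Fin d → ℝ) × (Fin k → ℝ)) :=
  ⋃ z ∈ Z, Metric.closedBall (gridPt ρ z) ρ

lemma lintegral_wp_sq_ballUnion_le {Φ : (Fin d → ℝ) → Fin k → ℝ} (hΦ : Measurable Φ) {ρ : ℝ}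
    (hρ : 1 ≤ ρ) (𝕋 : Finset (Idx d)) (c : Idx d → ℂ)
    {Z : Finset ((Fin d → ℤ) × (Fin k → ℤ))} (hZ : Z ⊆ gridSet d k ρ) :
    ∫⁻ w in ballUnion ρ Z, ‖wp Φ ρ 𝕋 c w‖ₑ ^ 2 ≤
      ENNReal.ofReal (enC d k * (3 * ρ ^ 2) ^ k * ∑ T ∈ 𝕋, ‖c T‖ ^ 2) := by
  refine (lintegral_mono_set ?_).trans
    (lintegral_wp_sq_le hΦ (by linarith) 𝕋 c (R := 3 * ρ ^ 2) (by positivity) 0)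
  exact Set.iUnion₂_subset fun z hz => closedBall_gridPt_subset hρ (hZ hz)

/-- The `L^p` bound for the far part of the bilinear interaction. -/
lemma TransCond.exists_eLpNorm_far_le (hdk : k ≤ d) (hk : 1 ≤ k) {Φ : (Fin d → ℝ) → Fin k → ℝ}
    (hΦ : ContDiff ℝ (⊤ : ℕ∞) Φ) {ν ν' : Fin d → ℝ} (h : TransCond Φ ν ν') :
    ∃ r : ℝ, 0 < r ∧ r ≤ 1 ∧ ∀ M : ℕ, ∃ C : ℝ, 0 ≤ C ∧ ∀ ρ κ : ℝ, 1 ≤ κ →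
      4 * κ ^ 2 ≤ ρ → ρ ^ (2 * d + k) ≤ κ ^ (2 * M) →
      ∀ 𝕋₁ 𝕋₂ : Finset (Idx d), (∀ T ∈ 𝕋₁, ‖freq ρ T.1 - ν‖ ≤ r) →
      (∀ T ∈ 𝕋₂, ‖freq ρ T.1 - ν'‖ ≤ r) → ∀ Zf Z' : Finset ((Fin d → ℤ) × (Fin k → ℤ)),
      Zf ⊆ gridSet d k ρ → Z' ⊆ gridSet d k ρ →
      (∀ z ∈ Zf, ∀ z₀ ∈ Z', ρ / κ ≤ max ‖toR z.1 - toR z₀.1‖ ‖toR z.2 - toR z₀.2‖) →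
      ∀ c₁ c₂ e₁ e₂ : Idx d → ℂ, (∀ T, ‖e₁ T‖ ≤ ‖c₁ T‖) → (∀ T, ‖e₂ T‖ ≤ ‖c₂ T‖) →
      (∀ T ∈ 𝕋₁, massAlong (gridSet d k ρ) 𝕋₂ (incI Φ ρ κ) (incI Φ ρ κ) (fun T => ‖c₂ T‖) T *
          ‖e₁ T‖ ≤
        massAlong Zf 𝕋₂ (incI Φ ρ κ) (incI Φ ρ κ) (fun T => ‖c₂ T‖) T * ‖c₁ T‖) →
      ∀ a b : ℝ, 0 ≤ a → 0 ≤ b → ∑ T ∈ 𝕋₁, ‖c₁ T‖ ^ 2 ≤ a ^ 2 → ∑ T ∈ 𝕋₂, ‖c₂ T‖ ^ 2 ≤ b ^ 2 →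
      eLpNorm (fun w => wp Φ ρ 𝕋₁ e₁ w * wp Φ ρ 𝕋₂ e₂ w) (ENNReal.ofReal (pexp d k))
          (volume.restrict (ballUnion ρ Z')) ≤
        ENNReal.ofReal (C * κ ^ (2 * (5 * d + k)) * (a * b)) := by
  obtain ⟨r, hr, hr1, H⟩ := h.exists_sum_far_le hk hΦ
  refine ⟨r, hr, hr1, fun M => ?_⟩
  set B : ℝ := max (5 ^ (d + k)) (max (‖ν‖ + 1) (‖ν'‖ + 1)) with hB
  have hB1 : (5 : ℝ) ^ (d + k) ≤ B := le_max_left _ _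
  have hB2 : ‖ν‖ + 1 ≤ B := (le_max_left _ _).trans (le_max_right _ _)
  have hB3 : ‖ν'‖ + 1 ≤ B := (le_max_right _ _).trans (le_max_right _ _)
  have hB4 : 2 ≤ B := by
    have : (5 : ℝ) ^ 1 ≤ 5 ^ (d + k) := pow_le_pow_right₀ (by norm_num) (by omega)
    linarith
  obtain ⟨C, hC, H⟩ := H M B (by linarith)
  have hen := enC_nonneg d k
  have hΦm : Measurable Φ := hΦ.continuous.measurable
  refine ⟨(enC d k * 3 ^ k + 1) * (C + 1), by positivity, ?_⟩
  intro ρ κ hκ hρκ hM 𝕋₁ 𝕋₂ h1 h2 Zf Z' hZf hZ' hfar c₁ c₂ e₁ e₂ hc1 hc2 hw a b ha hb hca hcb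
  have hρ : 1 ≤ ρ := by nlinarith
  have hρ0 : 0 < ρ := by linarith
  have hfreq : ∀ (μ : Fin d → ℝ) (T : Idx d), ‖μ‖ + 1 ≤ B → ‖freq ρ T.1 - μ‖ ≤ r →
      ‖freq ρ T.1‖ ≤ B := by
    intro μ T hμ hT
    calc ‖freq ρ T.1‖ = ‖(freq ρ T.1 - μ) + μ‖ := by congr 1; abel
      _ ≤ ‖freq ρ T.1 - μ‖ + ‖μ‖ := norm_add_le _ _
      _ ≤ B := by linarith
  have hcard : ((gridSet d k ρ).card : ℝ) * ρ ^ d ≤ B * κ ^ (2 * M) := by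
    calc ((gridSet d k ρ).card : ℝ) * ρ ^ d ≤ (5 * ρ) ^ (d + k) * ρ ^ d := by
          gcongr; exact card_gridSet_le hρ
      _ = 5 ^ (d + k) * ρ ^ (2 * d + k) := by rw [mul_pow]; ring
      _ ≤ _ := by gcongr
  have hsum := H ρ κ hκ hρκ 𝕋₁ 𝕋₂ h1 h2 (fun T hT => hfreq ν T hB2 (h1 T hT))
    (fun T hT => hfreq ν' T hB3 (h2 T hT)) (gridSet d k ρ) Zf Z'
    (fun z hz => ((mem_gridSet hρ0.le).1 hz).2.trans (by nlinarith)) hcard hZf hZ' hfar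
    c₁ c₂ e₁ e₂ hc1 hc2 hw
  have hwm := fun 𝕋 c => (continuous_wp hΦm hρ0 𝕋 c).measurable.aemeasurable
    (μ := volume.restrict (ballUnion ρ Z'))
  have hen1 : ∀ (𝕋 : Finset (Idx d)) (c e : Idx d → ℂ) (x : ℝ), (∀ T, ‖e T‖ ≤ ‖c T‖) →
      ∑ T ∈ 𝕋, ‖c T‖ ^ 2 ≤ x ^ 2 → ∫⁻ w in ballUnion ρ Z', ‖wp Φ ρ 𝕋 e w‖ₑ ^ 2 ≤
        ENNReal.ofReal ((Real.sqrt (enC d k * (3 * ρ ^ 2) ^ k) * x) ^ 2) := by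
    intro 𝕋 c e x hec hx
    refine (lintegral_wp_sq_ballUnion_le hΦm hρ 𝕋 e hZ').trans (ENNReal.ofReal_le_ofReal ?_)
    rw [mul_pow _ x, Real.sq_sqrt (by positivity)]
    refine mul_le_mul_of_nonneg_left (le_trans (Finset.sum_le_sum fun T _ => ?_) hx) (by positivity)
    have := hec T
    gcongr
  refine eLpNorm_interp_le hdk hk ((hwm 𝕋₁ e₁).mul (hwm 𝕋₂ e₂)) (A := enC d k * 3 ^ k) (C := C)
    (by positivity) hC hρ hκ (mul_nonneg ha hb) ?_ ?_
  · refine (lintegral_enorm_mul_le (hwm 𝕋₁ e₁) (hwm 𝕋₂ e₂) (by positivity) (by positivity)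
      (hen1 𝕋₁ c₁ e₁ a hc1 hca) (hen1 𝕋₂ c₂ e₂ b hc2 hcb)).trans (le_of_eq ?_)
    congr 1
    rw [mul_mul_mul_comm, Real.mul_self_sqrt (by positivity), mul_pow, ← pow_mul]
    ring
  · refine (setLIntegral_biUnion_le _ Z' _).trans (hsum.trans (ENNReal.ofReal_le_ofReal ?_))
    rw [mul_pow a b]
    gcongr

end Grid

section Cells

variable {d k : ℕ}

/-- The cell of side `lam` (in grid units) containing a grid point. -/
def cell (lam : ℝ) (z : (Fin d → ℤ) × (Fin k → ℤ)) : (Fin d → ℤ) × (Fin k → ℤ) :=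
  (fun i => ⌊(lam⁻¹ • toR z.1) i⌋, fun j => ⌊(lam⁻¹ • toR z.2) j⌋)

/-- Adjacent or equal cells. -/
def nearCell (Z Z' : (Fin d → ℤ) × (Fin k → ℤ)) : Prop :=
  ‖toR Z.1 - toR Z'.1‖ ≤ 1 ∧ ‖toR Z.2 - toR Z'.2‖ ≤ 1

lemma le_norm_sub_of_floor {n : ℕ} {lam : ℝ} (hlam : 0 < lam) {u v : Fin n → ℤ}
    (h : ¬ ‖toR (fun i => ⌊(lam⁻¹ • toR u) i⌋) - toR (fun i => ⌊(lam⁻¹ • toR v) i⌋)‖ ≤ 1) :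
    lam ≤ ‖toR u - toR v‖ := by
  by_contra! hlt
  refine h ((pi_norm_le_iff_of_nonneg (by norm_num)).2 fun i => ?_)
  have h1 : |(u i : ℝ) - v i| < lam := by
    have := norm_le_pi_norm (toR u - toR v) i
    rw [Pi.sub_apply, toR, toR, Real.norm_eq_abs] at this
    exact this.trans_lt hlt
  have h2 : |lam⁻¹ * u i - lam⁻¹ * v i| < 1 := by
    rw [← mul_sub, abs_mul, abs_of_pos (inv_pos.2 hlam), inv_mul_lt_iff₀ hlam]
    linarith
  rw [Pi.sub_apply, toR, toR, Real.norm_eq_abs]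
  simp only [Pi.smul_apply, smul_eq_mul, toR]
  rw [abs_lt] at h2
  have a1 := Int.floor_le (lam⁻¹ * (u i : ℝ))
  have a2 := Int.lt_floor_add_one (lam⁻¹ * (u i : ℝ))
  have b1 := Int.floor_le (lam⁻¹ * (v i : ℝ))
  have b2 := Int.lt_floor_add_one (lam⁻¹ * (v i : ℝ))
  have c1 : (⌊lam⁻¹ * (u i : ℝ)⌋ : ℝ) - ⌊lam⁻¹ * (v i : ℝ)⌋ < 2 := by linarith
  have c2 : -2 < (⌊lam⁻¹ * (u i : ℝ)⌋ : ℝ) - ⌊lam⁻¹ * (v i : ℝ)⌋ := by linarith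
  have c1' : ⌊lam⁻¹ * (u i : ℝ)⌋ - ⌊lam⁻¹ * (v i : ℝ)⌋ < 2 := by exact_mod_cast c1
  have c2' : -2 < ⌊lam⁻¹ * (u i : ℝ)⌋ - ⌊lam⁻¹ * (v i : ℝ)⌋ := by exact_mod_cast c2
  rw [abs_le]
  constructor
  · have : -1 ≤ ⌊lam⁻¹ * (u i : ℝ)⌋ - ⌊lam⁻¹ * (v i : ℝ)⌋ := by omega
    exact_mod_cast this
  · have : ⌊lam⁻¹ * (u i : ℝ)⌋ - ⌊lam⁻¹ * (v i : ℝ)⌋ ≤ 1 := by omega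
    exact_mod_cast this

lemma le_max_of_not_nearCell {lam : ℝ} (hlam : 0 < lam) {z z₀ : (Fin d → ℤ) × (Fin k → ℤ)}
    (h : ¬ nearCell (cell lam z) (cell lam z₀)) :
    lam ≤ max ‖toR z.1 - toR z₀.1‖ ‖toR z.2 - toR z₀.2‖ := by
  rw [nearCell, not_and_or] at h
  rcases h with h | h
  · exact (le_norm_sub_of_floor hlam h).trans (le_max_left _ _)
  · exact (le_norm_sub_of_floor hlam h).trans (le_max_right _ _)

lemma norm_toR_sub_smul_floor_le {n : ℕ} {lam : ℝ} (hlam : 0 < lam) (u : Fin n → ℤ) :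
    ‖toR u - lam • toR (fun i => ⌊(lam⁻¹ • toR u) i⌋)‖ ≤ lam := by
  have h := norm_toR_floor_sub (lam⁻¹ • toR u)
  set v := toR (fun i => ⌊(lam⁻¹ • toR u) i⌋)
  have h3 : toR u - lam • v = -(lam • (v - lam⁻¹ • toR u)) := by
    rw [smul_sub, smul_smul, mul_inv_cancel₀ hlam.ne', one_smul]; abel
  rw [h3, norm_neg, norm_smul, Real.norm_of_nonneg hlam.le]
  nlinarith

lemma closedBall_subset_of_cell {ρ lam : ℝ} (hρ : 0 < ρ) (hlam : 1 ≤ lam)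
    (z : (Fin d → ℤ) × (Fin k → ℤ)) :
    Metric.closedBall (gridPt ρ z) ρ ⊆
      Metric.closedBall (gridPt (ρ * lam) (cell lam z)) (2 * (ρ * lam)) := by
  have hl0 : 0 < lam := by linarith
  refine Metric.closedBall_subset_closedBall' ?_
  rw [dist_eq_norm]
  have h : gridPt ρ z - gridPt (ρ * lam) (cell lam z) =
      ρ • ((toR z.1, toR z.2) - lam • (toR (cell lam z).1, toR (cell lam z).2)) := by
    rw [smul_sub, smul_smul]; rfl
  have h2 : ‖((toR z.1, toR z.2) - lam • (toR (cell lam z).1, toR (cell lam z).2) :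
      (Fin d → ℝ) × (Fin k → ℝ))‖ ≤ lam := by
    rw [Prod.norm_def]
    exact max_le (norm_toR_sub_smul_floor_le hl0 z.1) (norm_toR_sub_smul_floor_le hl0 z.2)
  rw [h, norm_smul, Real.norm_of_nonneg hρ.le]
  nlinarith

open Classical in
lemma card_nearCell_le (S : Finset ((Fin d → ℤ) × (Fin k → ℤ))) (Z : (Fin d → ℤ) × (Fin k → ℤ)) :
    ((S.filter fun Z' => nearCell Z Z').card : ℝ) ≤ 3 ^ (d + k) := by
  have hsub : (S.filter fun Z' => nearCell Z Z') ⊆ intBall Z.1 1 ×ˢ intBall Z.2 1 := by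
    intro Z' h
    have h' := (Finset.mem_filter.1 h).2
    rw [Finset.mem_product, mem_intBall (by norm_num), mem_intBall (by norm_num), norm_sub_rev,
      norm_sub_rev (toR Z'.2)]
    exact h'
  calc ((S.filter fun Z' => nearCell Z Z').card : ℝ)
      ≤ ((intBall Z.1 1 ×ˢ intBall Z.2 1).card : ℝ) := by exact_mod_cast Finset.card_le_card hsub
    _ ≤ (2 * 1 + 1) ^ d * (2 * 1 + 1) ^ k := by
        rw [Finset.card_product, Nat.cast_mul]
        exact mul_le_mul (card_intBall_le _ (by norm_num)) (card_intBall_le _ (by norm_num))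
          (Nat.cast_nonneg _) (by positivity)
    _ = _ := by rw [← pow_add]; norm_num

open Classical in
lemma card_image_cell_le {ρ κ : ℝ} (hρ : 1 ≤ ρ) (hκ : 1 ≤ κ) :
    (((gridSet d k ρ).image (cell (ρ / κ))).card : ℝ) ≤ (7 * κ) ^ (d + k) := by
  have hρ0 : 0 < ρ := by linarith
  have hκ0 : 0 < κ := by linarith
  have key : ∀ (n : ℕ) (u : Fin n → ℤ), ‖toR u‖ ≤ ρ + 1 →
      ‖toR (fun i => ⌊((ρ / κ)⁻¹ • toR u) i⌋)‖ ≤ 3 * κ := by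
    intro n u hu
    have h1 := norm_toR_floor_sub ((ρ / κ)⁻¹ • toR u)
    set v := toR (fun i => ⌊((ρ / κ)⁻¹ • toR u) i⌋)
    have h2 : ‖(ρ / κ)⁻¹ • toR u‖ ≤ 2 * κ := by
      rw [norm_smul, Real.norm_of_nonneg (by positivity), inv_div, div_mul_eq_mul_div,
        div_le_iff₀ hρ0]
      nlinarith
    calc ‖v‖ = ‖(v - (ρ / κ)⁻¹ • toR u) + (ρ / κ)⁻¹ • toR u‖ := by congr 1; abel
      _ ≤ ‖v - (ρ / κ)⁻¹ • toR u‖ + ‖(ρ / κ)⁻¹ • toR u‖ := norm_add_le _ _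
      _ ≤ _ := by linarith
  have hsub : (gridSet d k ρ).image (cell (ρ / κ)) ⊆ intBall 0 (3 * κ) ×ˢ intBall 0 (3 * κ) := by
    intro Z hZ
    obtain ⟨z, hz, rfl⟩ := Finset.mem_image.1 hZ
    have hz' := (mem_gridSet hρ0.le).1 hz
    rw [Finset.mem_product, mem_intBall (by positivity), mem_intBall (by positivity), toR_zero,
      toR_zero, sub_zero, sub_zero]
    exact ⟨key d z.1 hz'.1, key k z.2 hz'.2⟩
  have h7 : 2 * (3 * κ) + 1 ≤ 7 * κ := by linarith
  calc (((gridSet d k ρ).image (cell (ρ / κ))).card : ℝ)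
      ≤ ((intBall (0 : Fin d → ℤ) (3 * κ) ×ˢ intBall (0 : Fin k → ℤ) (3 * κ)).card : ℝ) := by
        exact_mod_cast Finset.card_le_card hsub
    _ ≤ (7 * κ) ^ d * (7 * κ) ^ k := by
        rw [Finset.card_product, Nat.cast_mul]
        exact mul_le_mul ((card_intBall_le _ (by positivity)).trans (by gcongr))
          ((card_intBall_le _ (by positivity)).trans (by gcongr))
          (Nat.cast_nonneg _) (by positivity)
    _ = _ := (pow_add _ _ _).symm

end Cells

section NearWeight

open Classical

variable {α β ζ ι : Type*}

/-- The proportion of the mass along `a` that lies near the cell `Z`. -/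
def nearWeight (G : Finset ζ) (near : ζ → ι → Prop) (𝕋₂ : Finset β) (i₁ : α → ζ → ℝ) (i₂ : β → ζ → ℝ)
    (n₂ : β → ℝ) (Z : ι) (a : α) : ℝ :=
  massAlong (G.filter fun z => near z Z) 𝕋₂ i₁ i₂ n₂ a / massAlong G 𝕋₂ i₁ i₂ n₂ a

variable {G : Finset ζ} {near : ζ → ι → Prop} {𝕋₂ : Finset β} {i₁ : α → ζ → ℝ} {i₂ : β → ζ → ℝ}
  {n₂ : β → ℝ}

lemma nearWeight_nonneg (h1 : ∀ a z, 0 ≤ i₁ a z) (h2 : ∀ b z, 0 ≤ i₂ b z) (Z : ι) (a : α) :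
    0 ≤ nearWeight G near 𝕋₂ i₁ i₂ n₂ Z a :=
  div_nonneg (massAlong_nonneg _ _ _ h1 h2 a) (massAlong_nonneg _ _ _ h1 h2 a)

lemma nearWeight_le_one (h1 : ∀ a z, 0 ≤ i₁ a z) (h2 : ∀ b z, 0 ≤ i₂ b z) (Z : ι) (a : α) :
    nearWeight G near 𝕋₂ i₁ i₂ n₂ Z a ≤ 1 :=
  div_le_one_of_le₀ (massAlong_mono (Finset.filter_subset _ _) _ _ h1 h2 a)
    (massAlong_nonneg _ _ _ h1 h2 a)

lemma massAlong_mul_one_sub_nearWeight_le (h1 : ∀ a z, 0 ≤ i₁ a z) (h2 : ∀ b z, 0 ≤ i₂ b z) (Z : ι)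
    (a : α) : massAlong G 𝕋₂ i₁ i₂ n₂ a * (1 - nearWeight G near 𝕋₂ i₁ i₂ n₂ Z a) ≤
      massAlong (G.filter fun z => ¬ near z Z) 𝕋₂ i₁ i₂ n₂ a := by
  have hadd : massAlong (G.filter fun z => near z Z) 𝕋₂ i₁ i₂ n₂ a +
      massAlong (G.filter fun z => ¬ near z Z) 𝕋₂ i₁ i₂ n₂ a = massAlong G 𝕋₂ i₁ i₂ n₂ a :=
    Finset.sum_filter_add_sum_filter_not G _ _
  rcases (massAlong_nonneg G 𝕋₂ n₂ h1 h2 a).eq_or_lt with h0 | h0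
  · rw [← h0, zero_mul]
    exact massAlong_nonneg _ _ _ h1 h2 a
  · rw [nearWeight, mul_sub, mul_one, mul_div_cancel₀ _ h0.ne']
    linarith

lemma sum_nearWeight_sq_le (h1 : ∀ a z, 0 ≤ i₁ a z) (h2 : ∀ b z, 0 ≤ i₂ b z) (S : Finset ι) {K : ℝ}
    (hK : 0 ≤ K) (hcard : ∀ z ∈ G, ((S.filter fun Z => near z Z).card : ℝ) ≤ K) (a : α) :
    ∑ Z ∈ S, nearWeight G near 𝕋₂ i₁ i₂ n₂ Z a ^ 2 ≤ K := by
  have hsq : ∀ Z ∈ S, nearWeight G near 𝕋₂ i₁ i₂ n₂ Z a ^ 2 ≤ nearWeight G near 𝕋₂ i₁ i₂ n₂ Z a :=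
    fun Z _ => by
      have := nearWeight_nonneg (G := G) (near := near) (𝕋₂ := 𝕋₂) (n₂ := n₂) h1 h2 Z a
      have := nearWeight_le_one (G := G) (near := near) (𝕋₂ := 𝕋₂) (n₂ := n₂) h1 h2 Z a
      nlinarith
  refine (Finset.sum_le_sum hsq).trans ?_
  simp only [nearWeight]
  rw [← Finset.sum_div]
  refine div_le_of_le_mul₀ (massAlong_nonneg _ _ _ h1 h2 a) hK ?_
  simp only [massAlong, Finset.sum_filter]
  rw [Finset.sum_comm, Finset.mul_sum]
  refine Finset.sum_le_sum fun z hz => ?_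
  rw [← Finset.sum_filter, Finset.sum_const, nsmul_eq_mul]
  exact mul_le_mul_of_nonneg_right (hcard z hz) (Finset.sum_nonneg fun b _ =>
    mul_nonneg (mul_nonneg (h1 a z) (h2 b z)) (sq_nonneg _))

end NearWeight

section Combine

variable {d k : ℕ}

lemma wp_add_coeff (Φ : (Fin d → ℝ) → Fin k → ℝ) (ρ : ℝ) (𝕋 : Finset (Idx d)) (s : Idx d → ℝ)
    (c : Idx d → ℂ) (w : (Fin d → ℝ) × (Fin k → ℝ)) :
    wp Φ ρ 𝕋 c w = wp Φ ρ 𝕋 (fun T => (s T : ℂ) * c T) w +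
      wp Φ ρ 𝕋 (fun T => ((1 - s T : ℝ) : ℂ) * c T) w := by
  simp only [wp]
  rw [← Finset.sum_add_distrib]
  refine Finset.sum_congr rfl fun T _ => ?_
  push_cast; ring

lemma norm_ofReal_mul_le {s : ℝ} (h0 : 0 ≤ s) (h1 : s ≤ 1) (c : ℂ) : ‖(s : ℂ) * c‖ ≤ ‖c‖ := by
  rw [norm_mul, Complex.norm_real, Real.norm_of_nonneg h0]
  exact mul_le_of_le_one_left (norm_nonneg _) h1

lemma eLpNorm_mul_split_le {α : Type*} [MeasurableSpace α] {μ : Measure α} {p : ℝ} (hp : 1 ≤ p)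
    {F Fn Ff H Hn Hf : α → ℂ} (hF : ∀ x, F x = Fn x + Ff x) (hH : ∀ x, H x = Hn x + Hf x)
    (m1 : Measurable Fn) (m2 : Measurable Ff) (m3 : Measurable Hn) (m4 : Measurable Hf) :
    eLpNorm (fun x => F x * H x) (ENNReal.ofReal p) μ ≤
      eLpNorm (fun x => Fn x * Hn x) (ENNReal.ofReal p) μ +
        (eLpNorm (fun x => Hf x * Fn x) (ENNReal.ofReal p) μ +
        eLpNorm (fun x => Ff x * H x) (ENNReal.ofReal p) μ) := by
  have hp' : 1 ≤ ENNReal.ofReal p := by rw [← ENNReal.ofReal_one]; exact ENNReal.ofReal_le_ofReal hp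
  have e : (fun x => F x * H x) =
      (fun x => Fn x * Hn x) + ((fun x => Hf x * Fn x) + fun x => Ff x * H x) := by
    ext x
    simp only [Pi.add_apply, hF x, hH x]; ring
  have m5 : Measurable H := by
    have : H = fun x => Hn x + Hf x := funext hH
    rw [this]; exact m3.add m4
  rw [e]
  refine (eLpNorm_add_le (m1.mul m3).aestronglyMeasurable
    ((m4.mul m1).add (m2.mul m5)).aestronglyMeasurable hp').trans (add_le_add le_rfl ?_)
  exact eLpNorm_add_le (m4.mul m1).aestronglyMeasurable (m2.mul m5).aestronglyMeasurable hp'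

open Classical in
lemma sum_sqrt_nearWeight_le {ζ ι : Type*} {S : Finset ι} {G : Finset ζ} {near : ζ → ι → Prop}
    {𝕋₁ 𝕋₂ : Finset (Idx d)} {i₁ i₂ : Idx d → ζ → ℝ} {n₂ : Idx d → ℝ} (h1 : ∀ a z, 0 ≤ i₁ a z)
    (h2 : ∀ b z, 0 ≤ i₂ b z) {K : ℝ} (hK : 0 ≤ K)
    (hcard : ∀ z ∈ G, ((S.filter fun Z => near z Z).card : ℝ) ≤ K) {c : Idx d → ℂ} {a : ℝ}
    (hc : ∑ T ∈ 𝕋₁, ‖c T‖ ^ 2 ≤ a ^ 2) :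
    ∑ Z ∈ S, ∑ T ∈ 𝕋₁, ‖(nearWeight G near 𝕋₂ i₁ i₂ n₂ Z T : ℂ) * c T‖ ^ 2 ≤ K * a ^ 2 := by
  rw [Finset.sum_comm]
  have : ∀ T ∈ 𝕋₁, ∑ Z ∈ S, ‖(nearWeight G near 𝕋₂ i₁ i₂ n₂ Z T : ℂ) * c T‖ ^ 2 ≤ K * ‖c T‖ ^ 2 := by
    intro T _
    simp only [norm_mul, Complex.norm_real, mul_pow, Real.norm_eq_abs, sq_abs]
    rw [← Finset.sum_mul]
    exact mul_le_mul_of_nonneg_right (sum_nearWeight_sq_le h1 h2 S hK hcard T) (sq_nonneg _)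
  refine (Finset.sum_le_sum this).trans ?_
  rw [← Finset.mul_sum]
  exact mul_le_mul_of_nonneg_left hc hK

lemma sum_sqrt_mul_sqrt_le {ι : Type*} (S : Finset ι) {x y : ι → ℝ} (hx : ∀ i, 0 ≤ x i)
    (hy : ∀ i, 0 ≤ y i) {K a b : ℝ} (hK : 0 ≤ K) (ha : 0 ≤ a) (hb : 0 ≤ b)
    (hX : ∑ i ∈ S, x i ≤ K * a ^ 2) (hY : ∑ i ∈ S, y i ≤ K * b ^ 2) :
    ∑ i ∈ S, Real.sqrt (x i) * Real.sqrt (y i) ≤ K * (a * b) := by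
  refine (Real.sum_mul_le_sqrt_mul_sqrt S _ _).trans ?_
  simp only [Real.sq_sqrt (hx _), Real.sq_sqrt (hy _)]
  calc Real.sqrt (∑ i ∈ S, x i) * Real.sqrt (∑ i ∈ S, y i)
      ≤ Real.sqrt (K * a ^ 2) * Real.sqrt (K * b ^ 2) := by gcongr
    _ = Real.sqrt K * Real.sqrt K * (a * b) := by
        rw [Real.sqrt_mul hK, Real.sqrt_mul hK, Real.sqrt_sq ha, Real.sqrt_sq hb]; ring
    _ = _ := by rw [Real.mul_self_sqrt hK]

/-- The bilinear estimate for wave packets at scale `ρ ^ 2` follows from the one at scale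
`ρ ^ 2 / κ`. -/
lemma TransCond.exists_combine (hdk : k ≤ d) (hk : 1 ≤ k) {Φ : (Fin d → ℝ) → Fin k → ℝ}
    (hΦ : ContDiff ℝ (⊤ : ℕ∞) Φ) {ν ν' : Fin d → ℝ} (h : TransCond Φ ν ν') (h' : TransCond Φ ν' ν) :
    ∃ r : ℝ, 0 < r ∧ r ≤ 1 ∧ ∀ M : ℕ, ∃ C : ℝ, 0 ≤ C ∧ ∀ ρ κ : ℝ, 1 ≤ κ →
      4 * κ ^ 2 ≤ ρ → ρ ^ (2 * d + k) ≤ κ ^ (2 * M) →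
      ∀ 𝕋₁ 𝕋₂ : Finset (Idx d), (∀ T ∈ 𝕋₁, ‖freq ρ T.1 - ν‖ ≤ r) →
      (∀ T ∈ 𝕋₂, ‖freq ρ T.1 - ν'‖ ≤ r) →
      ∀ (c₁ c₂ : Idx d → ℂ) (a b : ℝ), 0 ≤ a → 0 ≤ b → ∑ T ∈ 𝕋₁, ‖c₁ T‖ ^ 2 ≤ a ^ 2 →
      ∑ T ∈ 𝕋₂, ‖c₂ T‖ ^ 2 ≤ b ^ 2 → ∀ Q : ℝ, 0 ≤ Q →
      (∀ w₀ (e₁ e₂ : Idx d → ℂ) (a' b' : ℝ), 0 ≤ a' → 0 ≤ b' → ∑ T ∈ 𝕋₁, ‖e₁ T‖ ^ 2 ≤ a' ^ 2 →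
        ∑ T ∈ 𝕋₂, ‖e₂ T‖ ^ 2 ≤ b' ^ 2 →
        eLpNorm (fun w => wp Φ ρ 𝕋₁ e₁ w * wp Φ ρ 𝕋₂ e₂ w) (ENNReal.ofReal (pexp d k))
          (volume.restrict (Metric.closedBall w₀ (2 * (ρ * (ρ / κ))))) ≤
          ENNReal.ofReal (Q * (a' * b'))) →
      eLpNorm (fun w => wp Φ ρ 𝕋₁ c₁ w * wp Φ ρ 𝕋₂ c₂ w) (ENNReal.ofReal (pexp d k))
          (volume.restrict (Metric.closedBall 0 (ρ ^ 2))) ≤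
        ENNReal.ofReal ((C * κ ^ (d + k + 2 * (5 * d + k)) + 3 ^ (d + k) * Q) * (a * b)) := by
  classical
  obtain ⟨r, hr, hr1, H⟩ := h.exists_eLpNorm_far_le hdk hk hΦ
  obtain ⟨r', hr', hr1', H'⟩ := h'.exists_eLpNorm_far_le hdk hk hΦ
  refine ⟨min r r', lt_min hr hr', (min_le_left _ _).trans hr1, fun M => ?_⟩
  obtain ⟨C, hC, H⟩ := H M
  obtain ⟨C', hC', H'⟩ := H' M
  have hp := one_le_pexp (d := d) hk
  have hΦm : Measurable Φ := hΦ.continuous.measurable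
  refine ⟨7 ^ (d + k) * (C' + C), by positivity, ?_⟩
  intro ρ κ hκ hρκ hM 𝕋₁ 𝕋₂ h1 h2 c₁ c₂ a b ha hb hca hcb Q hQ hnear
  have hρ : 1 ≤ ρ := by nlinarith
  have hρ0 : 0 < ρ := by linarith
  have hκ0 : 0 < κ := by linarith
  set lam := ρ / κ with hlam
  have hlam1 : 1 ≤ lam := by rw [hlam, le_div_iff₀ hκ0]; nlinarith
  have hlam0 : 0 < lam := by linarith
  set G := gridSet d k ρ with hG
  set S := G.image (cell lam) with hS
  set near : (Fin d → ℤ) × (Fin k → ℤ) → (Fin d → ℤ) × (Fin k → ℤ) → Prop :=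
    fun z Z => nearCell (cell lam z) Z with hnearDef
  set I := incI Φ ρ κ with hI
  have hI0 : ∀ T z, 0 ≤ I T z := incI_nonneg Φ ρ κ
  set s₁ := nearWeight G near 𝕋₂ I I (fun T => ‖c₂ T‖) with hs1
  set s₂ := nearWeight G near 𝕋₁ I I (fun T => ‖c₁ T‖) with hs2
  have s10 : ∀ Z T, 0 ≤ s₁ Z T := nearWeight_nonneg hI0 hI0
  have s11 : ∀ Z T, s₁ Z T ≤ 1 := nearWeight_le_one hI0 hI0
  have s20 : ∀ Z T, 0 ≤ s₂ Z T := nearWeight_nonneg hI0 hI0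
  have s21 : ∀ Z T, s₂ Z T ≤ 1 := nearWeight_le_one hI0 hI0
  have hm := fun 𝕋 c => (continuous_wp hΦm hρ0 𝕋 c).measurable
  set E := 2 * (5 * d + k) with hE
  set x₁ := fun Z => ∑ T ∈ 𝕋₁, ‖(s₁ Z T : ℂ) * c₁ T‖ ^ 2 with hx1
  set x₂ := fun Z => ∑ T ∈ 𝕋₂, ‖(s₂ Z T : ℂ) * c₂ T‖ ^ 2 with hx2
  have hx1n : ∀ Z, 0 ≤ x₁ Z := fun Z => Finset.sum_nonneg fun _ _ => sq_nonneg _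
  have hx2n : ∀ Z, 0 ≤ x₂ Z := fun Z => Finset.sum_nonneg fun _ _ => sq_nonneg _
  have hcell : ∀ Z ∈ S, eLpNorm (fun w => wp Φ ρ 𝕋₁ c₁ w * wp Φ ρ 𝕋₂ c₂ w)
      (ENNReal.ofReal (pexp d k))
      (volume.restrict (ballUnion ρ (G.filter fun z => cell lam z = Z))) ≤
      ENNReal.ofReal (Q * (Real.sqrt (x₁ Z) * Real.sqrt (x₂ Z)) + (C' + C) * κ ^ E * (a * b)) := by
    intro Z _
    refine (eLpNorm_mul_split_le hp (wp_add_coeff Φ ρ 𝕋₁ (s₁ Z) c₁)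
      (wp_add_coeff Φ ρ 𝕋₂ (s₂ Z) c₂) (hm _ _) (hm _ _) (hm _ _) (hm _ _)).trans ?_
    have hfar : ∀ z ∈ G.filter (fun z => ¬ near z Z), ∀ z₀ ∈ G.filter (fun z => cell lam z = Z),
        lam ≤ max ‖toR z.1 - toR z₀.1‖ ‖toR z.2 - toR z₀.2‖ := by
      intro z hz z₀ hz₀
      refine le_max_of_not_nearCell hlam0 ?_
      rw [(Finset.mem_filter.1 hz₀).2]
      exact (Finset.mem_filter.1 hz).2
    have t1 := hnear (gridPt (ρ * lam) Z) (fun T => (s₁ Z T : ℂ) * c₁ T)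
      (fun T => (s₂ Z T : ℂ) * c₂ T) (Real.sqrt (x₁ Z)) (Real.sqrt (x₂ Z)) (Real.sqrt_nonneg _)
      (Real.sqrt_nonneg _) (by rw [Real.sq_sqrt (hx1n Z)]) (by rw [Real.sq_sqrt (hx2n Z)])
    have hsub : ballUnion ρ (G.filter fun z => cell lam z = Z) ⊆
        Metric.closedBall (gridPt (ρ * lam) Z) (2 * (ρ * lam)) := by
      refine Set.iUnion₂_subset fun z hz => ?_
      have := closedBall_subset_of_cell hρ0 hlam1 z
      rwa [(Finset.mem_filter.1 hz).2] at this
    have t1' := (eLpNorm_mono_measure _ (Measure.restrict_mono hsub le_rfl)).trans t1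
    have hw : ∀ (s : Idx d → ℝ) (c : Idx d → ℂ) (m m' : Idx d → ℝ) (𝕋 : Finset (Idx d)),
        (∀ T, s T ≤ 1) → (∀ T, m T * (1 - s T) ≤ m' T) →
        ∀ T ∈ 𝕋, m T * ‖((1 - s T : ℝ) : ℂ) * c T‖ ≤ m' T * ‖c T‖ := by
      intro s c m m' 𝕋 hs hmm T _
      rw [norm_mul, Complex.norm_real, Real.norm_of_nonneg (by linarith [hs T]), ← mul_assoc]
      exact mul_le_mul_of_nonneg_right (hmm T) (norm_nonneg _)
    have t2 := H' ρ κ hκ hρκ hM 𝕋₂ 𝕋₁ (fun T hT => (h2 T hT).trans (min_le_right _ _))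
      (fun T hT => (h1 T hT).trans (min_le_right _ _)) _ _ (Finset.filter_subset _ _)
      (Finset.filter_subset _ _) hfar c₂ c₁ (fun T => ((1 - s₂ Z T : ℝ) : ℂ) * c₂ T)
      (fun T => (s₁ Z T : ℂ) * c₁ T)
      (fun T => norm_ofReal_mul_le (by linarith [s21 Z T]) (by linarith [s20 Z T]) _)
      (fun T => norm_ofReal_mul_le (s10 Z T) (s11 Z T) _)
      (hw (s₂ Z) c₂ _ _ 𝕋₂ (s21 Z) (massAlong_mul_one_sub_nearWeight_le hI0 hI0 Z)) b a hb ha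
      hcb hca
    have t3 := H ρ κ hκ hρκ hM 𝕋₁ 𝕋₂ (fun T hT => (h1 T hT).trans (min_le_left _ _))
      (fun T hT => (h2 T hT).trans (min_le_left _ _)) _ _ (Finset.filter_subset _ _)
      (Finset.filter_subset _ _) hfar c₁ c₂ (fun T => ((1 - s₁ Z T : ℝ) : ℂ) * c₁ T) c₂
      (fun T => norm_ofReal_mul_le (by linarith [s11 Z T]) (by linarith [s10 Z T]) _)
      (fun T => le_rfl)
      (hw (s₁ Z) c₁ _ _ 𝕋₁ (s11 Z) (massAlong_mul_one_sub_nearWeight_le hI0 hI0 Z)) a b ha hb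
      hca hcb
    refine (add_le_add t1' (add_le_add t2 t3)).trans (le_of_eq ?_)
    rw [← ENNReal.ofReal_add (by positivity) (by positivity),
      ← ENNReal.ofReal_add (by positivity) (by positivity)]
    congr 1; ring
  have hcover : Metric.closedBall (0 : (Fin d → ℝ) × (Fin k → ℝ)) (ρ ^ 2) ⊆
      ⋃ Z ∈ S, ballUnion ρ (G.filter fun z => cell lam z = Z) := by
    intro w hw
    obtain ⟨z, hz, hwz⟩ := exists_gridPt hρ0 w hw
    exact Set.mem_iUnion₂.2 ⟨cell lam z, Finset.mem_image_of_mem _ hz,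
      Set.mem_iUnion₂.2 ⟨z, Finset.mem_filter.2 ⟨hz, rfl⟩, hwz⟩⟩
  refine (eLpNorm_mono_measure _ (Measure.restrict_mono hcover le_rfl)).trans
    ((eLpNorm_restrict_biUnion_le hp _ S _).trans ((Finset.sum_le_sum hcell).trans ?_))
  rw [← ENNReal.ofReal_sum_of_nonneg fun Z _ => by positivity]
  refine ENNReal.ofReal_le_ofReal ?_
  rw [Finset.sum_add_distrib, ← Finset.mul_sum, Finset.sum_const, nsmul_eq_mul]
  have hK : (0 : ℝ) ≤ 3 ^ (d + k) := by positivity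
  have hcn : ∀ z ∈ G, ((S.filter fun Z => near z Z).card : ℝ) ≤ 3 ^ (d + k) := fun z _ =>
    card_nearCell_le S (cell lam z)
  have hsum := sum_sqrt_mul_sqrt_le S hx1n hx2n hK ha hb
    (sum_sqrt_nearWeight_le hI0 hI0 hK hcn hca) (sum_sqrt_nearWeight_le hI0 hI0 hK hcn hcb)
  have hcardS : (S.card : ℝ) ≤ (7 * κ) ^ (d + k) := card_image_cell_le hρ hκ
  calc _ ≤ Q * (3 ^ (d + k) * (a * b)) + (7 * κ) ^ (d + k) * ((C' + C) * κ ^ E * (a * b)) := by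
        gcongr
    _ = _ := by rw [mul_pow, pow_add κ (d + k) E]; ring

end Combine

section Local
variable {d k : ℕ}

/-- Functions supported in the ball `B(ν, r)` with `L²` norm at most `a`. -/
structure Adm (ν : Fin d → ℝ) (r a : ℝ) (f : (Fin d → ℝ) → ℂ) : Prop where
  meas : AEStronglyMeasurable f
  supp : ∀ ξ, r < ‖ξ - ν‖ → f ξ = 0
  norm : ∫⁻ ξ, ‖f ξ‖ₑ ^ 2 ≤ ENNReal.ofReal (a ^ 2)

namespace Adm

variable {ν : Fin d → ℝ} {r a : ℝ} {f : (Fin d → ℝ) → ℂ}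

lemma mono (h : Adm ν r a f) {r' : ℝ} (hr : r ≤ r') : Adm ν r' a f :=
  ⟨h.meas, fun ξ hξ => h.supp ξ (hr.trans_lt hξ), h.norm⟩

lemma lintegral_enorm_le (h : Adm ν r a f) (hr : 0 ≤ r) (ha : 0 ≤ a) :
    ∫⁻ ξ, ‖f ξ‖ₑ ≤ ENNReal.ofReal (a * Real.sqrt ((2 * r) ^ d)) := by
  set G : (Fin d → ℝ) → ℂ := (Metric.closedBall ν r).indicator fun _ => 1 with hG
  have hms : MeasurableSet (Metric.closedBall ν r) := Metric.isClosed_closedBall.measurableSet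
  have h1 : ∀ ξ, f ξ = f ξ * G ξ := fun ξ => by
    by_cases hξ : ξ ∈ Metric.closedBall ν r
    · rw [hG, Set.indicator_of_mem hξ, mul_one]
    · rw [h.supp ξ (by rwa [mem_closedBall_iff_norm, not_le] at hξ), zero_mul]
  have h2 : ∫⁻ ξ, ‖G ξ‖ₑ ^ 2 ≤ ENNReal.ofReal (Real.sqrt ((2 * r) ^ d) ^ 2) := by
    have : ∀ ξ, ‖G ξ‖ₑ ^ 2 = (Metric.closedBall ν r).indicator (fun _ => 1) ξ := fun ξ => by
      by_cases hξ : ξ ∈ Metric.closedBall ν r <;> simp [hG, hξ]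
    rw [lintegral_congr this, lintegral_indicator hms, lintegral_const, Measure.restrict_apply_univ,
      Real.volume_pi_closedBall _ hr, Real.sq_sqrt (by positivity), one_mul, Fintype.card_fin]
  rw [lintegral_congr fun ξ => by rw [h1 ξ]]
  exact lintegral_enorm_mul_le h.meas.aemeasurable
    ((measurable_const.indicator hms).aemeasurable) ha (Real.sqrt_nonneg _) h.norm h2

lemma integrable (h : Adm ν r a f) (hr : 0 ≤ r) (ha : 0 ≤ a) : Integrable f :=
  ⟨h.meas, (h.lintegral_enorm_le hr ha).trans_lt ENNReal.ofReal_lt_top⟩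

lemma norm_extE_le (h : Adm ν r a f) (hr : 0 ≤ r) (ha : 0 ≤ a) (Φ : (Fin d → ℝ) → Fin k → ℝ)
    (w : (Fin d → ℝ) × (Fin k → ℝ)) : ‖extE Φ f w‖ ≤ a * Real.sqrt ((2 * r) ^ d) := by
  refine (norm_integral_le_lintegral_norm _).trans ?_
  refine ENNReal.toReal_le_of_le_ofReal (by positivity) ?_
  refine le_trans (le_of_eq ?_) (h.lintegral_enorm_le hr ha)
  refine lintegral_congr fun ξ => ?_
  rw [norm_mul, norm_ec, one_mul, ofReal_norm]

/-- Translation of the extension operator. -/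
lemma modulate (h : Adm ν r a f) {Φ : (Fin d → ℝ) → Fin k → ℝ} (hΦ : Measurable Φ)
    (c : (Fin d → ℝ) × (Fin k → ℝ)) : Adm ν r a fun ξ => ec (c.1 ⬝ᵥ ξ + c.2 ⬝ᵥ Φ ξ) * f ξ := by
  refine ⟨?_, fun ξ hξ => by rw [h.supp ξ hξ, mul_zero], ?_⟩
  · refine AEStronglyMeasurable.mul (Measurable.aestronglyMeasurable ?_) h.meas
    refine measurable_ec.comp ?_
    unfold dotProduct
    fun_prop
  · refine le_trans (le_of_eq (lintegral_congr fun ξ => ?_)) h.norm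
    rw [enorm_mul, enorm_ec, one_mul]

lemma sub (h : Adm ν r a f) {g : (Fin d → ℝ) → ℂ} {b η : ℝ} (hg : Adm ν r b g)
    (hfg : ∫⁻ ξ, ‖f ξ - g ξ‖ₑ ^ 2 ≤ ENNReal.ofReal (η ^ 2)) : Adm ν r η fun ξ => f ξ - g ξ :=
  ⟨h.meas.sub hg.meas, fun ξ hξ => by rw [h.supp ξ hξ, hg.supp ξ hξ, sub_zero], hfg⟩

end Adm

lemma extE_add_right (Φ : (Fin d → ℝ) → Fin k → ℝ) (f : (Fin d → ℝ) → ℂ)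
    (w c : (Fin d → ℝ) × (Fin k → ℝ)) :
    extE Φ f (w + c) = extE Φ (fun ξ => ec (c.1 ⬝ᵥ ξ + c.2 ⬝ᵥ Φ ξ) * f ξ) w := by
  unfold extE
  refine integral_congr_ae (ae_of_all _ fun ξ => ?_)
  simp only [Prod.fst_add, Prod.snd_add, add_dotProduct]
  rw [← mul_assoc, ← ec_add]
  congr 2
  ring

lemma extE_sub {Φ : (Fin d → ℝ) → Fin k → ℝ} (hΦ : Measurable Φ) {f g : (Fin d → ℝ) → ℂ}
    (hf : Integrable f) (hg : Integrable g) (w : (Fin d → ℝ) × (Fin k → ℝ)) :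
    extE Φ (fun ξ => f ξ - g ξ) w = extE Φ f w - extE Φ g w := by
  unfold extE
  rw [← integral_sub (integrable_ec_mul hΦ hf w) (integrable_ec_mul hΦ hg w)]
  simp only [mul_sub]

lemma volume_closedBall_prod (w : (Fin d → ℝ) × (Fin k → ℝ)) {R : ℝ} (hR : 0 ≤ R) :
    volume (Metric.closedBall w R) = ENNReal.ofReal ((2 * R) ^ (d + k)) := by
  rw [← Prod.mk.eta (p := w), ← closedBall_prod_same, Measure.volume_eq_prod, Measure.prod_prod,
    Real.volume_pi_closedBall _ hR, Real.volume_pi_closedBall _ hR, Fintype.card_fin,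
    Fintype.card_fin, ← ENNReal.ofReal_mul (by positivity), pow_add]

lemma eLpNorm_translate {F : (Fin d → ℝ) × (Fin k → ℝ) → ℂ} (hF : Continuous F) (p : ℝ≥0∞)
    (c : (Fin d → ℝ) × (Fin k → ℝ)) (R : ℝ) :
    eLpNorm F p (volume.restrict (Metric.closedBall c R)) =
      eLpNorm (fun w => F (w + c)) p (volume.restrict (Metric.closedBall 0 R)) := by
  have h1 : MeasurePreserving (fun w : (Fin d → ℝ) × (Fin k → ℝ) => w + c) volume volume :=
    measurePreserving_add_right
      ((volume : Measure (Fin d → ℝ)).prod (volume : Measure (Fin k → ℝ))) c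
  have h2 := h1.restrict_preimage (s := Metric.closedBall c R)
    Metric.isClosed_closedBall.measurableSet
  have h3 : (fun w : (Fin d → ℝ) × (Fin k → ℝ) => w + c) ⁻¹' Metric.closedBall c R =
      Metric.closedBall 0 R := by
    ext w
    simp
  rw [h3] at h2
  exact (eLpNorm_comp_measurePreserving hF.aestronglyMeasurable h2).symm

/-- The local bilinear estimate with loss `R ^ α`, for functions supported in balls of
radius `r` about `ν` and `ν'`. -/
def LocBil (Φ : (Fin d → ℝ) → Fin k → ℝ) (ν ν' : Fin d → ℝ) (r α : ℝ) : Prop :=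
  ∃ C : ℝ, 0 ≤ C ∧ ∀ R : ℝ, 1 ≤ R → ∀ (a b : ℝ), 0 ≤ a → 0 ≤ b →
    ∀ f g : (Fin d → ℝ) → ℂ, Adm ν r a f → Adm ν' r b g → ∀ w₀,
    eLpNorm (fun w => extE Φ f w * extE Φ g w) (ENNReal.ofReal (pexp d k))
      (volume.restrict (Metric.closedBall w₀ R)) ≤ ENNReal.ofReal (C * R ^ α * (a * b))

lemma eLpNorm_extE_mul_le_trivial (hk : 1 ≤ k) (Φ : (Fin d → ℝ) → Fin k → ℝ) {ν ν' : Fin d → ℝ}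
    {r a b R : ℝ} (hr : 0 ≤ r) (hR : 1 ≤ R) (ha : 0 ≤ a) (hb : 0 ≤ b) {f g : (Fin d → ℝ) → ℂ}
    (hf : Adm ν r a f) (hg : Adm ν' r b g) (w₀ : (Fin d → ℝ) × (Fin k → ℝ)) :
    eLpNorm (fun w => extE Φ f w * extE Φ g w) (ENNReal.ofReal (pexp d k))
      (volume.restrict (Metric.closedBall w₀ R)) ≤
      ENNReal.ofReal ((2 * R) ^ (d + k) * (2 * r) ^ d * (a * b)) := by
  have hp := one_le_pexp (d := d) hk
  have hb1 : ∀ w, ‖extE Φ f w * extE Φ g w‖ ≤ (2 * r) ^ d * (a * b) := fun w => by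
    rw [norm_mul]
    refine (mul_le_mul (hf.norm_extE_le hr ha Φ w) (hg.norm_extE_le hr hb Φ w) (norm_nonneg _)
      (by positivity)).trans (le_of_eq ?_)
    have := Real.mul_self_sqrt (show 0 ≤ (2 * r) ^ d by positivity)
    linear_combination a * b * this
  refine (eLpNorm_le_of_ae_bound (ae_of_all _ hb1)).trans ?_
  rw [Measure.restrict_apply_univ, volume_closedBall_prod _ (by linarith), mul_assoc,
    ENNReal.ofReal_mul (p := (2 * R) ^ (d + k)) (by positivity),
    ENNReal.toReal_ofReal (by linarith)]
  gcongr
  have h1 : (1 : ℝ) ≤ (2 * R) ^ (d + k) := one_le_pow₀ (by linarith)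
  calc ENNReal.ofReal ((2 * R) ^ (d + k)) ^ (pexp d k)⁻¹
      ≤ ENNReal.ofReal ((2 * R) ^ (d + k)) ^ (1 : ℝ) :=
        ENNReal.rpow_le_rpow_of_exponent_le (by rwa [← ENNReal.ofReal_one,
          ENNReal.ofReal_le_ofReal_iff (by positivity)]) (inv_le_one_of_one_le₀ hp)
    _ = _ := ENNReal.rpow_one _

lemma LocBil.mono {Φ : (Fin d → ℝ) → Fin k → ℝ} {ν ν' : Fin d → ℝ} {r r' α α' : ℝ}
    (h : LocBil Φ ν ν' r α) (hr : r' ≤ r) (hα : α ≤ α') : LocBil Φ ν ν' r' α' := by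
  obtain ⟨C, hC, h⟩ := h
  refine ⟨C, hC, fun R hR a b ha hb f g hf hg w₀ =>
    (h R hR a b ha hb f g (hf.mono hr) (hg.mono hr) w₀).trans ?_⟩
  gcongr

lemma locBil_trivial (hk : 1 ≤ k) (Φ : (Fin d → ℝ) → Fin k → ℝ) (ν ν' : Fin d → ℝ) {r : ℝ}
    (hr : 0 ≤ r) : LocBil Φ ν ν' r ((d + k : ℕ) : ℝ) := by
  refine ⟨2 ^ (d + k) * (2 * r) ^ d, by positivity, fun R hR a b ha hb f g hf hg w₀ => ?_⟩
  refine (eLpNorm_extE_mul_le_trivial hk Φ hr hR ha hb hf hg w₀).trans (le_of_eq ?_)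
  rw [Real.rpow_natCast, mul_pow]
  congr 1
  ring

end Local

section Step
variable {d k : ℕ}

lemma adm_synth {ρ : ℝ} (hρ : 0 < ρ) {ν : Fin d → ℝ} {s a : ℝ} {𝕋 : Finset (Idx d)}
    (hT : ∀ T ∈ 𝕋, ‖freq ρ T.1 - ν‖ ≤ s) {c : Idx d → ℂ} (hc : ∑ T ∈ 𝕋, ‖c T‖ ^ 2 ≤ a ^ 2) :
    Adm ν (s + 1 / (2 * ρ)) (Real.sqrt (3 ^ d) * a) (synth ρ 𝕋 c) := by
  refine ⟨(continuous_synth ρ 𝕋 c).aestronglyMeasurable, fun ξ hξ => ?_, ?_⟩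
  · refine Finset.sum_eq_zero fun T hTm => ?_
    rw [packet_eq_zero hρ, mul_zero]
    have h1 := hT T hTm
    have h2 : ‖ξ - ν‖ ≤ ‖ξ - freq ρ T.1‖ + ‖freq ρ T.1 - ν‖ := norm_sub_le_norm_sub_add_norm_sub ..
    linarith
  · refine (lintegral_synth_sq_le hρ 𝕋 c).trans (ENNReal.ofReal_le_ofReal ?_)
    rw [mul_pow, Real.sq_sqrt (by positivity)]
    gcongr

lemma eLpNorm_extE_mul_le_of_approx (hk : 1 ≤ k) {Φ : (Fin d → ℝ) → Fin k → ℝ} (hΦ : Measurable Φ)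
    {ν ν' : Fin d → ℝ} {r A B R : ℝ} (hr : 0 ≤ r) (hR : 1 ≤ R) (hA : 0 ≤ A) (hB : 0 ≤ B)
    {f g : (Fin d → ℝ) → ℂ} (hf : Adm ν r A f) (hg : Adm ν' r B g)
    (w₀ : (Fin d → ℝ) × (Fin k → ℝ)) {X : ℝ≥0∞}
    (h : ∀ η : ℝ, 0 < η → ∃ s t : (Fin d → ℝ) → ℂ, Adm ν r A s ∧ Adm ν' r B t ∧
      ∫⁻ ξ, ‖f ξ - s ξ‖ₑ ^ 2 ≤ ENNReal.ofReal (η ^ 2) ∧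
      ∫⁻ ξ, ‖g ξ - t ξ‖ₑ ^ 2 ≤ ENNReal.ofReal (η ^ 2) ∧
      eLpNorm (fun w => extE Φ s w * extE Φ t w) (ENNReal.ofReal (pexp d k))
        (volume.restrict (Metric.closedBall w₀ R)) ≤ X) :
    eLpNorm (fun w => extE Φ f w * extE Φ g w) (ENNReal.ofReal (pexp d k))
      (volume.restrict (Metric.closedBall w₀ R)) ≤ X := by
  have hp : 1 ≤ ENNReal.ofReal (pexp d k) := by
    rw [← ENNReal.ofReal_one]; exact ENNReal.ofReal_le_ofReal (one_le_pexp hk)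
  set K := (2 * R) ^ (d + k) * (2 * r) ^ d with hK
  have hK0 : 0 ≤ K := by positivity
  have key : ∀ η : ℝ, 0 < η → eLpNorm (fun w => extE Φ f w * extE Φ g w)
      (ENNReal.ofReal (pexp d k)) (volume.restrict (Metric.closedBall w₀ R)) ≤
      X + ENNReal.ofReal (K * (A + B) * η) := by
    intro η hη
    obtain ⟨s, t, hs, ht, hfs, hgt, hX⟩ := h η hη
    have hif := hf.integrable hr hA
    have hig := hg.integrable hr hB
    have his := hs.integrable hr hA
    have hit := ht.integrable hr hB
    have h1 := hf.sub hs hfs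
    have h2 := hg.sub ht hgt
    have e : (fun w => extE Φ f w * extE Φ g w) = fun w => (extE Φ s w * extE Φ t w) +
        ((extE Φ (fun ξ => f ξ - s ξ) w * extE Φ g w) +
          (extE Φ s w * extE Φ (fun ξ => g ξ - t ξ) w)) := by
      funext w
      rw [extE_sub hΦ hif his, extE_sub hΦ hig hit]
      ring
    have cf := continuous_extE hΦ (h1.integrable hr hη.le)
    have cg := continuous_extE hΦ (h2.integrable hr hη.le)
    have cs := continuous_extE hΦ his
    have ct := continuous_extE hΦ hit
    have cg' := continuous_extE hΦ hig
    rw [e]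
    refine (eLpNorm_add_le (cs.mul ct).aestronglyMeasurable
      ((cf.mul cg').add (cs.mul cg)).aestronglyMeasurable hp).trans (add_le_add hX ?_)
    refine (eLpNorm_add_le (cf.mul cg').aestronglyMeasurable
      (cs.mul cg).aestronglyMeasurable hp).trans ?_
    refine (add_le_add (eLpNorm_extE_mul_le_trivial hk Φ hr hR hη.le hB h1 hg w₀)
      (eLpNorm_extE_mul_le_trivial hk Φ hr hR hA hη.le hs h2 w₀)).trans (le_of_eq ?_)
    rw [← ENNReal.ofReal_add (by positivity) (by positivity)]
    congr 1
    ring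
  have hlim : Filter.Tendsto (fun η : ℝ => X + ENNReal.ofReal (K * (A + B) * η))
      (nhdsWithin 0 (Set.Ioi 0)) (nhds (X + ENNReal.ofReal (K * (A + B) * 0))) := by
    refine Filter.Tendsto.mono_left ?_ nhdsWithin_le_nhds
    refine tendsto_const_nhds.add (ENNReal.tendsto_ofReal ?_)
    exact (continuous_const.mul continuous_id).tendsto 0
  rw [mul_zero, ENNReal.ofReal_zero, add_zero] at hlim
  exact ge_of_tendsto hlim (Filter.eventually_of_mem self_mem_nhdsWithin fun η hη => key η hη)

/-- Wave packet approximation of admissible functions. -/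
lemma Adm.exists_synth {ν : Fin d → ℝ} {r a : ℝ} {f : (Fin d → ℝ) → ℂ} (h : Adm ν r a f) (hr : 0 ≤ r)
    {ρ : ℝ} (hρ : 0 < ρ) {η : ℝ} (hη : 0 < η) :
    ∃ (𝕋 : Finset (Idx d)) (c : Idx d → ℂ), (∀ T ∈ 𝕋, ‖freq ρ T.1 - ν‖ ≤ r + 1 / ρ) ∧
      ∫⁻ ξ, ‖f ξ - synth ρ 𝕋 c ξ‖ₑ ^ 2 ≤ ENNReal.ofReal (η ^ 2) ∧
      ∑ T ∈ 𝕋, ‖c T‖ ^ 2 ≤ a ^ 2 := by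
  obtain ⟨𝕋, c, h1, h2, h3⟩ := exists_synth_approx h.meas (h.norm.trans_lt ENNReal.ofReal_lt_top)
    hρ hr h.supp (η := ENNReal.ofReal (η ^ 2)) (ENNReal.ofReal_pos.2 (by positivity))
  exact ⟨𝕋, c, h1, h2, (ENNReal.ofReal_le_ofReal_iff (sq_nonneg a)).1 (h3.trans h.norm)⟩

/-- Parameter bookkeeping for the induction on scales. -/
lemma rpow_step_le {R ε α β : ℝ} (E : ℕ) (hR : 1 ≤ R) (h1 : α * (1 - ε / 2) ≤ β)
    (h2 : E * (ε / 2) ≤ β) {C A D ρ κ : ℝ} (hC : 0 ≤ C) (hA : 0 ≤ A) (hD : 0 ≤ D)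
    (hρ : ρ = R ^ (1 / 2 : ℝ)) (hκ : κ = R ^ (ε / 2)) :
    C * κ ^ E + D * (A * (2 * (ρ * (ρ / κ))) ^ α) ≤ (C + D * (A * 2 ^ α)) * R ^ β := by
  have hR0 : 0 < R := by linarith
  have e1 : κ ^ E = R ^ (E * (ε / 2)) := by
    rw [hκ, ← Real.rpow_natCast, ← Real.rpow_mul hR0.le, mul_comm]
  have e2 : ρ * (ρ / κ) = R ^ (1 - ε / 2) := by
    rw [hρ, hκ, ← mul_div_assoc, ← Real.rpow_add hR0, ← Real.rpow_sub hR0]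
    congr 1; ring
  have e3 : (2 * (ρ * (ρ / κ))) ^ α = 2 ^ α * R ^ (α * (1 - ε / 2)) := by
    rw [e2, Real.mul_rpow (by norm_num) (by positivity), ← Real.rpow_mul hR0.le, mul_comm α]
  have i1 := Real.rpow_le_rpow_of_exponent_le hR h1
  have i2 := Real.rpow_le_rpow_of_exponent_le hR h2
  rw [e1, e3, add_mul]
  have : 0 < (2 : ℝ) ^ α := by positivity
  calc C * R ^ (E * (ε / 2)) + D * (A * (2 ^ α * R ^ (α * (1 - ε / 2))))
      ≤ C * R ^ β + D * (A * (2 ^ α * R ^ β)) := by gcongr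
    _ = _ := by ring

end Step

section Induct
variable {d k : ℕ}

lemma Adm.mono_norm {ν : Fin d → ℝ} {r a b : ℝ} {f : (Fin d → ℝ) → ℂ} (h : Adm ν r a f)
    (ha : 0 ≤ a) (hab : a ≤ b) : Adm ν r b f :=
  ⟨h.meas, h.supp, h.norm.trans (ENNReal.ofReal_le_ofReal (by gcongr))⟩

/-- It suffices to treat balls centred at the origin and large radii. -/
lemma locBil_of_large (hk : 1 ≤ k) {Φ : (Fin d → ℝ) → Fin k → ℝ} (hΦ : Measurable Φ)
    {ν ν' : Fin d → ℝ} {r β R₁ C : ℝ} (hr : 0 ≤ r) (hβ : 0 ≤ β) (hR₁ : 1 ≤ R₁) (hC : 0 ≤ C)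
    (h : ∀ R, R₁ ≤ R → ∀ (a b : ℝ), 0 ≤ a → 0 ≤ b →
      ∀ f g : (Fin d → ℝ) → ℂ, Adm ν r a f → Adm ν' r b g →
      eLpNorm (fun w => extE Φ f w * extE Φ g w) (ENNReal.ofReal (pexp d k))
        (volume.restrict (Metric.closedBall 0 R)) ≤ ENNReal.ofReal (C * R ^ β * (a * b))) :
    LocBil Φ ν ν' r β := by
  refine ⟨C + (2 * R₁) ^ (d + k) * (2 * r) ^ d, by positivity,
    fun R hR a b ha hb f g hf hg w₀ => ?_⟩
  have h1 : 1 ≤ R ^ β := Real.one_le_rpow hR hβ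
  have hK : 0 ≤ (2 * R₁) ^ (d + k) * (2 * r) ^ d := by positivity
  have hab : 0 ≤ a * b := by positivity
  rcases le_total R₁ R with hR' | hR'
  · have cf := continuous_extE hΦ (hf.integrable hr ha)
    have cg := continuous_extE hΦ (hg.integrable hr hb)
    rw [eLpNorm_translate (F := fun w => extE Φ f w * extE Φ g w) (cf.mul cg)]
    simp only [extE_add_right]
    refine (h R hR' a b ha hb _ _ (hf.modulate hΦ w₀) (hg.modulate hΦ w₀)).trans
      (ENNReal.ofReal_le_ofReal ?_)
    gcongr
    linarith
  · refine (eLpNorm_extE_mul_le_trivial hk Φ hr hR ha hb hf hg w₀).trans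
      (ENNReal.ofReal_le_ofReal ?_)
    refine mul_le_mul_of_nonneg_right ?_ hab
    calc (2 * R) ^ (d + k) * (2 * r) ^ d ≤ (2 * R₁) ^ (d + k) * (2 * r) ^ d * 1 := by
          rw [mul_one]; gcongr
      _ ≤ (2 * R₁) ^ (d + k) * (2 * r) ^ d * R ^ β := by gcongr
      _ ≤ _ := by
          have : 0 ≤ C * R ^ β := by positivity
          nlinarith

/-- Admissible choice of scales in the induction step. -/
lemma step_scales {R ε : ℝ} (hR : 256 ≤ R) (hε : 0 < ε) (hε' : ε ≤ 1 / 4) (n : ℕ) {M : ℕ}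
    (hM : n / (2 * ε) ≤ M) :
    1 ≤ R ^ (ε / 2) ∧ 4 * (R ^ (ε / 2)) ^ 2 ≤ R ^ (1 / 2 : ℝ) ∧
      (R ^ (1 / 2 : ℝ)) ^ n ≤ (R ^ (ε / 2)) ^ (2 * M) := by
  have hR1 : 1 ≤ R := by linarith
  have hR0 : 0 < R := by linarith
  refine ⟨Real.one_le_rpow hR1 (by positivity), ?_, ?_⟩
  · have h4 : (4 : ℝ) ≤ R ^ (1 / 4 : ℝ) := by
      have h1 : (256 : ℝ) ^ (1 / 4 : ℝ) = 4 := by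
        rw [show (256 : ℝ) = 4 ^ (4 : ℝ) by norm_num,
          ← Real.rpow_mul (by norm_num : (0 : ℝ) ≤ 4)]
        norm_num
      exact h1.symm.le.trans (Real.rpow_le_rpow (by norm_num) hR (by norm_num))
    have h5 : (R ^ (ε / 2)) ^ 2 ≤ R ^ (1 / 4 : ℝ) := by
      rw [← Real.rpow_natCast, ← Real.rpow_mul hR0.le]
      refine Real.rpow_le_rpow_of_exponent_le hR1 ?_
      push_cast; linarith
    have h6 : R ^ (1 / 2 : ℝ) = R ^ (1 / 4 : ℝ) * R ^ (1 / 4 : ℝ) := by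
      rw [← Real.rpow_add hR0]; norm_num
    rw [h6]
    exact mul_le_mul h4 h5 (by positivity) (by positivity)
  · rw [← Real.rpow_natCast, ← Real.rpow_natCast, ← Real.rpow_mul hR0.le, ← Real.rpow_mul hR0.le]
    refine Real.rpow_le_rpow_of_exponent_le hR1 ?_
    rw [div_le_iff₀ (by positivity)] at hM
    push_cast; linarith

/-- The induction-on-scales step. -/
lemma TransCond.exists_step (hdk : k ≤ d) (hk : 1 ≤ k) {Φ : (Fin d → ℝ) → Fin k → ℝ}
    (hΦ : ContDiff ℝ (⊤ : ℕ∞) Φ) {ν ν' : Fin d → ℝ} (h : TransCond Φ ν ν') (h' : TransCond Φ ν' ν) :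
    ∃ r₀ : ℝ, 0 < r₀ ∧ ∀ ε r α β : ℝ, 0 < ε → ε ≤ 1 / 4 → 0 < r → r ≤ r₀ → 0 ≤ α → 0 ≤ β →
      α * (1 - ε / 2) ≤ β → ((d + k + 2 * (5 * d + k) : ℕ) : ℝ) * (ε / 2) ≤ β →
      LocBil Φ ν ν' r α → LocBil Φ ν ν' (r / 2) β := by
  obtain ⟨r₀, hr₀, -, H⟩ := TransCond.exists_combine hdk hk hΦ h h'
  have hΦm : Measurable Φ := hΦ.continuous.measurable
  refine ⟨r₀, hr₀, fun ε r α β hε hε' hr hrr hα hβ hαβ hEβ ⟨Q₀, hQ₀, hQ⟩ => ?_⟩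
  obtain ⟨M, hM⟩ := exists_nat_ge (((2 * d + k : ℕ) : ℝ) / (2 * ε))
  obtain ⟨C, hC, H⟩ := H M
  set D : ℝ := 3 ^ (d + k) with hD
  have hD0 : 0 ≤ D := by positivity
  have hs3 : 1 ≤ Real.sqrt (3 ^ d) := by
    rw [Real.one_le_sqrt]; exact one_le_pow₀ (by norm_num)
  have hs3' : Real.sqrt (3 ^ d) * Real.sqrt (3 ^ d) = 3 ^ d := Real.mul_self_sqrt (by positivity)
  refine locBil_of_large (R₁ := max 256 ((3 / r) ^ 2)) (C := C + D * (Q₀ * 3 ^ d * 2 ^ α)) hk hΦm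
    (by positivity) hβ (by have := le_max_left 256 ((3 / r) ^ 2); linarith) (by positivity)
    fun R hR a b ha hb f g hf hg => ?_
  have hR256 : 256 ≤ R := (le_max_left _ _).trans hR
  have hRr : (3 / r) ^ 2 ≤ R := (le_max_right _ _).trans hR
  have hR0 : 0 < R := by linarith
  obtain ⟨hκ1, hκρ, hκM⟩ := step_scales hR256 hε hε' (2 * d + k) hM
  have hfin := rpow_step_le (ε := ε) (α := α) (β := β) (C := C) (A := Q₀ * 3 ^ d) (D := D)
    (d + k + 2 * (5 * d + k)) (by linarith : (1 : ℝ) ≤ R) hαβ hEβ hC (by positivity) hD0 rfl rfl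
  set ρ := R ^ (1 / 2 : ℝ) with hρ
  set κ := R ^ (ε / 2) with hκ
  have hρ2 : ρ ^ 2 = R := by
    rw [hρ, ← Real.rpow_natCast, ← Real.rpow_mul hR0.le]; norm_num
  have hρ0 : 0 < ρ := by positivity
  have hκ0 : 0 < κ := by linarith
  have hρr : 3 / r ≤ ρ := by
    refine le_of_sq_le_sq ?_ hρ0.le
    rwa [hρ2]
  have hρr' : 1 / ρ ≤ r / 3 := by
    rw [div_le_iff₀ hr] at hρr
    rw [div_le_iff₀ hρ0]; linarith
  have hρr'' : r / 2 + 1 / ρ + 1 / (2 * ρ) ≤ r := by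
    have : 1 / (2 * ρ) = 1 / ρ / 2 := by field_simp
    rw [this]; linarith
  have hκρ' : κ ≤ ρ := by nlinarith
  have hbig : 1 ≤ 2 * (ρ * (ρ / κ)) := by
    have h1 : 1 ≤ ρ / κ := by rwa [one_le_div hκ0]
    nlinarith
  have hadm : ∀ {μ : Fin d → ℝ} {𝕋 : Finset (Idx d)} {c : Idx d → ℂ} {a : ℝ},
      (∀ T ∈ 𝕋, ‖freq ρ T.1 - μ‖ ≤ r / 2 + 1 / ρ) → ∑ T ∈ 𝕋, ‖c T‖ ^ 2 ≤ a ^ 2 →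
      Adm μ r (Real.sqrt (3 ^ d) * a) (synth ρ 𝕋 c) := fun hT hc => (adm_synth hρ0 hT hc).mono hρr''
  have hgrow : ∀ {a : ℝ}, 0 ≤ a → a ≤ Real.sqrt (3 ^ d) * a := fun ha =>
    le_mul_of_one_le_left ha hs3
  refine eLpNorm_extE_mul_le_of_approx hk hΦm hr.le (by linarith)
    (by positivity : 0 ≤ Real.sqrt (3 ^ d) * a) (by positivity : 0 ≤ Real.sqrt (3 ^ d) * b)
    ((hf.mono (by linarith)).mono_norm ha (hgrow ha))
    ((hg.mono (by linarith)).mono_norm hb (hgrow hb)) 0 fun η hη => ?_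
  obtain ⟨𝕋₁, c₁, hT₁, he₁, hc₁⟩ := hf.exists_synth (by positivity) hρ0 hη
  obtain ⟨𝕋₂, c₂, hT₂, he₂, hc₂⟩ := hg.exists_synth (by positivity) hρ0 hη
  refine ⟨_, _, hadm hT₁ hc₁, hadm hT₂ hc₂, he₁, he₂, ?_⟩
  have key := H ρ κ hκ1 hκρ hκM 𝕋₁ 𝕋₂ (fun T hT => (hT₁ T hT).trans (by linarith))
    (fun T hT => (hT₂ T hT).trans (by linarith)) c₁ c₂ a b ha hb hc₁ hc₂
    (Q₀ * 3 ^ d * (2 * (ρ * (ρ / κ))) ^ α) (by positivity) fun w₀ e₁ e₂ a' b' ha' hb' h1 h2 => by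
      rw [wp_eq_extE hΦm hρ0, wp_eq_extE hΦm hρ0]
      refine (hQ _ hbig _ _ (by positivity) (by positivity) _ _ (hadm hT₁ h1) (hadm hT₂ h2)
        w₀).trans (le_of_eq ?_)
      congr 1
      linear_combination Q₀ * (2 * (ρ * (ρ / κ))) ^ α * (a' * b') * hs3'
  rw [wp_eq_extE hΦm hρ0, wp_eq_extE hΦm hρ0, hρ2] at key
  refine key.trans (ENNReal.ofReal_le_ofReal ?_)
  exact mul_le_mul_of_nonneg_right hfin (by positivity)

/-- The local bilinear estimate with arbitrarily small loss near a transversal pair. -/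
lemma TransCond.exists_locBil (hdk : k ≤ d) (hk : 1 ≤ k) {Φ : (Fin d → ℝ) → Fin k → ℝ}
    (hΦ : ContDiff ℝ (⊤ : ℕ∞) Φ) {ν ν' : Fin d → ℝ} (h : TransCond Φ ν ν') (h' : TransCond Φ ν' ν)
    {β : ℝ} (hβ : 0 < β) : ∃ r : ℝ, 0 < r ∧ LocBil Φ ν ν' r β := by
  obtain ⟨r₀, hr₀, H⟩ := TransCond.exists_step hdk hk hΦ h h'
  set E : ℝ := ((d + k + 2 * (5 * d + k) : ℕ) : ℝ) with hE
  have hE0 : 0 < E := by rw [hE]; exact_mod_cast (by omega)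
  set ε := min (1 / 4) (2 * β / E) with hεd
  have hε : 0 < ε := lt_min (by norm_num) (by positivity)
  have hε4 : ε ≤ 1 / 4 := min_le_left _ _
  have hεE : E * (ε / 2) ≤ β := by
    have : ε ≤ 2 * β / E := min_le_right _ _
    rw [le_div_iff₀ hE0] at this
    linarith
  set q := 1 - ε / 2 with hq
  have hq0 : 0 ≤ q := by linarith
  have hq1 : q < 1 := by linarith
  have iter : ∀ n : ℕ, LocBil Φ ν ν' (r₀ / 2 ^ n) (max β (((d + k : ℕ) : ℝ) * q ^ n)) := by
    intro n
    induction n with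
    | zero => exact (locBil_trivial hk Φ ν ν' (r := r₀ / 2 ^ 0) (by positivity)).mono le_rfl (by simp)
    | succ n ih =>
      have hm : 0 ≤ max β (((d + k : ℕ) : ℝ) * q ^ n) := le_max_of_le_left hβ.le
      have := H ε (r₀ / 2 ^ n) _ (max β (((d + k : ℕ) : ℝ) * q ^ (n + 1))) hε hε4 (by positivity)
        (div_le_self hr₀.le (one_le_pow₀ (by norm_num))) hm (le_max_of_le_left hβ.le)
        (by
          rw [max_mul_of_nonneg _ _ hq0]
          refine max_le_max (mul_le_of_le_one_right hβ.le hq1.le) (le_of_eq (by ring)))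
        (hεE.trans (le_max_left _ _)) ih
      rwa [div_div, ← pow_succ] at this
  obtain ⟨n, hn⟩ := ((tendsto_pow_atTop_nhds_zero_of_lt_one hq0 hq1).const_mul
    (((d + k : ℕ) : ℝ))).eventually (gt_mem_nhds
      (show ((d + k : ℕ) : ℝ) * 0 < β by rwa [mul_zero])) |>.exists
  exact ⟨r₀ / 2 ^ n, by positivity, (iter n).mono le_rfl (max_le le_rfl hn.le)⟩

end Induct

section Globalize
variable {d k : ℕ}

/-- The restriction of `f` to a frequency cell. -/
def cellPart (ρ : ℝ) (f : (Fin d → ℝ) → ℂ) (q : Fin d → ℤ) : (Fin d → ℝ) → ℂ :=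
  {ξ | cellIdx ρ ξ = q}.indicator f

lemma cellPart_apply (ρ : ℝ) (f : (Fin d → ℝ) → ℂ) (q : Fin d → ℤ) (ξ : Fin d → ℝ) :
    cellPart ρ f q ξ = if cellIdx ρ ξ = q then f ξ else 0 := by
  classical
  rw [cellPart, Set.indicator_apply]
  rfl

lemma aestronglyMeasurable_cellPart {ρ : ℝ} {f : (Fin d → ℝ) → ℂ} (hf : AEStronglyMeasurable f)
    (q : Fin d → ℤ) : AEStronglyMeasurable (cellPart ρ f q) :=
  hf.indicator (measurable_cellIdx ρ (measurableSet_singleton q))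

lemma lintegral_cellPart_le (ρ : ℝ) (f : (Fin d → ℝ) → ℂ) (q : Fin d → ℤ) :
    ∫⁻ ξ, ‖cellPart ρ f q ξ‖ₑ ^ 2 ≤ ∫⁻ ξ, ‖f ξ‖ₑ ^ 2 := by
  refine lintegral_mono fun ξ => ?_
  rw [cellPart_apply]
  split_ifs <;> simp

lemma IsCompact.exists_cells {S : Set (Fin d → ℝ)} (hS : IsCompact S) {ρ : ℝ} (hρ : 0 < ρ) :
    ∃ N : Finset (Fin d → ℤ), ∀ ξ ∈ S, cellIdx ρ ξ ∈ N := by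
  obtain ⟨B, hB⟩ := hS.isBounded.exists_norm_le
  refine ⟨freqSet ρ 0 (|B| + 1 / ρ), fun ξ hξ => (mem_freqSet hρ (by positivity)).2 ?_⟩
  have h1 := norm_sub_cellIdx_le hρ ξ
  have h2 : ‖freq ρ (cellIdx ρ ξ)‖ ≤ ‖ξ‖ + ‖ξ - freq ρ (cellIdx ρ ξ)‖ := by
    calc ‖freq ρ (cellIdx ρ ξ)‖ = ‖ξ - (ξ - freq ρ (cellIdx ρ ξ))‖ := by congr 1; abel
      _ ≤ _ := norm_sub_le _ _
  rw [sub_zero]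
  linarith [hB ξ hξ, le_abs_self B]

lemma norm_sub_le_of_cellIdx_eq {ρ : ℝ} (hρ : 0 < ρ) {ξ ξ' : Fin d → ℝ}
    (h : cellIdx ρ ξ = cellIdx ρ ξ') : ‖ξ - ξ'‖ ≤ 2 / ρ := by
  have h1 := norm_sub_cellIdx_le hρ ξ
  have h2 := norm_sub_cellIdx_le hρ ξ'
  rw [← h, norm_sub_rev] at h2
  have h3 := norm_sub_le_norm_sub_add_norm_sub ξ (freq ρ (cellIdx ρ ξ)) ξ'
  calc ‖ξ - ξ'‖ ≤ 1 / ρ + 1 / ρ := by linarith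
    _ = _ := by ring

lemma extE_eq_sum_cellPart {Φ : (Fin d → ℝ) → Fin k → ℝ} (hΦ : Measurable Φ) {ρ : ℝ}
    {S : Set (Fin d → ℝ)} {N : Finset (Fin d → ℤ)} (hN : ∀ ξ ∈ S, cellIdx ρ ξ ∈ N)
    {f : (Fin d → ℝ) → ℂ} (hf : Integrable f) (hfS : ∀ ξ, ξ ∉ S → f ξ = 0)
    (w : (Fin d → ℝ) × (Fin k → ℝ)) :
    extE Φ f w = ∑ q ∈ N, extE Φ (cellPart ρ f q) w := by
  have hint : ∀ q, Integrable (cellPart ρ f q) := fun q =>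
    hf.indicator (measurable_cellIdx ρ (measurableSet_singleton q))
  unfold extE
  rw [← integral_finsetSum _ fun q _ => integrable_ec_mul hΦ (hint q) w]
  refine integral_congr_ae (ae_of_all _ fun ξ => ?_)
  simp only
  rw [← Finset.mul_sum]
  congr 1
  simp only [cellPart_apply]
  rw [Finset.sum_ite_eq]
  split_ifs with h
  · rfl
  · exact hfS ξ fun hξ => h (hN ξ hξ)

/-- Passage from local bilinear estimates to compact sets. -/
lemma exists_bilinear_of_locBil (hk : 1 ≤ k) {Φ : (Fin d → ℝ) → Fin k → ℝ} (hΦ : Measurable Φ)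
    {S S' : Set (Fin d → ℝ)} (hS : IsCompact S) (hS' : IsCompact S') {α : ℝ}
    (h : ∀ ν ∈ S, ∀ ν' ∈ S', ∃ r : ℝ, 0 < r ∧ LocBil Φ ν ν' r α) :
    ∃ C : ℝ, 0 ≤ C ∧ ∀ R : ℝ, 1 ≤ R → ∀ (a b : ℝ), 0 ≤ a → 0 ≤ b →
      ∀ f g : (Fin d → ℝ) → ℂ, AEStronglyMeasurable f → AEStronglyMeasurable g →
      (∀ ξ, ξ ∉ S → f ξ = 0) → (∀ ξ, ξ ∉ S' → g ξ = 0) →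
      ∫⁻ ξ, ‖f ξ‖ₑ ^ 2 ≤ ENNReal.ofReal (a ^ 2) → ∫⁻ ξ, ‖g ξ‖ₑ ^ 2 ≤ ENNReal.ofReal (b ^ 2) → ∀ w₀,
      eLpNorm (fun w => extE Φ f w * extE Φ g w) (ENNReal.ofReal (pexp d k))
        (volume.restrict (Metric.closedBall w₀ R)) ≤ ENNReal.ofReal (C * R ^ α * (a * b)) := by
  have hp : 1 ≤ ENNReal.ofReal (pexp d k) := by
    rw [← ENNReal.ofReal_one]; exact ENNReal.ofReal_le_ofReal (one_le_pexp hk)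
  choose! r hr hloc using h
  obtain ⟨δ, hδ, hleb⟩ := lebesgue_number_lemma_of_metric (hS.prod hS')
    (c := fun i : S ×ˢ S' => Metric.ball i.1 (r i.1.1 i.1.2)) (fun i => Metric.isOpen_ball)
    (fun x hx => Set.mem_iUnion.2 ⟨⟨x, hx⟩, Metric.mem_ball_self (hr _ hx.1 _ hx.2)⟩)
  set ρ := 4 / δ with hρd
  have hρ : 0 < ρ := by positivity
  have hcell : ∀ {ξ ξ' : Fin d → ℝ}, cellIdx ρ ξ = cellIdx ρ ξ' → dist ξ ξ' < δ := fun he => by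
    rw [dist_eq_norm]
    refine (norm_sub_le_of_cellIdx_eq hρ he).trans_lt ?_
    rw [hρd, div_div_eq_mul_div, div_lt_iff₀ (by norm_num)]
    linarith
  obtain ⟨N, hN⟩ := IsCompact.exists_cells hS hρ
  obtain ⟨N', hN'⟩ := IsCompact.exists_cells hS' hρ
  have hpair : ∀ x : (Fin d → ℤ) × (Fin d → ℤ), ∃ C : ℝ, 0 ≤ C ∧ ∀ R : ℝ, 1 ≤ R →
      ∀ (a b : ℝ), 0 ≤ a → 0 ≤ b →
      ∀ f g : (Fin d → ℝ) → ℂ, AEStronglyMeasurable f → AEStronglyMeasurable g →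
      (∀ ξ, ξ ∉ S → f ξ = 0) → (∀ ξ, ξ ∉ S' → g ξ = 0) →
      ∫⁻ ξ, ‖f ξ‖ₑ ^ 2 ≤ ENNReal.ofReal (a ^ 2) → ∫⁻ ξ, ‖g ξ‖ₑ ^ 2 ≤ ENNReal.ofReal (b ^ 2) → ∀ w₀,
      eLpNorm (fun w => extE Φ (cellPart ρ f x.1) w * extE Φ (cellPart ρ g x.2) w)
        (ENNReal.ofReal (pexp d k)) (volume.restrict (Metric.closedBall w₀ R)) ≤
        ENNReal.ofReal (C * R ^ α * (a * b)) := by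
    intro x
    have hzero : ∀ {T : Set (Fin d → ℝ)} {q : Fin d → ℤ} {f : (Fin d → ℝ) → ℂ},
        (∀ ξ, ξ ∉ T → f ξ = 0) → (¬ ∃ ξ ∈ T, cellIdx ρ ξ = q) → ∀ w,
        extE Φ (cellPart ρ f q) w = 0 := by
      intro T q f hf hq w
      refine integral_eq_zero_of_ae (ae_of_all _ fun ξ => ?_)
      simp only [Pi.zero_apply]
      rw [cellPart_apply]
      split_ifs with h
      · rw [hf ξ fun hξ => hq ⟨ξ, hξ, h⟩, mul_zero]
      · rw [mul_zero]
    by_cases h1 : ∃ ξ ∈ S, cellIdx ρ ξ = x.1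
    · by_cases h2 : ∃ ξ ∈ S', cellIdx ρ ξ = x.2
      · obtain ⟨y, hy, hyx⟩ := h1
        obtain ⟨y', hy', hyx'⟩ := h2
        obtain ⟨⟨⟨ν, ν'⟩, hν⟩, hi⟩ := hleb (y, y') ⟨hy, hy'⟩
        obtain ⟨C, hC, hb⟩ := hloc ν hν.1 ν' hν.2
        refine ⟨C, hC, fun R hR a b ha hb' f g hf hg hfS hgS hfa hgb w₀ =>
          hb R hR a b ha hb' _ _ ⟨aestronglyMeasurable_cellPart hf _, fun ξ hξ => ?_,
            (lintegral_cellPart_le ρ f _).trans hfa⟩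
            ⟨aestronglyMeasurable_cellPart hg _, fun ξ hξ => ?_,
            (lintegral_cellPart_le ρ g _).trans hgb⟩ w₀⟩
        · rw [cellPart_apply, if_neg]
          intro he
          have hm : (ξ, y') ∈ Metric.ball (y, y') δ := by
            rw [Metric.mem_ball, Prod.dist_eq, dist_self]
            exact max_lt (hcell (he.trans hyx.symm)) hδ
          have hm2 := hi hm
          rw [Metric.mem_ball, Prod.dist_eq] at hm2
          have := (le_max_left _ _).trans_lt hm2
          rw [dist_eq_norm] at this
          exact lt_asymm hξ this
        · rw [cellPart_apply, if_neg]
          intro he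
          have hm : (y, ξ) ∈ Metric.ball (y, y') δ := by
            rw [Metric.mem_ball, Prod.dist_eq, dist_self]
            exact max_lt hδ (hcell (he.trans hyx'.symm))
          have hm2 := hi hm
          rw [Metric.mem_ball, Prod.dist_eq] at hm2
          have := (le_max_right _ _).trans_lt hm2
          rw [dist_eq_norm] at this
          exact lt_asymm hξ this
      · refine ⟨0, le_rfl, fun R hR a b ha hb f g hf hg hfS hgS hfa hgb w₀ => ?_⟩
        simp only [hzero hgS h2, mul_zero, eLpNorm_zero']
        exact bot_le
    · refine ⟨0, le_rfl, fun R hR a b ha hb f g hf hg hfS hgS hfa hgb w₀ => ?_⟩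
      simp only [hzero hfS h1, zero_mul, eLpNorm_zero']
      exact bot_le
  choose C hC hpair using hpair
  refine ⟨∑ x ∈ N ×ˢ N', C x, Finset.sum_nonneg fun x _ => hC x,
    fun R hR a b ha hb f g hf hg hfS hgS hfa hgb w₀ => ?_⟩
  have hint : ∀ {T : Set (Fin d → ℝ)} {u : (Fin d → ℝ) → ℂ} {e : ℝ}, IsCompact T → 0 ≤ e →
      AEStronglyMeasurable u → (∀ ξ, ξ ∉ T → u ξ = 0) →
      ∫⁻ ξ, ‖u ξ‖ₑ ^ 2 ≤ ENNReal.ofReal (e ^ 2) → Integrable u := by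
    intro T u e hT he hu huT hue
    obtain ⟨B, hB⟩ := hT.isBounded.exists_norm_le
    refine Adm.integrable (ν := 0) (r := |B|) ⟨hu, fun ξ hξ => huT ξ fun hξT => ?_, hue⟩
      (abs_nonneg B) he
    have := hB ξ hξT
    rw [sub_zero] at hξ
    linarith [le_abs_self B]
  have hfi := hint hS ha hf hfS hfa
  have hgi := hint hS' hb hg hgS hgb
  have hcont : ∀ {u : (Fin d → ℝ) → ℂ}, Integrable u → ∀ q, Continuous (extE Φ (cellPart ρ u q)) :=
    fun hu q => continuous_extE hΦ (hu.indicator (measurable_cellIdx ρ (measurableSet_singleton q)))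
  have hsum : (fun w => extE Φ f w * extE Φ g w) = ∑ x ∈ N ×ˢ N', fun w =>
      extE Φ (cellPart ρ f x.1) w * extE Φ (cellPart ρ g x.2) w := by
    funext w
    rw [Finset.sum_apply, extE_eq_sum_cellPart hΦ hN hfi hfS, extE_eq_sum_cellPart hΦ hN' hgi hgS,
      Finset.sum_mul_sum, Finset.sum_product]
  rw [hsum]
  refine (eLpNorm_sum_le (fun x _ => ((hcont hfi x.1).mul (hcont hgi x.2)).aestronglyMeasurable)
    hp).trans ?_
  rw [Finset.sum_mul, Finset.sum_mul, ENNReal.ofReal_sum_of_nonneg fun x _ => by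
    have := hC x; positivity]
  exact Finset.sum_le_sum fun x _ => hpair x R hR a b ha hb f g hf hg hfS hgS hfa hgb w₀

end Globalize

section Final
variable {d k : ℕ}

lemma isCompact_of_isClosedCube {S : Set (Fin d → ℝ)} (hS : IsClosedCube d S) : IsCompact S := by
  obtain ⟨a, r, hr, rfl⟩ := hS
  have h : {x : Fin d → ℝ | ∀ i, |x i - a i| ≤ r} = Metric.closedBall a r := by
    ext x
    rw [mem_closedBall_iff_norm, pi_norm_le_iff_of_nonneg hr]
    rfl
  exact h ▸ isCompact_closedBall a r

lemma extOp_eq_extE {S : Set (Fin d → ℝ)} (hS : MeasurableSet S) (Φ : (Fin d → ℝ) → Fin k → ℝ)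
    (f : (Fin d → ℝ) → ℂ) : extOp d k S Φ f = extE Φ (S.indicator f) := by
  funext w
  rw [extOp, extE, ← integral_indicator hS]
  refine integral_congr_ae (ae_of_all _ fun ξ => ?_)
  by_cases hξ : ξ ∈ S
  · simp only [Set.indicator_of_mem hξ]
    rfl
  · simp only [Set.indicator_of_notMem hξ, mul_zero]

lemma extE_eq_zero_of_not_aestronglyMeasurable {Φ : (Fin d → ℝ) → Fin k → ℝ} (hΦ : Measurable Φ)
    {f : (Fin d → ℝ) → ℂ} (hf : ¬ AEStronglyMeasurable f) (w : (Fin d → ℝ) × (Fin k → ℝ)) :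
    extE Φ f w = 0 := by
  refine integral_non_aestronglyMeasurable fun h => hf ?_
  have hm : Measurable fun ξ => ec (-(w.1 ⬝ᵥ ξ + w.2 ⬝ᵥ Φ ξ)) := by
    refine measurable_ec.comp ?_
    unfold dotProduct
    fun_prop
  refine (hm.aestronglyMeasurable.mul h).congr (ae_of_all _ fun ξ => ?_)
  rw [Pi.mul_apply, ← mul_assoc, ← ec_add, neg_add_cancel, ec_zero, one_mul]

lemma extE_eq_zero_of_eLpNorm_eq_zero (Φ : (Fin d → ℝ) → Fin k → ℝ) {f : (Fin d → ℝ) → ℂ}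
    (hf : AEStronglyMeasurable f) (h : eLpNorm f 2 volume = 0) (w : (Fin d → ℝ) × (Fin k → ℝ)) :
    extE Φ f w = 0 := by
  refine integral_eq_zero_of_ae ?_
  filter_upwards [(eLpNorm_eq_zero_iff hf two_ne_zero).1 h] with ξ hξ
  simp [hξ]

lemma lintegral_sq_eq_eLpNorm_sq (f : (Fin d → ℝ) → ℂ) :
    ∫⁻ ξ, ‖f ξ‖ₑ ^ 2 = eLpNorm f 2 volume ^ 2 := by
  rw [eLpNorm_eq_lintegral_rpow_enorm_toReal two_ne_zero ofNat_ne_top, ← ENNReal.rpow_natCast,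
    ← ENNReal.rpow_mul]
  simp

lemma cubeQ_subset {R : ℝ} (hR : 0 ≤ R) (c : (Fin d → ℝ) × (Fin k → ℝ)) :
    cubeQ d k R c ⊆ Metric.closedBall c R := by
  rintro w ⟨h1, h2⟩
  rw [mem_closedBall_iff_norm, Prod.norm_def, sup_le_iff, pi_norm_le_iff_of_nonneg hR,
    pi_norm_le_iff_of_nonneg hR]
  exact ⟨fun i => (h1 i).trans (by linarith), fun j => (h2 j).trans (by linarith)⟩

/-- A bilinear estimate for measurable functions of finite norm extends to all functions. -/
lemma eLpNorm_extOp_mul_le {Φ : (Fin d → ℝ) → Fin k → ℝ} (hΦ : Measurable Φ)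
    {S₁ S₂ : Set (Fin d → ℝ)} (hS₁ : MeasurableSet S₁) (hS₂ : MeasurableSet S₂) {p : ℝ≥0∞}
    {μ : Measure ((Fin d → ℝ) × (Fin k → ℝ))} {C : ℝ} (hC : 0 < C)
    (h : ∀ (a b : ℝ), 0 ≤ a → 0 ≤ b →
      ∀ f g : (Fin d → ℝ) → ℂ, AEStronglyMeasurable f → AEStronglyMeasurable g →
      (∀ ξ, ξ ∉ S₁ → f ξ = 0) → (∀ ξ, ξ ∉ S₂ → g ξ = 0) →
      ∫⁻ ξ, ‖f ξ‖ₑ ^ 2 ≤ ENNReal.ofReal (a ^ 2) → ∫⁻ ξ, ‖g ξ‖ₑ ^ 2 ≤ ENNReal.ofReal (b ^ 2) →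
      eLpNorm (fun w => extE Φ f w * extE Φ g w) p μ ≤ ENNReal.ofReal (C * (a * b)))
    (f g : (Fin d → ℝ) → ℂ) :
    eLpNorm (fun w => extOp d k S₁ Φ f w * extOp d k S₂ Φ g w) p μ ≤
      ENNReal.ofReal C * eLpNorm f 2 volume * eLpNorm g 2 volume := by
  rw [extOp_eq_extE hS₁, extOp_eq_extE hS₂]
  set F := S₁.indicator f with hF
  set G := S₂.indicator g with hG
  have hFf : eLpNorm F 2 volume ≤ eLpNorm f 2 volume := eLpNorm_indicator_le f
  have hGg : eLpNorm G 2 volume ≤ eLpNorm g 2 volume := eLpNorm_indicator_le g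
  refine le_trans ?_ (mul_le_mul' (mul_le_mul' le_rfl hFf) hGg)
  have hz : (∀ w, extE Φ F w * extE Φ G w = 0) →
      eLpNorm (fun w => extE Φ F w * extE Φ G w) p μ ≤
        ENNReal.ofReal C * eLpNorm F 2 volume * eLpNorm G 2 volume := fun h0 => by
    simp only [h0, eLpNorm_zero']
    exact bot_le
  by_cases hFm : AEStronglyMeasurable F
  swap
  · exact hz fun w => by rw [extE_eq_zero_of_not_aestronglyMeasurable hΦ hFm, zero_mul]
  by_cases hGm : AEStronglyMeasurable G
  swap
  · exact hz fun w => by rw [extE_eq_zero_of_not_aestronglyMeasurable hΦ hGm, mul_zero]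
  by_cases hF0 : eLpNorm F 2 volume = 0
  · exact hz fun w => by rw [extE_eq_zero_of_eLpNorm_eq_zero Φ hFm hF0, zero_mul]
  by_cases hG0 : eLpNorm G 2 volume = 0
  · exact hz fun w => by rw [extE_eq_zero_of_eLpNorm_eq_zero Φ hGm hG0, mul_zero]
  have hC' : ENNReal.ofReal C ≠ 0 := (ENNReal.ofReal_pos.2 hC).ne'
  by_cases hFt : eLpNorm F 2 volume = ∞
  · rw [hFt, ENNReal.mul_top hC', ENNReal.top_mul hG0]
    exact le_top
  by_cases hGt : eLpNorm G 2 volume = ∞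
  · rw [hGt, ENNReal.mul_top (mul_ne_zero hC' hF0)]
    exact le_top
  have hsq : ∀ u : (Fin d → ℝ) → ℂ, eLpNorm u 2 volume ≠ ∞ →
      ∫⁻ ξ, ‖u ξ‖ₑ ^ 2 ≤ ENNReal.ofReal ((eLpNorm u 2 volume).toReal ^ 2) := fun u hu => by
    rw [ENNReal.ofReal_pow ENNReal.toReal_nonneg, ENNReal.ofReal_toReal hu,
      lintegral_sq_eq_eLpNorm_sq]
  refine (h _ _ ENNReal.toReal_nonneg ENNReal.toReal_nonneg F G hFm hGm
    (fun ξ hξ => Set.indicator_of_notMem hξ _) (fun ξ hξ => Set.indicator_of_notMem hξ _)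
    (hsq F hFt) (hsq G hGt)).trans (le_of_eq ?_)
  rw [ENNReal.ofReal_mul hC.le, ENNReal.ofReal_mul ENNReal.toReal_nonneg, ENNReal.ofReal_toReal hFt,
    ENNReal.ofReal_toReal hGt, mul_assoc]

end Final

/-- **Theorem 2 (local bilinear estimate under the normal-direction condition).**
Assume that for all `ν₁ ∈ S₁`, `ν₂ ∈ S₂` the rows of `D(ν₁,ν₂)` are linearly
independent, and that for every `(d-k) × d` matrix `N` with orthonormal rows
orthogonal to the rows of `D(ν₁,ν₂)` one has
`det (N (∑ tᵢ Hφᵢ(ν)) Nᵀ) ≠ 0` for `|t| = 1`, `ν ∈ {ν₁, ν₂}`. Then for every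
`α > 0` there is `C_α` such that for every cube `Q_R` of sidelength `R ≥ 2`,
`‖E₁f · E₂g‖_{L^{(d+3k)/(d+k)}(Q_R)} ≤ C_α R^α ‖f‖₂ ‖g‖₂`. -/
theorem bilinear_restriction_local
    (d k : ℕ) (hdk : k ≤ d) (hk : 1 ≤ k)
    (Φ : (Fin d → ℝ) → Fin k → ℝ) (hΦ : ContDiff ℝ (⊤ : ℕ∞) Φ)
    (S₁ S₂ : Set (Fin d → ℝ))
    (hS₁ : IsClosedCube d S₁) (hS₂ : IsClosedCube d S₂)
    (hS₁I : S₁ ⊆ Set.Icc (-1) 1) (hS₂I : S₂ ⊆ Set.Icc (-1) 1)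
    (hind : ∀ ν₁ ∈ S₁, ∀ ν₂ ∈ S₂,
      LinearIndependent ℝ (fun j : Fin k => Dmat d k Φ ν₁ ν₂ j))
    (hN : ∀ ν₁ ∈ S₁, ∀ ν₂ ∈ S₂, ∀ N : Matrix (Fin (d - k)) (Fin d) ℝ,
      N * Nᵀ = 1 → N * (Dmat d k Φ ν₁ ν₂)ᵀ = 0 →
      ∀ t : Fin k → ℝ, (∑ i, t i ^ 2) = 1 → ∀ ν, (ν = ν₁ ∨ ν = ν₂) →
      (N * tHess d k Φ t ν * Nᵀ).det ≠ 0) :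
    ∀ α : ℝ, 0 < α → ∃ C : ℝ, ∀ R : ℝ, 2 ≤ R →
      ∀ c : (Fin d → ℝ) × (Fin k → ℝ), ∀ f g : (Fin d → ℝ) → ℂ,
      eLpNorm (fun w => extOp d k S₁ Φ f w * extOp d k S₂ Φ g w)
          (ENNReal.ofReal (((d : ℝ) + 3 * k) / ((d : ℝ) + k)))
          (volume.restrict (cubeQ d k R c)) ≤
        ENNReal.ofReal (C * R ^ α) * eLpNorm f 2 volume * eLpNorm g 2 volume := by
  intro α hα
  have hc₁ := isCompact_of_isClosedCube hS₁
  have hc₂ := isCompact_of_isClosedCube hS₂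
  have hΦm : Measurable Φ := hΦ.continuous.measurable
  obtain ⟨C, hC, h⟩ := exists_bilinear_of_locBil hk hΦm hc₁ hc₂ (α := α) fun ν₁ h₁ ν₂ h₂ =>
    TransCond.exists_locBil hdk hk hΦ
      (transCond_of_left hΦ (hind ν₁ h₁ ν₂ h₂)
        fun N hNN hND t ht => hN ν₁ h₁ ν₂ h₂ N hNN hND t ht ν₁ (Or.inl rfl))
      (transCond_of_right hΦ (hind ν₁ h₁ ν₂ h₂)
        fun N hNN hND t ht => hN ν₁ h₁ ν₂ h₂ N hNN hND t ht ν₂ (Or.inr rfl)) hα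
  refine ⟨C + 1, fun R hR c f g => ?_⟩
  have hR0 : 0 < R := by linarith
  refine eLpNorm_extOp_mul_le hΦm hc₁.measurableSet hc₂.measurableSet (by positivity)
    (fun a b ha hb u v hu hv huS hvS hua hvb => ?_) f g
  refine (eLpNorm_mono_measure _ (Measure.restrict_mono (cubeQ_subset hR0.le c) le_rfl)).trans ?_
  refine (h R (by linarith) a b ha hb u v hu hv huS hvS hua hvb c).trans
    (ENNReal.ofReal_le_ofReal ?_)
  gcongr
  linarith

end
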